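/- arXiv:1101.5830 — 2 statements merged into one kernel-verified Lean document; each statement's English description precedes it below -/
import Mathlib

section
/- There exists an integer n₀ such that for every integer n ≥ n₀ divisible by 3, every 3-graph H on n vertices with δ₁(H) ≥ C(n−1,2) − C(2n/3,2) + 1 contains a perfect matching. -/
open Finset

/-- `R` is the (ordered) edge relation of a 3-graph. -/
structure IsTripleRel {V : Type*} (R : V → V → V → Prop) : Prop where
  swap : ∀ {x y z}, R x y z → R y x z
  rot : ∀ {x y z}, R x y z → R y z x
  ne : ∀ {x y z}, R x y z → x ≠ y

/-- A vertex set that is a disjoint union of edges. -/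
inductive Matchable {V : Type*} [DecidableEq V] (R : V → V → V → Prop) : Finset V → Prop
  | empty : Matchable R ∅
  | step {S : Finset V} {x y z : V} : Matchable R S → R x y z → x ∉ S → y ∉ S → z ∉ S →
      Matchable R (insert x (insert y (insert z S)))

section
variable {V : Type*} {R : V → V → V → Prop}

namespace IsTripleRel

lemma ne' (hR : IsTripleRel R) {x y z : V} (h : R x y z) : y ≠ z ∧ x ≠ z :=
  ⟨hR.ne (hR.rot h), (hR.ne (hR.rot (hR.rot h))).symm⟩

lemma swap₂ (hR : IsTripleRel R) {x y z : V} (h : R x y z) : R x z y :=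
  hR.rot (hR.swap h)

end IsTripleRel

variable [DecidableEq V]

namespace Matchable

lemma union {S T : Finset V} (hS : Matchable R S) (hT : Matchable R T) (h : Disjoint S T) :
    Matchable R (S ∪ T) := by
  induction hS with
  | empty => simpa using hT
  | @step S x y z hS hr hx hy hz ih =>
    simp only [disjoint_insert_left] at h
    obtain ⟨h1, h2, h3, h4⟩ := h
    simp only [insert_union]
    exact step (ih h4) hr (by simp [*]) (by simp [*]) (by simp [*])

lemma single {x y z : V} (h : R x y z) : Matchable R {x, y, z} := by
  simpa using step empty h (by simp) (by simp) (by simp)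

lemma card_step (hR : IsTripleRel R) {S : Finset V} {x y z : V} (h : R x y z) (hx : x ∉ S)
    (hy : y ∉ S) (hz : z ∉ S) : (insert x (insert y (insert z S))).card = S.card + 3 := by
  have := hR.ne h
  have := hR.ne' h
  rw [card_insert_of_notMem, card_insert_of_notMem, card_insert_of_notMem] <;> simp [*]

lemma biUnion {ι : Type*} [DecidableEq ι] (I : Finset ι) (f : ι → Finset V)
    (hf : ∀ i ∈ I, Matchable R (f i))
    (hd : ∀ i ∈ I, ∀ j ∈ I, i ≠ j → Disjoint (f i) (f j)) : Matchable R (I.biUnion f) := by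
  induction I using Finset.induction_on with
  | empty => simpa using empty
  | insert i I hi ih =>
    rw [biUnion_insert]
    refine union (hf _ (by simp)) (ih (fun j hj => hf _ (by simp [hj]))
      fun a ha b hb => hd a (by simp [ha]) b (by simp [hb])) ?_
    rw [disjoint_biUnion_right]
    intro j hj
    exact hd i (by simp) j (by simp [hj]) (by rintro rfl; exact hi hj)

/-- A matchable set can be enumerated by the edges of a perfect matching of it. -/
lemma exists_family (hR : IsTripleRel R) {S : Finset V} (hS : Matchable R S) :
    ∃ (ι : Type) (_ : Fintype ι) (_ : DecidableEq ι) (f : ι → Fin 3 → V),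
      (∀ i, R (f i 0) (f i 1) (f i 2)) ∧ (∀ i a j b, f i a = f j b → i = j ∧ a = b) ∧
      (∀ v, v ∈ S ↔ ∃ i a, f i a = v) := by
  induction hS with
  | empty => exact ⟨Empty, inferInstance, inferInstance, fun i => i.elim, by simp, by simp, by simp⟩
  | @step S x y z hS hr hx hy hz ih =>
    obtain ⟨ι, _, _, f, h1, h2, h3⟩ := ih
    have hxy := hR.ne hr
    obtain ⟨hyz, hxz⟩ := hR.ne' hr
    have hmem : ∀ i a, f i a ∈ S := fun i a => (h3 _).2 ⟨i, a, rfl⟩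
    refine ⟨Option ι, inferInstance, inferInstance,
      fun o => o.elim ![x, y, z] f, ?_, ?_, ?_⟩
    · rintro (_ | i)
      · simpa using hr
      · simpa using h1 i
    · have key : ∀ i b a, f i b ≠ (![x, y, z] : Fin 3 → V) a := by
        intro i b a h
        have := hmem i b
        fin_cases a <;> simp_all
      rintro (_ | i) a (_ | j) b h
      · refine ⟨rfl, ?_⟩
        fin_cases a <;> fin_cases b <;> simp_all
      · exact absurd h.symm (key _ _ _)
      · exact absurd h (key _ _ _)
      · obtain ⟨rfl, rfl⟩ := h2 _ _ _ _ h
        exact ⟨rfl, rfl⟩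
    · intro v
      simp only [mem_insert, h3]
      constructor
      · rintro (rfl | rfl | rfl | ⟨i, a, rfl⟩)
        · exact ⟨none, 0, rfl⟩
        · exact ⟨none, 1, rfl⟩
        · exact ⟨none, 2, rfl⟩
        · exact ⟨some i, a, rfl⟩
      · rintro ⟨_ | i, a, rfl⟩
        · fin_cases a <;> simp
        · exact Or.inr (Or.inr (Or.inr ⟨i, a, rfl⟩))

/-- Extract the perfect matching witnessing matchability. -/
lemma exists_matching {H : Finset (Finset V)} {S : Finset V}
    (hS : Matchable (fun x y z => ({x, y, z} : Finset V) ∈ H) S) :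
    ∃ M ⊆ H, (M : Set (Finset V)).Pairwise (fun e f => Disjoint e f) ∧
      (∀ e ∈ M, e ⊆ S) ∧ ∀ v ∈ S, ∃ e ∈ M, v ∈ e := by
  induction hS with
  | empty => exact ⟨∅, by simp, by simp, by simp, by simp⟩
  | @step S x y z hS hr hx hy hz ih =>
    obtain ⟨M, hM, hp, hs, hc⟩ := ih
    refine ⟨insert {x, y, z} M, insert_subset hr hM, ?_, ?_, ?_⟩
    · rw [coe_insert]
      have hd : ∀ e ∈ M, Disjoint e {x, y, z} := by
        intro e he
        simp only [disjoint_insert_right, disjoint_singleton_right]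
        exact ⟨fun h => hx (hs e he h), fun h => hy (hs e he h), fun h => hz (hs e he h)⟩
      exact hp.insert fun e he _ => ⟨(hd e he).symm, hd e he⟩
    · intro e he
      rw [mem_insert] at he
      rcases he with rfl | he
      · intro v; simp only [mem_insert, mem_singleton]; tauto
      · intro v hv
        simp [hs e he hv]
    · intro v hv
      simp only [mem_insert] at hv
      by_cases h : v ∈ S
      · obtain ⟨e, he, hve⟩ := hc v h
        exact ⟨e, by simp [he], hve⟩
      · exact ⟨{x, y, z}, by simp, by simp; tauto⟩

end Matchable
end

section
open scoped Classical

/-- The number of pairs in `P` that form an edge with `v`. -/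
noncomputable def pairDeg {V : Type*} (R : V → V → V → Prop) (v : V) (P : Finset (V × V)) : ℕ :=
  (P.filter fun p => R v p.1 p.2).card

/-- The number of pairs in `P` that do not form an edge with `v`. -/
noncomputable def pairCodeg {V : Type*} (R : V → V → V → Prop) (v : V) (P : Finset (V × V)) : ℕ :=
  (P.filter fun p => ¬ R v p.1 p.2).card

variable {V : Type*} {R : V → V → V → Prop}

lemma pairDeg_add_pairCodeg (v : V) (P : Finset (V × V)) :
    pairDeg R v P + pairCodeg R v P = P.card :=
  card_filter_add_card_filter_not _

lemma pairDeg_mono (v : V) {P Q : Finset (V × V)} (h : P ⊆ Q) : pairDeg R v P ≤ pairDeg R v Q :=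
  card_le_card (filter_subset_filter _ h)

lemma pairCodeg_mono (v : V) {P Q : Finset (V × V)} (h : P ⊆ Q) :
    pairCodeg R v P ≤ pairCodeg R v Q :=
  card_le_card (filter_subset_filter _ h)

variable [DecidableEq V]

/-- `S ⊆ A` is matched into pairs `(y s, z s)` of distinct elements of `B`. -/
structure IsPairing (R : V → V → V → Prop) (A B S : Finset V) (y z : V → V) : Prop where
  sub : S ⊆ A
  memy : ∀ s ∈ S, y s ∈ B
  memz : ∀ s ∈ S, z s ∈ B
  injy : ∀ s ∈ S, ∀ t ∈ S, y s = y t → s = t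
  injz : ∀ s ∈ S, ∀ t ∈ S, z s = z t → s = t
  ne : ∀ s ∈ S, ∀ t ∈ S, y s ≠ z t
  rel : ∀ s ∈ S, R s (y s) (z s)

namespace IsPairing

variable {A B S : Finset V} {y z : V → V}

lemma card_union (h : IsPairing R A B S y z) : (S.image y ∪ S.image z).card = 2 * S.card := by
  rw [card_union_of_disjoint, card_image_of_injOn, card_image_of_injOn, two_mul]
  · exact fun a ha b hb => h.injz a ha b hb
  · exact fun a ha b hb => h.injy a ha b hb
  · rw [disjoint_left]
    intro v h1 h2
    rw [mem_image] at h1 h2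
    obtain ⟨s, hs, rfl⟩ := h1
    obtain ⟨t, ht, h3⟩ := h2
    exact h.ne s hs t ht h3.symm

lemma union_subset (h : IsPairing R A B S y z) : S.image y ∪ S.image z ⊆ B := by
  intro v hv
  simp only [mem_union, mem_image] at hv
  rcases hv with ⟨s, hs, rfl⟩ | ⟨s, hs, rfl⟩
  · exact h.memy s hs
  · exact h.memz s hs

lemma matchable (h : IsPairing R A B S y z) (hAB : Disjoint A B) :
    Matchable R (S ∪ (S.image y ∪ S.image z)) := by
  have : S ∪ (S.image y ∪ S.image z) = S.biUnion fun s => {s, y s, z s} := by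
    ext v; simp only [mem_union, mem_image, mem_biUnion, mem_insert, mem_singleton]; grind
  rw [this]
  refine Matchable.biUnion _ _ (fun s hs => Matchable.single (h.rel s hs)) ?_
  intro s hs t ht hst
  have h1 := h.injy s hs t ht
  have h2 := h.injz s hs t ht
  have h3 := h.ne s hs t ht
  have h4 := h.ne t ht s hs
  have h5 : ∀ u ∈ S, ∀ v ∈ B, u ≠ v := fun u hu v hv =>
    disjoint_iff_ne.1 hAB u (h.sub hu) v hv
  have := h5 s hs _ (h.memy t ht)
  have := h5 s hs _ (h.memz t ht)
  have := h5 t ht _ (h.memy s hs)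
  have := h5 t ht _ (h.memz s hs)
  simp only [disjoint_insert_left, disjoint_singleton_left, mem_insert, mem_singleton]
  grind

lemma extend_free (h : IsPairing R A B S y z) {a b c : V} (ha : a ∈ A)
    (hb : b ∈ B) (hc : c ∈ B) (hbS : b ∉ S.image y ∪ S.image z)
    (hcS : c ∉ S.image y ∪ S.image z) (hbc : b ≠ c) (hr : R a b c) :
    IsPairing R A B (insert a S) (fun s => if s = a then b else y s)
      (fun s => if s = a then c else z s) := by
  simp only [mem_union, mem_image, not_or, not_exists, not_and] at hbS hcS
  obtain ⟨h1, h2, h3, h4, h5, h6, h7⟩ := h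
  constructor <;> grind

lemma extend_swap (h : IsPairing R A B S y z) {a b c s t : V} (ha : a ∈ A)
    (hb : b ∈ B) (hc : c ∈ B) (hbS : b ∉ S.image y ∪ S.image z)
    (hcS : c ∉ S.image y ∪ S.image z) (hbc : b ≠ c) (hs : s ∈ S) (ht : t ∈ S) (hst : s ≠ t)
    (h1 : R a (y s) (z t)) (h2 : R t b (z s)) (h3 : R s (y t) c) :
    IsPairing R A B (insert a S)
      (fun u => if u = a then y s else if u = t then b else if u = s then y t else y u)
      (fun u => if u = a then z t else if u = t then z s else if u = s then c else z u) := by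
  simp only [mem_union, mem_image, not_or, not_exists, not_and] at hbS hcS
  obtain ⟨k1, k2, k3, k4, k5, k6, k7⟩ := h
  constructor <;> grind

end IsPairing

omit [DecidableEq V] in
lemma card_bad_pairs_le {S : Finset V} (f : V × V → V × V) (Q : Finset (V × V)) (v : V) {c : ℕ} (hQ : pairCodeg R v Q ≤ c)
    (hf : ∀ p ∈ S ×ˢ S, f p ∈ Q) (hinj : Set.InjOn f (S ×ˢ S : Finset (V × V))) :
    ((S ×ˢ S).filter fun p => ¬ R v (f p).1 (f p).2).card ≤ c := by
  refine le_trans (card_le_card_of_injOn f ?_ (hinj.mono (coe_subset.2 (filter_subset _ _)))) hQ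
  intro p hp
  simp only [coe_filter, Set.mem_ofPred_eq] at hp ⊢
  exact ⟨hf p hp.1, hp.2⟩

/-- If the swap of `IsPairing.extend_swap` is never possible then the pairing is small. -/
lemma IsPairing.sq_card_le {A B S : Finset V} {y z : V → V} (h : IsPairing R A B S y z)
    {a b d : V} {c : ℕ} (ha : pairCodeg R a (B ×ˢ B) ≤ c) (hb : pairCodeg R b (A ×ˢ B) ≤ c)
    (hd : pairCodeg R d (A ×ˢ B) ≤ c)
    (hno : ¬ ∃ s ∈ S, ∃ t ∈ S, s ≠ t ∧ R a (y s) (z t) ∧ R b t (z s) ∧ R d s (y t)) :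
    S.card * S.card ≤ S.card + 3 * c := by
  have hbad1 := card_bad_pairs_le (fun p => (y p.1, z p.2)) (B ×ˢ B) a (ha)
    (fun p hp => by
      rw [mem_product] at hp ⊢; exact ⟨h.memy _ hp.1, h.memz _ hp.2⟩)
    (fun p hp q hq hpq => by
      simp only [coe_product, Set.mem_prod, mem_coe, Prod.mk.injEq] at hp hq hpq
      exact Prod.ext (h.injy _ hp.1 _ hq.1 hpq.1) (h.injz _ hp.2 _ hq.2 hpq.2))
  have hbad2 := card_bad_pairs_le (fun p => (p.2, z p.1)) (A ×ˢ B) b (hb)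
    (fun p hp => by
      rw [mem_product] at hp ⊢; exact ⟨h.sub hp.2, h.memz _ hp.1⟩)
    (fun p hp q hq hpq => by
      simp only [coe_product, Set.mem_prod, mem_coe, Prod.mk.injEq] at hp hq hpq
      exact Prod.ext (h.injz _ hp.1 _ hq.1 hpq.2) hpq.1)
  have hbad3 := card_bad_pairs_le (fun p => (p.1, y p.2)) (A ×ˢ B) d hd
    (fun p hp => by
      rw [mem_product] at hp ⊢; exact ⟨h.sub hp.1, h.memy _ hp.2⟩)
    (fun p hp q hq hpq => by
      simp only [coe_product, Set.mem_prod, mem_coe, Prod.mk.injEq] at hp hq hpq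
      exact Prod.ext hpq.1 (h.injy _ hp.2 _ hq.2 hpq.2))
  obtain ⟨F₁, hF₁⟩ : ∃ F, F = (S ×ˢ S).filter fun p => ¬ R a (y p.1) (z p.2) := ⟨_, rfl⟩
  obtain ⟨F₂, hF₂⟩ : ∃ F, F = (S ×ˢ S).filter fun p => ¬ R b p.2 (z p.1) := ⟨_, rfl⟩
  obtain ⟨F₃, hF₃⟩ : ∃ F, F = (S ×ˢ S).filter fun p => ¬ R d p.1 (y p.2) := ⟨_, rfl⟩
  have hsub : S ×ˢ S ⊆ S.diag ∪ (F₁ ∪ (F₂ ∪ F₃)) := by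
    intro p hp
    rw [mem_product] at hp
    simp only [hF₁, hF₂, hF₃, mem_union, mem_filter, mem_diag, mem_product]
    by_contra hcon
    exact hno ⟨p.1, hp.1, p.2, hp.2, by tauto⟩
  have h2 := card_le_card hsub
  rw [card_product] at h2
  have h3 := card_union_le S.diag (F₁ ∪ (F₂ ∪ F₃))
  have h4 := card_union_le F₁ (F₂ ∪ F₃)
  have h5 := card_union_le F₂ F₃
  rw [diag_card] at h3
  have e1 : F₁.card ≤ c := hF₁ ▸ hbad1
  have e2 : F₂.card ≤ c := hF₂ ▸ hbad2
  have e3 : F₃.card ≤ c := hF₃ ▸ hbad3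
  linarith

/-- Nearly complete `A`-`B`-`B` 3-graphs with `|B| = 2|A|` have a perfect matching. -/
theorem matchable_of_pairCodeg_le (hR : IsTripleRel R) {A B : Finset V} (hAB : Disjoint A B)
    {c : ℕ} (hcard : B.card = 2 * A.card) (hA : ∀ a ∈ A, pairCodeg R a (B ×ˢ B) ≤ c)
    (hB : ∀ b ∈ B, pairCodeg R b (A ×ˢ B) ≤ c) (hc : 12 * c + 2 * A.card < A.card ^ 2) :
    Matchable R (A ∪ B) := by
  have key : ∀ j ≤ A.card, ∃ S y z, IsPairing R A B S y z ∧ S.card = j := by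
    intro j
    induction j with
    | zero => intro _; exact ⟨∅, id, id, ⟨by simp, by simp, by simp, by simp, by simp, by simp, by simp⟩, rfl⟩
    | succ j ih =>
      intro hj
      obtain ⟨S, y, z, h, rfl⟩ := ih (by omega)
      obtain ⟨a, ha, haS⟩ : ∃ a ∈ A, a ∉ S := by
        by_contra! hcon
        have := card_le_card (show A ⊆ S from hcon)
        omega
      set W := S.image y ∪ S.image z with hW
      have hBW : (B \ W).card = 2 * (A.card - S.card) := by
        rw [card_sdiff_of_subset h.union_subset, h.card_union]; omega
      by_cases hfree : ∃ b ∈ B \ W, ∃ c ∈ B \ W, R a b c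
      · obtain ⟨b, hb, c, hc, hr⟩ := hfree
        rw [mem_sdiff] at hb hc
        exact ⟨_, _, _, h.extend_free ha hb.1 hc.1 hb.2 hc.2 (hR.ne' hr).1 hr,
          card_insert_of_notMem haS⟩
      · have h1 : (B \ W).card ^ 2 ≤ c := by
          refine le_trans ?_ (hA a ha)
          rw [sq, ← card_product]
          refine card_le_card fun p hp => ?_
          rw [mem_product] at hp
          simp only [mem_filter, mem_product]
          push Not at hfree
          exact ⟨⟨(mem_sdiff.1 hp.1).1, (mem_sdiff.1 hp.2).1⟩, hfree _ hp.1 _ hp.2⟩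
        obtain ⟨b, hb, c', hc', hbc⟩ : ∃ b ∈ B \ W, ∃ c ∈ B \ W, b ≠ c :=
          one_lt_card.1 (by omega)
        rw [mem_sdiff] at hb hc'
        by_cases hgood : ∃ s ∈ S, ∃ t ∈ S, s ≠ t ∧ R a (y s) (z t) ∧ R b t (z s) ∧ R c' s (y t)
        · obtain ⟨s, hs, t, ht, hst, r1, r2, r3⟩ := hgood
          exact ⟨_, _, _, h.extend_swap ha hb.1 hc'.1 hb.2 hc'.2 hbc hs ht hst r1
            (hR.swap r2) (hR.rot r3), card_insert_of_notMem haS⟩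
        · have h5 := h.sq_card_le (hA a ha) (hB b hb.1) (hB c' hc'.1) hgood
          rw [hBW] at h1
          obtain ⟨d, hd⟩ : ∃ d, A.card = S.card + d := ⟨A.card - S.card, by omega⟩
          rw [hd] at h1 hc
          rw [Nat.add_sub_cancel_left] at h1
          rcases le_total S.card d with hd | hd
          · nlinarith
          · have := Nat.mul_le_mul hd hd
            nlinarith
  obtain ⟨S, y, z, h, hS⟩ := key A.card le_rfl
  have hSA : S = A := eq_of_subset_of_card_le h.sub hS.ge
  subst hSA
  have : S.image y ∪ S.image z = B :=
    eq_of_subset_of_card_le h.union_subset (by rw [h.card_union, hcard])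
  rw [← this]
  exact h.matchable hAB

end

section
open scoped Classical

variable {V : Type*} {R : V → V → V → Prop}

lemma pairDeg_product (v : V) (S T : Finset V) :
    pairDeg R v (S ×ˢ T) = ∑ s ∈ S, ∑ t ∈ T, if R v s t then 1 else 0 := by
  rw [pairDeg, card_filter, sum_product]

lemma pairCodeg_product (v : V) (S T : Finset V) :
    pairCodeg R v (S ×ˢ T) = ∑ s ∈ S, ∑ t ∈ T, if ¬ R v s t then 1 else 0 := by
  rw [pairCodeg, card_filter, sum_product]

lemma sum_pairDeg_product_comm (hR : IsTripleRel R) (S T U : Finset V) :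
    ∑ s ∈ S, pairDeg R s (T ×ˢ U) = ∑ t ∈ T, pairDeg R t (S ×ˢ U) := by
  simp only [pairDeg_product]
  rw [sum_comm]
  refine sum_congr rfl fun t _ => sum_congr rfl fun s _ => sum_congr rfl fun u _ => ?_
  rw [if_congr ⟨fun h => hR.swap h, fun h => hR.swap h⟩ rfl rfl]

lemma sum_pairCodeg_product_comm (hR : IsTripleRel R) (S T U : Finset V) :
    ∑ s ∈ S, pairCodeg R s (T ×ˢ U) = ∑ t ∈ T, pairCodeg R t (S ×ˢ U) := by
  simp only [pairCodeg_product]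
  rw [sum_comm]
  refine sum_congr rfl fun t _ => sum_congr rfl fun s _ => sum_congr rfl fun u _ => ?_
  rw [if_congr (not_congr ⟨fun h => hR.swap h, fun h => hR.swap h⟩) rfl rfl]

lemma pairDeg_swap (hR : IsTripleRel R) (v : V) (S T : Finset V) :
    pairDeg R v (S ×ˢ T) = pairDeg R v (T ×ˢ S) := by
  simp only [pairDeg_product]
  rw [sum_comm]
  refine sum_congr rfl fun t _ => sum_congr rfl fun s _ => ?_
  rw [if_congr ⟨fun h => hR.swap₂ h, fun h => hR.swap₂ h⟩ rfl rfl]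

lemma pairDeg_le_card (v : V) (P : Finset (V × V)) : pairDeg R v P ≤ P.card :=
  card_filter_le _ _

lemma pairCodeg_le_card (v : V) (P : Finset (V × V)) : pairCodeg R v P ≤ P.card :=
  card_filter_le _ _

variable [DecidableEq V]

lemma pairDeg_union_le (v : V) (P Q : Finset (V × V)) :
    pairDeg R v (P ∪ Q) ≤ pairDeg R v P + pairDeg R v Q := by
  unfold pairDeg
  rw [filter_union]
  exact card_union_le _ _

lemma pairCodeg_union_le (v : V) (P Q : Finset (V × V)) :
    pairCodeg R v (P ∪ Q) ≤ pairCodeg R v P + pairCodeg R v Q := by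
  unfold pairCodeg
  rw [filter_union]
  exact card_union_le _ _

lemma square_subset (S T : Finset V) : S ×ˢ S ⊆ T ×ˢ T ∪ ((S \ T) ×ˢ S ∪ S ×ˢ (S \ T)) := by
  intro p
  simp only [mem_union, mem_product, mem_sdiff]
  tauto

lemma pairDeg_square_le (v : V) (S T : Finset V) :
    pairDeg R v (S ×ˢ S) ≤ pairDeg R v (T ×ˢ T) + 2 * ((S \ T).card * S.card) := by
  have h1 := pairDeg_mono (R := R) v (square_subset S T)
  have h2 := pairDeg_union_le (R := R) v (T ×ˢ T) ((S \ T) ×ˢ S ∪ S ×ˢ (S \ T))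
  have h3 := pairDeg_union_le (R := R) v ((S \ T) ×ˢ S) (S ×ˢ (S \ T))
  have h4 := pairDeg_le_card (R := R) v ((S \ T) ×ˢ S)
  have h5 := pairDeg_le_card (R := R) v (S ×ˢ (S \ T))
  rw [card_product] at h4 h5
  rw [mul_comm] at h5
  linarith

lemma pairCodeg_square_le (v : V) (S T : Finset V) :
    pairCodeg R v (S ×ˢ S) ≤ pairCodeg R v (T ×ˢ T) + 2 * ((S \ T).card * S.card) := by
  have h1 := pairCodeg_mono (R := R) v (square_subset S T)
  have h2 := pairCodeg_union_le (R := R) v (T ×ˢ T) ((S \ T) ×ˢ S ∪ S ×ˢ (S \ T))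
  have h3 := pairCodeg_union_le (R := R) v ((S \ T) ×ˢ S) (S ×ˢ (S \ T))
  have h4 := pairCodeg_le_card (R := R) v ((S \ T) ×ˢ S)
  have h5 := pairCodeg_le_card (R := R) v (S ×ˢ (S \ T))
  rw [card_product] at h4 h5
  rw [mul_comm] at h5
  linarith

/-- Greedily pick `q` disjoint edges, each with exactly `α` vertices in `A`. -/
lemma exists_matchable_greedy (hR : IsTripleRel R) (A : Finset V) (α q : ℕ)
    (h : ∀ W : Finset V, W.card + 3 ≤ 3 * q → ∃ x y z, R x y z ∧ x ∉ W ∧ y ∉ W ∧ z ∉ W ∧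
      (({x, y, z} : Finset V) ∩ A).card = α) :
    ∃ S, Matchable R S ∧ S.card = 3 * q ∧ (S ∩ A).card = α * q := by
  have key : ∀ j ≤ q, ∃ S, Matchable R S ∧ S.card = 3 * j ∧ (S ∩ A).card = α * j := by
    intro j
    induction j with
    | zero => intro _; exact ⟨∅, .empty, by simp, by simp⟩
    | succ j ih =>
      intro hj
      obtain ⟨S, hS, hc, hA⟩ := ih (by omega)
      obtain ⟨x, y, z, hr, hx, hy, hz, hi⟩ := h S (by omega)
      refine ⟨_, hS.step hr hx hy hz, ?_, ?_⟩
      · rw [Matchable.card_step hR hr hx hy hz, hc]; ring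
      · have : insert x (insert y (insert z S)) ∩ A = ({x, y, z} ∩ A) ∪ (S ∩ A) := by
          ext v; simp only [mem_inter, mem_insert, mem_union, mem_singleton]; tauto
        rw [this, card_union_of_disjoint, hi, hA]
        · ring
        · rw [disjoint_left]
          intro v hv hv'
          simp only [mem_inter, mem_insert, mem_singleton] at hv hv'
          grind
  exact key q le_rfl

/-- Greedily match a small set `D` into pairs from `B`, avoiding `W`. -/
lemma exists_matchable_cover {D B W : Finset V} (hDB : Disjoint D B) {w : ℕ}
    (hw : W.card + 2 * D.card ≤ w)
    (h : ∀ a ∈ D, ∀ X : Finset V, X.card ≤ w → ∃ y ∈ B \ X, ∃ z ∈ B \ X, y ≠ z ∧ R a y z) :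
    ∃ T ⊆ B, Disjoint T W ∧ T.card = 2 * D.card ∧ Matchable R (D ∪ T) := by
  induction D using Finset.induction_on with
  | empty => exact ⟨∅, by simp, by simp, by simp, by simpa using Matchable.empty⟩
  | insert a D ha ih =>
    rw [card_insert_of_notMem ha] at hw
    rw [disjoint_insert_left] at hDB
    obtain ⟨T, hTB, hTW, hTc, hT⟩ := ih hDB.2 (by omega) fun b hb => h b (by simp [hb])
    obtain ⟨y, hy, z, hz, hyz, hr⟩ := h a (by simp) (W ∪ T)
      ((card_union_le _ _).trans (by omega))
    simp only [mem_sdiff, mem_union, not_or] at hy hz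
    refine ⟨insert y (insert z T), ?_, ?_, ?_, ?_⟩
    · exact insert_subset hy.1 (insert_subset hz.1 hTB)
    · simp only [disjoint_insert_left]
      exact ⟨hy.2.1, hz.2.1, hTW⟩
    · rw [card_insert_of_notMem, card_insert_of_notMem hz.2.2, hTc, card_insert_of_notMem ha]
      · ring
      · simp [hyz, hy.2.2]
    · have : insert a D ∪ insert y (insert z T) = insert a (insert y (insert z (D ∪ T))) := by
        ext v; simp only [mem_union, mem_insert]; tauto
      rw [this]
      have hD : ∀ v ∈ B, v ∉ D := fun v hv hv' => disjoint_left.1 hDB.2 hv' hv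
      refine hT.step hr ?_ ?_ ?_
      · rw [mem_union, not_or]; exact ⟨ha, fun h => hDB.1 (hTB h)⟩
      · rw [mem_union, not_or]; exact ⟨hD _ hy.1, hy.2.2⟩
      · rw [mem_union, not_or]; exact ⟨hD _ hz.1, hz.2.2⟩

omit [DecidableEq V] in
lemma exists_rel_of_pairCodeg_lt {v : V} {P : Finset (V × V)} (h : pairCodeg R v P < P.card) :
    ∃ p ∈ P, R v p.1 p.2 := by
  by_contra! hcon
  refine h.ne ?_
  rw [pairCodeg, filter_true_of_mem hcon]

/-- An exact lower bound for the degree inside a set `B`. -/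
lemma le_pairDeg_square [Fintype V] (hR : IsTripleRel R) (B : Finset V) {b : V} (hb : b ∈ B) :
    pairDeg R b univ + (B.card - 1) * (B.card - 2) ≤
      pairDeg R b (B ×ˢ B) + (Fintype.card V - 1) * (Fintype.card V - 2) := by
  have hsub : (univ.filter fun p : V × V => R b p.1 p.2) ⊆
      ((B ×ˢ B).filter fun p => R b p.1 p.2) ∪
        ((univ.erase b).offDiag \ (B.erase b).offDiag) := by
    intro p hp
    simp only [mem_filter, mem_univ, true_and] at hp
    have h1 := hR.ne hp
    have h2 := hR.ne' hp
    simp only [mem_union, mem_filter, mem_product, hp, and_true, mem_sdiff, mem_offDiag, mem_erase,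
      mem_univ]
    tauto
  have h1 := (card_le_card hsub).trans (card_union_le _ _)
  have h2 : (B.erase b).offDiag ⊆ (univ.erase b).offDiag :=
    offDiag_mono (erase_subset_erase _ (subset_univ _))
  rw [card_sdiff_of_subset h2] at h1
  have h3 := card_le_card h2
  have h4 : ∀ S : Finset V, b ∈ S → (S.erase b).offDiag.card = (S.card - 1) * (S.card - 2) := by
    intro S hS
    rw [offDiag_card, card_erase_of_mem hS, ← Nat.mul_sub_one, Nat.sub_sub]
  rw [h4 B hb, h4 univ (mem_univ _), card_univ] at h1 h3
  unfold pairDeg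
  omega

end

section
open scoped Classical

variable {V : Type*} {R : V → V → V → Prop} [DecidableEq V] [Fintype V]

/-- The structure of a 3-graph close to the extremal one: `A` is the set of vertices with many
edges into `B`, `G` are the typical vertices of `A`, and the complement of `A` is almost `B`. -/
structure IsNearExtremal (R : V → V → V → Prop) (k t : ℕ) (A G B : Finset V) : Prop where
  large : 1000000 ≤ k
  small : 10000 * t ≤ k
  cardB : B.card = 2 * k
  codeg_compl : ∀ b ∉ A, 100 * pairCodeg R b (univ \ B ×ˢ B) ≤ 2 * k ^ 2
  deg_mem : ∀ a ∈ A, k ^ 2 ≤ 100 * pairDeg R a (B ×ˢ B)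
  subset : G ⊆ A
  disj : Disjoint G B
  codeg_good : ∀ a ∈ G, 100 * pairCodeg R a (B ×ˢ B) ≤ k ^ 2
  card_bad : (A \ G).card ≤ 2 * t
  card_compl_sdiff : (Aᶜ \ B).card ≤ t
  card_inter : (A ∩ B).card ≤ t

namespace IsNearExtremal

variable {k t : ℕ} {A G B : Finset V}

lemma card_compl_le (h : IsNearExtremal R k t A G B) : Aᶜ.card ≤ 2 * k + t := by
  have h1 := card_le_card (show Aᶜ ⊆ (Aᶜ \ B) ∪ B by intro v; simp; tauto)
  have h2 := card_union_le (Aᶜ \ B) B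
  have := h.card_compl_sdiff
  have := h.cardB
  omega

lemma codeg_good_square_le (h : IsNearExtremal R k t A G B) {a : V} (ha : a ∈ G) {S : Finset V}
    (hS : S ⊆ Aᶜ) : 50 * pairCodeg R a (S ×ˢ S) ≤ k ^ 2 := by
  have h1 := pairCodeg_mono (R := R) a (product_subset_product hS hS)
  have h2 := pairCodeg_square_le (R := R) a Aᶜ B
  have h3 := h.codeg_good a ha
  have h4 := Nat.mul_le_mul h.card_compl_sdiff h.card_compl_le
  have := h.small
  nlinarith

lemma exists_pair (h : IsNearExtremal R k t A G B) {a : V} (ha : a ∈ A) {X : Finset V}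
    (hX : X.card ≤ 7 * t) : ∃ y ∈ Aᶜ \ X, ∃ z ∈ Aᶜ \ X, R a y z := by
  by_contra! hcon
  have h1 : B \ (Aᶜ \ X) ⊆ (A ∩ B) ∪ X := by intro v; simp; tauto
  have h2 := (card_le_card h1).trans (card_union_le _ _)
  have h3 := pairDeg_square_le (R := R) a B (Aᶜ \ X)
  have h4 : pairDeg R a ((Aᶜ \ X) ×ˢ (Aᶜ \ X)) = 0 := by
    rw [pairDeg, card_eq_zero, filter_eq_empty_iff]
    intro p hp
    rw [mem_product] at hp
    exact hcon _ hp.1 _ hp.2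
  have h5 := h.deg_mem a ha
  have h6 := h.card_inter
  have h7 : (B \ (Aᶜ \ X)).card * B.card ≤ (8 * t) * (2 * k) :=
    Nat.mul_le_mul (by omega) h.cardB.le
  have := h.small
  have := h.large
  nlinarith

/-- Once the sizes are balanced by a small matchable set, a perfect matching exists. -/
lemma matchable_of_balanced (hR : IsTripleRel R) (h : IsNearExtremal R k t A G B) {S : Finset V}
    {q : ℕ} (hq : q ≤ t) (hS : Matchable R S) (hSc : S.card ≤ 3 * t) (hA : (A \ S).card + q = k)
    (hA' : (Aᶜ \ S).card = 2 * (A \ S).card) : Matchable R (univ : Finset V) := by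
  have hsmall := h.small
  have hlarge := h.large
  set D := (A \ G) \ S with hD
  have hDc : D.card ≤ 2 * t := (card_le_card sdiff_subset).trans h.card_bad
  have hDA : D ⊆ A := sdiff_subset.trans sdiff_subset
  obtain ⟨T, hTA, hTS, hTc, hT⟩ := exists_matchable_cover (R := R) (D := D) (B := Aᶜ) (W := S)
    (disjoint_left.2 fun v hv hv' => (mem_compl.1 hv') (hDA hv)) (w := 7 * t) (by omega)
    (fun a ha X hX => by
      obtain ⟨y, hy, z, hz, hr⟩ := h.exists_pair (hDA ha) hX
      exact ⟨y, hy, z, hz, (hR.ne' hr).1, hr⟩)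
  set A₁ := (A \ S) \ D with hA₁
  set B₁ := (Aᶜ \ S) \ T with hB₁
  have hA₁G : A₁ ⊆ G := by intro v; simp only [hA₁, hD, mem_sdiff]; tauto
  have hA₁c : A₁.card + D.card = (A \ S).card := by
    rw [hA₁, card_sdiff_add_card_eq_card]
    exact sdiff_subset_sdiff sdiff_subset le_rfl
  have hB₁c : B₁.card + T.card = (Aᶜ \ S).card := by
    rw [hB₁, card_sdiff_add_card_eq_card]
    intro v hv
    rw [mem_sdiff]
    exact ⟨hTA hv, disjoint_left.1 hTS hv⟩
  have hfin : Matchable R (A₁ ∪ B₁) := by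
    refine matchable_of_pairCodeg_le hR (c := k ^ 2 / 50) ?_ (by omega) ?_ ?_ ?_
    · rw [disjoint_left]
      intro v hv hv'
      simp only [hA₁, hB₁, mem_sdiff, mem_compl] at hv hv'
      tauto
    · intro a ha
      rw [Nat.le_div_iff_mul_le (by norm_num), mul_comm]
      exact h.codeg_good_square_le (hA₁G ha) (sdiff_subset.trans sdiff_subset)
    · intro b hb
      rw [Nat.le_div_iff_mul_le (by norm_num)]
      have h1 := h.codeg_compl b (by simp only [hB₁, mem_sdiff, mem_compl] at hb; tauto)
      have h2 := pairCodeg_mono (R := R) b (show A₁ ×ˢ B₁ ⊆ univ \ B ×ˢ B by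
        intro p hp
        rw [mem_product] at hp
        simp only [mem_sdiff, mem_univ, true_and, mem_product]
        exact fun h' => disjoint_left.1 h.disj (hA₁G hp.1) h'.1)
      omega
    · have h1 := Nat.div_mul_le_self (k ^ 2) 50
      obtain ⟨d, hd⟩ : ∃ d, k = A₁.card + d := ⟨k - A₁.card, by omega⟩
      have hd3 : d ≤ 3 * t := by omega
      have h2 : 1000 * d ≤ k := by omega
      have h3 : 999 * k ≤ 1000 * A₁.card := by omega
      nlinarith
  have hu : (univ : Finset V) = (S ∪ (D ∪ T)) ∪ (A₁ ∪ B₁) := by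
    ext v
    simp only [hA₁, hB₁, mem_univ, mem_union, mem_sdiff, mem_compl, true_iff]
    tauto
  rw [hu]
  refine (hS.union hT ?_).union hfin ?_
  · rw [disjoint_union_right]
    exact ⟨disjoint_sdiff, hTS.symm⟩
  · rw [disjoint_left]
    intro v hv hv'
    simp only [hA₁, hB₁, mem_union, mem_sdiff, mem_compl] at hv hv'
    have h1 : v ∈ T → v ∉ A := fun hv => mem_compl.1 (hTA hv)
    have h2 : v ∈ D → v ∈ A := fun hv => hDA hv
    tauto

/-- The case where `A` is too large: use edges with two vertices in `A`. -/
lemma matchable_of_large (hR : IsTripleRel R) (h : IsNearExtremal R k t A G B) {q : ℕ}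
    (hq : q ≤ t) (hA : A.card = k + q) (hA' : Aᶜ.card + q = 2 * k) :
    Matchable R (univ : Finset V) := by
  have hsmall := h.small
  have hlarge := h.large
  obtain ⟨S, hS, hSc, hSA⟩ := exists_matchable_greedy hR A 2 q (by
    intro W hW
    have h1 := le_card_sdiff W Aᶜ
    obtain ⟨b, hb⟩ : (Aᶜ \ W).Nonempty := card_pos.1 (by omega)
    rw [mem_sdiff, mem_compl] at hb
    have h2 : pairCodeg R b ((G \ W) ×ˢ (G \ W)) < ((G \ W) ×ˢ (G \ W)).card := by
      have h3 := h.codeg_compl b hb.1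
      have h4 := pairCodeg_mono (R := R) b (show (G \ W) ×ˢ (G \ W) ⊆ univ \ B ×ˢ B by
        intro p hp
        rw [mem_product, mem_sdiff] at hp
        simp only [mem_sdiff, mem_univ, true_and, mem_product]
        exact fun h' => disjoint_left.1 h.disj hp.1.1 h'.1)
      have h5 := le_card_sdiff W G
      have h6 := card_sdiff_add_card_eq_card h.subset
      have h7 := h.card_bad
      rw [card_product]
      have h8 : 999 * k ≤ 1000 * (G \ W).card := by omega
      nlinarith
    obtain ⟨p, hp, hr⟩ := exists_rel_of_pairCodeg_lt h2
    simp only [mem_product, mem_sdiff] at hp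
    refine ⟨b, p.1, p.2, hr, hb.2, hp.1.2, hp.2.2, ?_⟩
    have h9 : ({b, p.1, p.2} : Finset V) ∩ A = {p.1, p.2} := by
      have := h.subset hp.1.1
      have := h.subset hp.2.1
      ext v
      simp only [mem_inter, mem_insert, mem_singleton]
      constructor
      · rintro ⟨rfl | h | h, h'⟩
        · exact absurd h' hb.1
        · exact Or.inl h
        · exact Or.inr h
      · rintro (rfl | rfl) <;> simp [*]
    rw [h9, card_pair (hR.ne' hr).1])
  have h1 := card_sdiff_add_card_inter A S
  have h2 := card_sdiff_add_card_inter Aᶜ S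
  have h3 := card_sdiff_add_card_inter S A
  rw [inter_comm] at h1 h2
  have h4 : S ∩ Aᶜ = S \ A := by ext; simp
  rw [h4] at h2
  exact h.matchable_of_balanced hR hq hS (by omega) (by omega) (by omega)

/-- The case where `A` is too small: use edges in the complement of `A`. -/
lemma matchable_of_small (hR : IsTripleRel R) (h : IsNearExtremal R k t A G B)
    (hV : Fintype.card V = 3 * k) (hdeg : ∀ v, 5 * k ^ 2 + 4 ≤ pairDeg R v univ + 7 * k)
    (hdB : ∀ b ∉ A, 100 * pairDeg R b (B ×ˢ B) ≤ k ^ 2) {q : ℕ}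
    (hq : q ≤ t) (hA : A.card + q = k) :
    Matchable R (univ : Finset V) := by
  have hsmall := h.small
  have hlarge := h.large
  have hA' : Aᶜ.card = 2 * k + q := by rw [card_compl]; omega
  obtain ⟨S, hS, hSc, hSA⟩ := exists_matchable_greedy hR A 0 q (by
    intro W hW
    obtain ⟨p, rfl⟩ : ∃ p, q = p + 1 := ⟨q - 1, by omega⟩
    have hlow : ∀ b ∈ Aᶜ, 4 * k * p + 2 ≤ pairDeg R b (Aᶜ ×ˢ Aᶜ) := by
      intro b hb
      have h1 := le_pairDeg_square hR Aᶜ hb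
      have h2 := hdeg b
      rw [hA', hV] at h1
      obtain ⟨l, rfl⟩ : ∃ l, k = l + 1 := ⟨k - 1, by omega⟩
      have e1 : 2 * (l + 1) + (p + 1) - 1 = 2 * l + p + 2 := by omega
      have e2 : 2 * (l + 1) + (p + 1) - 2 = 2 * l + p + 1 := by omega
      have e3 : 3 * (l + 1) - 1 = 3 * l + 2 := by omega
      have e4 : 3 * (l + 1) - 2 = 3 * l + 1 := by omega
      rw [e1, e2, e3, e4] at h1
      have := Nat.le_mul_self p
      nlinarith
    have hup : ∀ b ∈ Aᶜ, 50 * pairDeg R b (Aᶜ ×ˢ Aᶜ) ≤ k ^ 2 := by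
      intro b hb
      have h2 := pairDeg_square_le (R := R) b Aᶜ B
      have h3 := hdB b (mem_compl.1 hb)
      have h4 := Nat.mul_le_mul h.card_compl_sdiff h.card_compl_le
      nlinarith
    by_cases hex : ∃ x ∈ Aᶜ \ W, ∃ y ∈ Aᶜ \ W, ∃ z ∈ Aᶜ \ W, R x y z
    · obtain ⟨x, hx, y, hy, z, hz, hr⟩ := hex
      simp only [mem_sdiff, mem_compl] at hx hy hz
      refine ⟨x, y, z, hr, hx.2, hy.2, hz.2, ?_⟩
      rw [card_eq_zero, ← disjoint_iff_inter_eq_empty]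
      simp [hx.1, hy.1, hz.1]
    · exfalso
      push Not at hex
      have h1 : ∀ b ∈ Aᶜ \ W, 4 * k * p + 2 ≤ 2 * pairDeg R b ((W ∩ Aᶜ) ×ˢ Aᶜ) := by
        intro b hb
        refine (hlow b (mem_sdiff.1 hb).1).trans ?_
        have hsub : (Aᶜ ×ˢ Aᶜ).filter (fun p => R b p.1 p.2) ⊆
            (((W ∩ Aᶜ) ×ˢ Aᶜ) ∪ (Aᶜ ×ˢ (W ∩ Aᶜ))).filter (fun p => R b p.1 p.2) := by
          intro p hp
          rw [mem_filter, mem_product] at hp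
          have := hex b hb p.1
          have := fun h1 h2 => this h1 p.2 h2 hp.2
          simp only [mem_filter, mem_union, mem_product, mem_inter, mem_sdiff] at this ⊢
          tauto
        have h2 := (card_le_card hsub).trans (pairDeg_union_le b _ _)
        rw [pairDeg_swap hR b Aᶜ] at h2
        rw [pairDeg]
        omega
      have h2 := sum_le_sum h1
      rw [sum_const, ← mul_sum, smul_eq_mul, sum_pairDeg_product_comm hR] at h2
      have h3 : ∀ w ∈ W ∩ Aᶜ, 50 * pairDeg R w ((Aᶜ \ W) ×ˢ Aᶜ) ≤ k ^ 2 := by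
        intro w hw
        have := pairDeg_mono (R := R) w (product_subset_product
          (sdiff_subset : Aᶜ \ W ⊆ Aᶜ) (Subset.refl Aᶜ))
        have := hup w (mem_inter.1 hw).2
        omega
      have h4 := sum_le_sum h3
      rw [sum_const, ← mul_sum, smul_eq_mul] at h4
      have h5 : (W ∩ Aᶜ).card ≤ 3 * p := (card_le_card inter_subset_left).trans (by omega)
      have h6 := le_card_sdiff W Aᶜ
      have h7 : k ≤ (Aᶜ \ W).card := by omega
      have h8 := Nat.mul_le_mul_right (4 * k * p + 2) h7
      have h9 := Nat.mul_le_mul_right (k ^ 2) h5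
      nlinarith)
  have h1 := card_sdiff_add_card_inter A S
  have h2 := card_sdiff_add_card_inter Aᶜ S
  have h3 := card_sdiff_add_card_inter S A
  rw [inter_comm] at h1 h2
  have h4 : S ∩ Aᶜ = S \ A := by ext; simp
  rw [h4] at h2
  exact h.matchable_of_balanced hR hq hS (by omega) (by omega) (by omega)

end IsNearExtremal

/-- The extremal case: some set of two thirds of the vertices spans few edges. -/
theorem matchable_univ_of_sparse (hR : IsTripleRel R) {k : ℕ} (hk : 1000000000 ≤ k)
    (hV : Fintype.card V = 3 * k) (hdeg : ∀ v, 5 * k ^ 2 + 4 ≤ pairDeg R v univ + 7 * k)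
    {B : Finset V} (hB : B.card = 2 * k)
    (hsparse : 10000000 * ∑ b ∈ B, pairDeg R b (B ×ˢ B) ≤ k ^ 3) :
    Matchable R (univ : Finset V) := by
  set A := univ.filter fun v => k ^ 2 ≤ 100 * pairDeg R v (B ×ˢ B) with hA
  set G := univ.filter fun v => v ∉ B ∧ 100 * pairCodeg R v (B ×ˢ B) ≤ k ^ 2 with hG
  set t := k / 10000 with ht
  have hk2 : 1000000000 * k ≤ k ^ 2 := by nlinarith
  have hcard : (univ \ B ×ˢ B : Finset (V × V)).card = 5 * k ^ 2 := by
    rw [card_sdiff_of_subset (subset_univ _), card_univ, Fintype.card_prod, card_product, hB, hV]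
    have : 3 * k * (3 * k) = 5 * k ^ 2 + 2 * k * (2 * k) := by ring
    omega
  have hco : ∀ v, pairCodeg R v (univ \ B ×ˢ B) ≤ 7 * k + pairDeg R v (B ×ˢ B) := by
    intro v
    have h1 := pairDeg_add_pairCodeg (R := R) v (univ \ B ×ˢ B)
    have h2 := pairDeg_union_le (R := R) v (univ \ B ×ˢ B) (B ×ˢ B)
    rw [sdiff_union_of_subset (subset_univ _)] at h2
    have := hdeg v
    omega
  have hsum : 10000000 * ∑ a ∈ Bᶜ, pairCodeg R a (B ×ˢ B) ≤ 140000000 * k ^ 2 + k ^ 3 := by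
    rw [sum_pairCodeg_product_comm hR]
    have h1 : ∑ b ∈ B, pairCodeg R b (Bᶜ ×ˢ B) ≤ ∑ b ∈ B, (7 * k + pairDeg R b (B ×ˢ B)) := by
      refine sum_le_sum fun b _ => (pairCodeg_mono b ?_).trans (hco b)
      intro p hp
      rw [mem_product, mem_compl] at hp
      simp only [mem_sdiff, mem_univ, true_and, mem_product]
      exact fun h => hp.1 h.1
    rw [sum_add_distrib, sum_const, hB, smul_eq_mul] at h1
    nlinarith
  have hbadG : (Bᶜ \ G).card ≤ t := by
    rw [ht, Nat.le_div_iff_mul_le (by norm_num)]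
    have h1 : ∀ a ∈ Bᶜ \ G, k ^ 2 ≤ 100 * pairCodeg R a (B ×ˢ B) := by
      intro a ha
      simp only [hG, mem_sdiff, mem_compl, mem_filter, mem_univ, true_and, not_and, not_le] at ha
      exact (ha.2 ha.1).le
    have h2 := sum_le_sum h1
    rw [sum_const, ← mul_sum, smul_eq_mul] at h2
    have h3 := sum_le_sum_of_subset (f := fun a => pairCodeg R a (B ×ˢ B))
      (sdiff_subset : Bᶜ \ G ⊆ Bᶜ)
    have h4 : ((Bᶜ \ G).card * 10000) * k ^ 2 ≤ k * k ^ 2 := by nlinarith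
    exact Nat.le_of_mul_le_mul_right h4 (by positivity)
  have hAB : (A ∩ B).card ≤ t := by
    rw [ht, Nat.le_div_iff_mul_le (by norm_num)]
    have h1 : ∀ a ∈ A ∩ B, k ^ 2 ≤ 100 * pairDeg R a (B ×ˢ B) := by
      intro a ha
      simp only [hA, mem_inter, mem_filter, mem_univ, true_and] at ha
      exact ha.1
    have h2 := sum_le_sum h1
    rw [sum_const, ← mul_sum, smul_eq_mul] at h2
    have h3 := sum_le_sum_of_subset (f := fun a => pairDeg R a (B ×ˢ B))
      (inter_subset_right : A ∩ B ⊆ B)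
    have h4 : ((A ∩ B).card * 10000) * k ^ 2 ≤ k * k ^ 2 := by nlinarith
    exact Nat.le_of_mul_le_mul_right h4 (by positivity)
  have hGA : G ⊆ A := by
    intro a ha
    simp only [hG, hA, mem_filter, mem_univ, true_and] at ha ⊢
    have h1 := pairDeg_add_pairCodeg (R := R) a (B ×ˢ B)
    rw [card_product, hB] at h1
    nlinarith
  have hGB : Disjoint G B := by
    rw [disjoint_left]
    intro v hv
    simp only [hG, mem_filter] at hv
    exact hv.2.1
  have hmemA : ∀ b ∉ A, 100 * pairDeg R b (B ×ˢ B) ≤ k ^ 2 := by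
    intro b hb
    simp only [hA, mem_filter, mem_univ, true_and, not_le] at hb
    exact hb.le
  have hBc : Bᶜ.card = k := by rw [card_compl]; omega
  have hnear : IsNearExtremal R k t A G B := by
    refine ⟨by omega, by omega, hB, ?_, ?_, hGA, hGB, ?_, ?_, ?_, hAB⟩
    · intro b hb
      have := hmemA b hb
      have := hco b
      omega
    · intro a ha
      simp only [hA, mem_filter, mem_univ, true_and] at ha
      exact ha
    · intro a ha
      simp only [hG, mem_filter, mem_univ, true_and] at ha
      exact ha.2
    · have h1 : A \ G ⊆ (A ∩ B) ∪ (Bᶜ \ G) := by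
        intro v; simp only [mem_sdiff, mem_union, mem_inter, mem_compl]; tauto
      have h2 := (card_le_card h1).trans (card_union_le _ _)
      omega
    · refine (card_le_card ?_).trans hbadG
      intro v
      simp only [mem_sdiff, mem_compl]
      exact fun h => ⟨h.2, fun h' => h.1 (hGA h')⟩
  have hup : A.card ≤ k + t := by
    have h1 : A ⊆ (A ∩ B) ∪ Bᶜ := by
      intro v; simp only [mem_union, mem_inter, mem_compl]; tauto
    have h2 := (card_le_card h1).trans (card_union_le _ _)
    omega
  have hlow : k ≤ A.card + t := by
    have h1 : Bᶜ ⊆ A ∪ (Bᶜ \ G) := by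
      intro v
      simp only [mem_union, mem_sdiff]
      have := @hGA v
      tauto
    have h2 := (card_le_card h1).trans (card_union_le _ _)
    omega
  rcases le_total A.card k with h | h
  · exact hnear.matchable_of_small hR hV hdeg hmemA (q := k - A.card) (by omega) (by omega)
  · exact hnear.matchable_of_large hR (q := A.card - k) (by omega) (by omega)
      (by rw [card_compl]; omega)

end

section
open scoped Classical

section Counting

variable {J V : Type*} [Fintype J] [DecidableEq J] [Fintype V]

lemma card_filter_apply_mem (c : J) (U : Finset V) :
    (univ.filter fun x : J → V => x c ∈ U).card =
      U.card * Fintype.card V ^ (Fintype.card J - 1) := by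
  have : (univ.filter fun x : J → V => x c ∈ U) =
      Fintype.piFinset (Function.update (fun _ => (univ : Finset V)) c U) := by
    ext x
    simp only [mem_filter, mem_univ, true_and, Fintype.mem_piFinset]
    constructor
    · intro h j
      by_cases hj : j = c
      · subst hj; simpa using h
      · simp [hj]
    · intro h; simpa using h c
  rw [this, Fintype.card_piFinset, ← mul_prod_erase univ _ (mem_univ c)]
  rw [Function.update_self]
  congr 1
  rw [prod_congr rfl (g := fun _ => Fintype.card V), prod_const, card_erase_of_mem (mem_univ c),
    card_univ]
  intro j hj
  rw [Function.update_of_ne (ne_of_mem_erase hj), card_univ]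

lemma card_filter_apply_eq_le {c d : J} (hcd : c ≠ d) :
    (univ.filter fun x : J → V => x c = x d).card ≤
      Fintype.card V ^ (Fintype.card J - 1) := by
  have h : Fintype.card ({j : J // j ≠ d} → V) = Fintype.card V ^ (Fintype.card J - 1) := by
    rw [Fintype.card_fun, Fintype.card_subtype_compl, Fintype.card_subtype_eq]
  rw [← h, ← card_univ]
  refine card_le_card_of_injOn (fun x j => x j) (fun _ _ => by simp) ?_
  intro x hx y hy hxy
  simp only [coe_filter, mem_univ, true_and, Set.mem_ofPred_eq] at hx hy
  have h1 : ∀ j, j ≠ d → x j = y j := fun j hj => congrFun hxy ⟨j, hj⟩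
  funext j
  by_cases hj : j = d
  · subst hj; rw [← hx, ← hy]; exact h1 c hcd
  · exact h1 j hj

/-- Few maps fail to be injective or meet a small set. -/
lemma card_filter_bad_le (U : Finset V) :
    (univ.filter fun x : J → V => ¬ (Function.Injective x ∧ ∀ c, x c ∉ U)).card ≤
      (Fintype.card J ^ 2 + Fintype.card J * U.card) *
        Fintype.card V ^ (Fintype.card J - 1) := by
  have hsub : (univ.filter fun x : J → V => ¬ (Function.Injective x ∧ ∀ c, x c ∉ U)) ⊆
      ((univ : Finset J).offDiag.biUnion fun p => univ.filter fun x : J → V => x p.1 = x p.2) ∪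
      ((univ : Finset J).biUnion fun c => univ.filter fun x : J → V => x c ∈ U) := by
    intro x hx
    simp only [mem_filter, mem_univ, true_and] at hx
    simp only [mem_union, mem_biUnion, mem_filter, mem_univ, true_and, mem_offDiag]
    by_contra! hcon
    refine hx ⟨fun c d h => ?_, hcon.2⟩
    by_contra hne
    exact hcon.1 (c, d) hne h
  refine (card_le_card hsub).trans ((card_union_le _ _).trans ?_)
  rw [add_mul]
  refine add_le_add ?_ ?_
  · refine (card_biUnion_le_card_mul _ _ _ fun p hp =>
      card_filter_apply_eq_le (mem_offDiag.1 hp).2.2).trans (Nat.mul_le_mul_right _ ?_)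
    rw [offDiag_card, card_univ, sq]
    exact Nat.sub_le _ _
  · refine (card_biUnion_le_card_mul _ _ _ fun c _ => (card_filter_apply_mem c U).le).trans ?_
    rw [card_univ, mul_assoc]

end Counting

variable {V : Type*} {R : V → V → V → Prop}

/-- Nine vertices spanning the three disjoint edges `x (i, 0), x (i, 1), x (i, 2)`. -/
def IsGadget (R : V → V → V → Prop) (x : Fin 3 × Fin 3 → V) : Prop :=
  Function.Injective x ∧ ∀ i, R (x (i, 0)) (x (i, 1)) (x (i, 2))

/-- A gadget that can be rematched together with the three vertices of `T`. -/
def IsAbsorber (R : V → V → V → Prop) (T : Fin 3 → V) (x : Fin 3 × Fin 3 → V) : Prop :=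
  IsGadget R x ∧ R (x (0, 0)) (x (1, 0)) (x (2, 0)) ∧ ∀ i, R (T i) (x (i, 1)) (x (i, 2))

/-- The vertices covered by a family of gadgets. -/
noncomputable def gadgetVerts [DecidableEq V] (F : Finset (Fin 3 × Fin 3 → V)) : Finset V :=
  F.biUnion fun x => univ.image x

section
variable [DecidableEq V]

lemma IsGadget.matchable {x : Fin 3 × Fin 3 → V} (hx : IsGadget R x) :
    Matchable R (univ.image x) := by
  have : univ.image x =
      (univ : Finset (Fin 3)).biUnion fun i => {x (i, 0), x (i, 1), x (i, 2)} := by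
    ext v
    simp only [mem_image, mem_univ, true_and, mem_biUnion, mem_insert, mem_singleton, Prod.exists]
    constructor
    · rintro ⟨i, j, rfl⟩
      exact ⟨i, by fin_cases j <;> simp⟩
    · rintro ⟨i, rfl | rfl | rfl⟩ <;> exact ⟨i, _, rfl⟩
  rw [this]
  refine Matchable.biUnion _ _ (fun i _ => Matchable.single (hx.2 i)) ?_
  intro i _ j _ hij
  simp only [disjoint_insert_left, disjoint_singleton_left, mem_insert, mem_singleton,
    hx.1.eq_iff, Prod.mk.injEq]
  tauto

lemma IsAbsorber.matchable {x : Fin 3 × Fin 3 → V} {T : Fin 3 → V} (hx : IsAbsorber R T x)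
    (hT : Function.Injective T) (hd : ∀ i c, T i ≠ x c) :
    Matchable R (univ.image T ∪ univ.image x) := by
  have : univ.image T ∪ univ.image x = {x (0, 0), x (1, 0), x (2, 0)} ∪
      (univ : Finset (Fin 3)).biUnion fun i => {T i, x (i, 1), x (i, 2)} := by
    ext v
    simp only [mem_union, mem_image, mem_univ, true_and, mem_biUnion, mem_insert, mem_singleton,
      Prod.exists]
    constructor
    · rintro (⟨i, rfl⟩ | ⟨i, j, rfl⟩)
      · exact Or.inr ⟨i, Or.inl rfl⟩
      · fin_cases j
        · left; fin_cases i <;> simp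
        · exact Or.inr ⟨i, by simp⟩
        · exact Or.inr ⟨i, by simp⟩
    · rintro ((rfl | rfl | rfl) | ⟨i, rfl | rfl | rfl⟩)
      · exact Or.inr ⟨_, _, rfl⟩
      · exact Or.inr ⟨_, _, rfl⟩
      · exact Or.inr ⟨_, _, rfl⟩
      · exact Or.inl ⟨_, rfl⟩
      · exact Or.inr ⟨_, _, rfl⟩
      · exact Or.inr ⟨_, _, rfl⟩
  rw [this]
  refine (Matchable.single hx.2.1).union
    (Matchable.biUnion _ _ (fun i _ => Matchable.single (hx.2.2 i)) ?_) ?_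
  · intro i _ j _ hij
    have h1 := fun c => (hd i c)
    have h2 := fun c => (hd j c).symm
    simp only [disjoint_insert_left, disjoint_singleton_left, mem_insert, mem_singleton,
      hx.1.1.eq_iff, Prod.mk.injEq, hT.eq_iff, h1, h2]
    tauto
  · rw [disjoint_biUnion_right]
    intro i _
    have h1 := fun c => (hd i c).symm
    simp only [disjoint_insert_left, disjoint_singleton_left, mem_insert, mem_singleton,
      hx.1.1.eq_iff, Prod.mk.injEq, h1]
    simp

/-- A family of gadgets rich in absorbers can absorb any small set. -/
lemma matchable_absorb {w : ℕ} : ∀ {F : Finset (Fin 3 × Fin 3 → V)} {W : Finset V},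
    (∀ x ∈ F, IsGadget R x) →
    (∀ x ∈ F, ∀ y ∈ F, x ≠ y → Disjoint (univ.image x) (univ.image y)) →
    (∀ T, w ≤ (F.filter (IsAbsorber R T)).card) →
    Disjoint W (gadgetVerts F) → W.card = 3 * w → Matchable R (W ∪ gadgetVerts F) := by
  induction w with
  | zero =>
    intro F W hF hd _ _ hW
    rw [mul_zero, card_eq_zero] at hW
    rw [hW, empty_union]
    exact Matchable.biUnion _ _ (fun x hx => (hF x hx).matchable) hd
  | succ w ih =>
    intro F W hF hd hT hWF hW
    obtain ⟨U, hUW, hU⟩ := exists_subset_card_eq (show 3 ≤ W.card by omega)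
    obtain ⟨a, b, c, hab, hac, hbc, rfl⟩ := card_eq_three.1 hU
    obtain ⟨x, hx⟩ := card_pos.1 (lt_of_lt_of_le (Nat.succ_pos w) (hT ![a, b, c]))
    rw [mem_filter] at hx
    have himg : univ.image ![a, b, c] = ({a, b, c} : Finset V) := by
      ext v; simp [Fin.exists_fin_succ, eq_comm]
    have hxF : univ.image x ⊆ gadgetVerts F := subset_biUnion_of_mem (fun x => univ.image x) hx.1
    have hF' : gadgetVerts (F.erase x) ∪ univ.image x = gadgetVerts F := by
      conv_rhs => rw [← insert_erase hx.1]
      rw [gadgetVerts, gadgetVerts, biUnion_insert, union_comm]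
    have h1 := ih (F := F.erase x) (W := W \ {a, b, c}) (fun y hy => hF y (mem_of_mem_erase hy))
      (fun y hy z hz => hd y (mem_of_mem_erase hy) z (mem_of_mem_erase hz))
      (fun T => by
        have h2 := hT T
        have h3 := card_le_card_sdiff_add_card (s := F.filter (IsAbsorber R T)) (t := {x})
        rw [card_singleton] at h3
        rw [filter_erase, erase_eq]
        omega)
      (disjoint_of_subset_left sdiff_subset (disjoint_of_subset_right
        (by rw [← hF']; exact subset_union_left) hWF))
      (by rw [card_sdiff_of_subset hUW]; omega)
    have h2 : Matchable R (univ.image ![a, b, c] ∪ univ.image x) := by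
      refine hx.2.matchable ?_ ?_
      · intro i j h
        fin_cases i <;> fin_cases j <;> simp_all
      · intro i c' h
        have h3 : (![a, b, c] : Fin 3 → V) i ∈ W := by
          apply hUW; rw [← himg]; exact mem_image_of_mem _ (mem_univ _)
        exact disjoint_left.1 hWF h3 (h ▸ hxF (mem_image_of_mem _ (mem_univ _)))
    rw [himg] at h2
    have h3 : W ∪ gadgetVerts F =
        (W \ {a, b, c} ∪ gadgetVerts (F.erase x)) ∪ ({a, b, c} ∪ univ.image x) := by
      rw [← hF', union_union_union_comm, sdiff_union_of_subset hUW]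
    rw [h3]
    refine h1.union h2 ?_
    have d1 : Disjoint (gadgetVerts (F.erase x)) (univ.image x) := by
      rw [gadgetVerts, disjoint_biUnion_left]
      exact fun y hy => hd y (mem_of_mem_erase hy) x hx.1 (ne_of_mem_erase hy)
    rw [disjoint_union_left, disjoint_union_right, disjoint_union_right]
    refine ⟨⟨sdiff_disjoint, ?_⟩, ?_, d1⟩
    · exact disjoint_of_subset_left sdiff_subset (disjoint_of_subset_right hxF hWF)
    · exact (disjoint_of_subset_left hUW (disjoint_of_subset_right
        (by rw [← hF']; exact subset_union_left) hWF)).symm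

end

section
variable [Fintype V]

/-- The number of absorbers of a fixed triple, ignoring injectivity. -/
lemma le_card_preabsorber {k : ℕ} (T : Fin 3 → V)
    (hcommon : ∀ x y : V, k ^ 2 ≤
      2 * (univ.filter fun p : V × V => R x p.1 p.2 ∧ R y p.1 p.2).card)
    (hedges : 12 * k ^ 3 ≤ ∑ v : V, pairDeg R v univ) :
    3 * k ^ 9 ≤ 2 * (univ.filter fun x : Fin 3 × Fin 3 → V =>
      (∀ i, R (x (i, 0)) (x (i, 1)) (x (i, 2))) ∧ R (x (0, 0)) (x (1, 0)) (x (2, 0)) ∧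
      ∀ i, R (T i) (x (i, 1)) (x (i, 2))).card := by
  set C : V → V → Finset (V × V) := fun x y =>
    univ.filter fun p : V × V => R x p.1 p.2 ∧ R y p.1 p.2 with hC
  set E : Finset (V × (V × V)) := univ.filter fun p => R p.1 p.2.1 p.2.2 with hE
  have hEc : 12 * k ^ 3 ≤ E.card := by
    refine hedges.trans (le_of_eq ?_)
    rw [hE, card_filter, Fintype.sum_prod_type]
    exact sum_congr rfl fun v _ => by rw [pairDeg, card_filter]
  set D := E.sigma fun p => Fintype.piFinset fun i : Fin 3 => C (![p.1, p.2.1, p.2.2] i) (T i)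
    with hD
  have hDc : 3 * k ^ 9 ≤ 2 * D.card := by
    rw [hD, card_sigma]
    have h1 : ∀ p ∈ E, k ^ 6 ≤
        8 * (Fintype.piFinset fun i : Fin 3 => C (![p.1, p.2.1, p.2.2] i) (T i)).card := by
      intro p _
      rw [Fintype.card_piFinset, Fin.prod_univ_three]
      have h0 := hcommon (![p.1, p.2.1, p.2.2] 0) (T 0)
      have h1 := hcommon (![p.1, p.2.1, p.2.2] 1) (T 1)
      have h2 := hcommon (![p.1, p.2.1, p.2.2] 2) (T 2)
      have := Nat.mul_le_mul (Nat.mul_le_mul h0 h1) h2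
      calc k ^ 6 = k ^ 2 * k ^ 2 * k ^ 2 := by ring
        _ ≤ _ := this
        _ = _ := by simp only [hC]; ring
    have h2 := sum_le_sum h1
    rw [sum_const, ← mul_sum, smul_eq_mul] at h2
    have h3 := Nat.mul_le_mul_right (k ^ 6) hEc
    have h4 : 12 * k ^ 3 * k ^ 6 = 4 * (3 * k ^ 9) := by ring
    omega
  refine hDc.trans (Nat.mul_le_mul_left 2 ?_)
  refine card_le_card_of_injOn
    (fun d c => ![(![d.1.1, d.1.2.1, d.1.2.2] : Fin 3 → V) c.1, (d.2 c.1).1, (d.2 c.1).2] c.2) ?_ ?_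
  · rintro ⟨p, g⟩ hd
    simp only [hD, hE, hC, coe_sigma, Set.mem_sigma_iff, mem_coe, mem_filter, mem_univ, true_and,
      Fintype.mem_piFinset] at hd
    simp only [coe_filter, mem_univ, true_and, Set.mem_ofPred_eq]
    refine ⟨fun i => ?_, ?_, fun i => ?_⟩
    · simpa using (hd.2 i).1
    · simpa using hd.1
    · simpa using (hd.2 i).2
  · rintro ⟨⟨a, b, c⟩, g⟩ _ ⟨⟨a', b', c'⟩, g'⟩ _ h
    have h0 := fun i => congrFun h (i, 0)
    have h1 := fun i => congrFun h (i, 1)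
    have h2 := fun i => congrFun h (i, 2)
    simp only [Matrix.cons_val_zero, Matrix.cons_val_one, Matrix.cons_val] at h0 h1 h2
    have ha : a = a' := by simpa using h0 0
    have hb : b = b' := by simpa using h0 1
    have hc : c = c' := by simpa using h0 2
    subst ha hb hc
    have : g = g' := funext fun i => Prod.ext (h1 i) (h2 i)
    rw [this]

end
end

section
open scoped Classical
variable {V : Type*} {R : V → V → V → Prop} [Fintype V] [DecidableEq V]

/-- Some gadget avoiding `U` absorbs a positive proportion of all weighted triples. -/
lemma exists_good_gadget {k : ℕ} (hk : 0 < k) (hV : Fintype.card V = 3 * k)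
    (hcommon : ∀ x y : V, k ^ 2 ≤
      2 * (univ.filter fun p : V × V => R x p.1 p.2 ∧ R y p.1 p.2).card)
    (hedges : 12 * k ^ 3 ≤ ∑ v : V, pairDeg R v univ) (U : Finset V)
    (hU : 118098 * (9 + U.card) ≤ k) (p : (Fin 3 → V) → ℝ) (hp : ∀ T, 0 < p T) :
    ∃ x, IsGadget R x ∧ (∀ c, x c ∉ U) ∧
      ∑ T, p T ≤ 19683 * ∑ T ∈ univ.filter fun T => IsAbsorber R T x, p T := by
  set G : Finset (Fin 3 × Fin 3 → V) := univ.filter fun x => Function.Injective x ∧ ∀ c, x c ∉ U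
    with hG
  have hcount : ∀ T : Fin 3 → V, k ^ 9 ≤ (G.filter fun x => IsAbsorber R T x).card := by
    intro T
    have h1 := le_card_preabsorber T hcommon hedges
    have h2 : (univ.filter fun x : Fin 3 × Fin 3 → V =>
        ¬ (Function.Injective x ∧ ∀ c, x c ∉ U)).card ≤
        ((3 * 3) ^ 2 + 3 * 3 * U.card) * (3 * k) ^ (3 * 3 - 1) := by
      have h2 := card_filter_bad_le (J := Fin 3 × Fin 3) U
      rw [hV, Fintype.card_prod, Fintype.card_fin] at h2
      convert h2
    have h3 : (univ.filter fun x : Fin 3 × Fin 3 → V =>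
        (∀ i, R (x (i, 0)) (x (i, 1)) (x (i, 2))) ∧ R (x (0, 0)) (x (1, 0)) (x (2, 0)) ∧
        ∀ i, R (T i) (x (i, 1)) (x (i, 2))).card ≤ (G.filter fun x => IsAbsorber R T x).card +
        (univ.filter fun x : Fin 3 × Fin 3 → V => ¬ (Function.Injective x ∧ ∀ c, x c ∉ U)).card := by
      refine (card_le_card ?_).trans (card_union_le _ _)
      intro x hx
      simp only [mem_filter, mem_univ, true_and, mem_union, hG, IsAbsorber, IsGadget] at hx ⊢
      tauto
    have h4 : 2 * (((3 * 3) ^ 2 + 3 * 3 * U.card) * (3 * k) ^ (3 * 3 - 1)) ≤ k ^ 9 := by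
      calc _ = (118098 * (9 + U.card)) * k ^ 8 := by norm_num; ring
        _ ≤ k * k ^ 8 := Nat.mul_le_mul_right _ hU
        _ = k ^ 9 := by ring
    omega
  have hVne : Nonempty V := by
    rw [← Fintype.card_pos_iff, hV]; omega
  have htot : 0 < ∑ T : Fin 3 → V, p T := sum_pos (fun T _ => hp T) univ_nonempty
  by_contra! hcon
  have h1 : ∀ x ∈ G, 19683 * ∑ T ∈ univ.filter (fun T => IsAbsorber R T x), p T <
      ∑ T, p T := by
    intro x hx
    by_cases hg : IsGadget R x
    · exact hcon x hg (mem_filter.1 hx).2.2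
    · rw [filter_false_of_mem (fun T _ h => hg h.1)]
      simpa using htot
  have hGpos : G.Nonempty := by
    have h2 := hcount (fun _ => hVne.some)
    have h3 : 0 < k ^ 9 := by positivity
    have := card_pos.1 (lt_of_lt_of_le h3 h2)
    exact this.mono (filter_subset _ _)
  have h2 := sum_lt_sum_of_nonempty hGpos h1
  rw [sum_const, nsmul_eq_mul, ← mul_sum] at h2
  have h3 : ∑ x ∈ G, ∑ T ∈ univ.filter (fun T => IsAbsorber R T x), p T =
      ∑ T, ((G.filter fun x => IsAbsorber R T x).card : ℝ) * p T := by
    simp_rw [sum_filter]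
    rw [sum_comm]
    refine sum_congr rfl fun T _ => ?_
    rw [← sum_filter, sum_const, nsmul_eq_mul]
  have h4 : (k : ℝ) ^ 9 * ∑ T, p T ≤
      ∑ T, ((G.filter fun x => IsAbsorber R T x).card : ℝ) * p T := by
    rw [mul_sum]
    refine sum_le_sum fun T _ => mul_le_mul_of_nonneg_right ?_ (hp T).le
    exact_mod_cast hcount T
  have h5 : (G.card : ℝ) ≤ 19683 * (k : ℝ) ^ 9 := by
    have : G.card ≤ 19683 * k ^ 9 := by
      refine (card_filter_le _ _).trans (le_of_eq ?_)
      rw [card_univ, Fintype.card_fun, hV, Fintype.card_prod, Fintype.card_fin]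
      ring
    exact_mod_cast this
  have h6 := mul_le_mul_of_nonneg_right h5 htot.le
  rw [h3] at h2
  linarith

omit [Fintype V] in
lemma card_gadgetVerts_le (F : Finset (Fin 3 × Fin 3 → V)) :
    (gadgetVerts F).card ≤ 9 * F.card := by
  rw [mul_comm]
  refine card_biUnion_le_card_mul _ _ _ fun x _ => ?_
  refine card_image_le.trans ?_
  simp

lemma one_sub_inv_pow_le_half {n : ℕ} (hn : 0 < n) :
    (1 - 1 / ((n : ℝ) + 1)) ^ (n + 1) ≤ 1 / 2 := by
  have hn' : (0 : ℝ) < n := by exact_mod_cast hn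
  have h3 := one_add_mul_le_pow (a := (1 / n : ℝ)) (by
    have : (0 : ℝ) ≤ 1 / n := by positivity
    linarith) (n + 1)
  have h4 : (1 - 1 / ((n : ℝ) + 1)) * (1 + 1 / n) = 1 := by field_simp; ring
  have h5 : (1 - 1 / ((n : ℝ) + 1)) ^ (n + 1) * (1 + 1 / (n : ℝ)) ^ (n + 1) = 1 := by
    rw [← mul_pow, h4, one_pow]
  have h6 : (0 : ℝ) < (1 - 1 / ((n : ℝ) + 1)) ^ (n + 1) := by
    refine pow_pos ?_ _
    rw [sub_pos, div_lt_one (by positivity)]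
    linarith
  have h7 : (2 : ℝ) ≤ (1 + 1 / (n : ℝ)) ^ (n + 1) := by
    refine le_trans ?_ h3
    push_cast
    have : ((n : ℝ) + 1) * (1 / n) = 1 + 1 / n := by field_simp
    rw [this]
    have : (0 : ℝ) ≤ 1 / n := by positivity
    linarith
  nlinarith

/-- A disjoint family of gadgets in which every triple has many absorbers. -/
theorem exists_absorbers {k u : ℕ} (hk : 0 < k) (hV : Fintype.card V = 3 * k)
    (hcommon : ∀ x y : V, k ^ 2 ≤
      2 * (univ.filter fun p : V × V => R x p.1 p.2 ∧ R y p.1 p.2).card)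
    (hedges : 12 * k ^ 3 ≤ ∑ v : V, pairDeg R v univ)
    (hu : 1062882 * (1 + 78732 * u) ≤ k) (hku : 27 * k ^ 3 ≤ 2 ^ u) :
    ∃ F : Finset (Fin 3 × Fin 3 → V), F.card = 78732 * u ∧ (∀ x ∈ F, IsGadget R x) ∧
      (∀ x ∈ F, ∀ y ∈ F, x ≠ y → Disjoint (univ.image x) (univ.image y)) ∧
      ∀ T, u ≤ (F.filter (IsAbsorber R T)).card := by
  have key : ∀ s ≤ 78732 * u, ∃ F : Finset (Fin 3 × Fin 3 → V), F.card = s ∧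
      (∀ x ∈ F, IsGadget R x) ∧
      (∀ x ∈ F, ∀ y ∈ F, x ≠ y → Disjoint (univ.image x) (univ.image y)) ∧
      ∑ T, (1 / 2 : ℝ) ^ (F.filter (IsAbsorber R T)).card ≤
        27 * (k : ℝ) ^ 3 * (1 - 1 / 39366) ^ s := by
    intro s
    induction s with
    | zero =>
      intro _
      refine ⟨∅, rfl, by simp, by simp, ?_⟩
      simp [hV]
      ring_nf
      rfl
    | succ s ih =>
      intro hs
      obtain ⟨F, hF, hg, hd, hphi⟩ := ih (by omega)
      have hUc := card_gadgetVerts_le F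
      obtain ⟨x, hx, hxU, hxs⟩ := exists_good_gadget hk hV hcommon hedges (gadgetVerts F)
        (by omega) (fun T => (1 / 2 : ℝ) ^ (F.filter (IsAbsorber R T)).card)
        (fun T => by positivity)
      have hxd : ∀ y ∈ F, Disjoint (univ.image x) (univ.image y) := by
        intro y hy
        rw [disjoint_left]
        intro v hv1 hv2
        obtain ⟨c, _, rfl⟩ := mem_image.1 hv1
        exact hxU c (mem_biUnion.2 ⟨y, hy, hv2⟩)
      have hxF : x ∉ F := by
        intro h
        have := hxd x h
        rw [disjoint_self_iff_empty, image_eq_empty] at this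
        exact univ_nonempty.ne_empty this
      refine ⟨insert x F, by rw [card_insert_of_notMem hxF, hF], ?_, ?_, ?_⟩
      · intro y hy
        rcases mem_insert.1 hy with rfl | hy
        · exact hx
        · exact hg y hy
      · intro y hy z hz hyz
        rcases mem_insert.1 hy with h1 | h1 <;> rcases mem_insert.1 hz with h2 | h2
        · exact absurd (h1.trans h2.symm) hyz
        · exact h1 ▸ hxd z h2
        · exact h2 ▸ (hxd y h1).symm
        · exact hd y h1 z h2 hyz
      · have h1 : ∀ T, (1 / 2 : ℝ) ^ ((insert x F).filter (IsAbsorber R T)).card =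
            (1 / 2 : ℝ) ^ (F.filter (IsAbsorber R T)).card -
            (1 / 2) * if IsAbsorber R T x then
              (1 / 2 : ℝ) ^ (F.filter (IsAbsorber R T)).card else 0 := by
          intro T
          rw [filter_insert]
          split_ifs with h
          · rw [card_insert_of_notMem (fun h' => hxF (mem_filter.1 h').1), pow_succ]
            ring
          · ring
        simp_rw [h1]
        rw [sum_sub_distrib, ← mul_sum, ← sum_filter, pow_succ (1 - 1 / 39366 : ℝ) s]
        have h2 : (0:ℝ) ≤ 1 - 1 / 39366 := by norm_num
        nlinarith [mul_le_mul_of_nonneg_right hphi h2]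
  obtain ⟨F, hF, hg, hd, hphi⟩ := key _ le_rfl
  refine ⟨F, hF, hg, hd, fun T => ?_⟩
  have h1 : (1 / 2 : ℝ) ^ (F.filter (IsAbsorber R T)).card ≤
      27 * (k : ℝ) ^ 3 * (1 - 1 / 39366) ^ (78732 * u) :=
    (single_le_sum (f := fun T => (1 / 2 : ℝ) ^ (F.filter (IsAbsorber R T)).card)
      (fun T _ => by positivity) (mem_univ T)).trans hphi
  have h3 : (1 - 1 / 39366 : ℝ) ^ (78732 * u) ≤ (1 / 2) ^ (2 * u) := by
    rw [show 78732 * u = (39365 + 1) * (2 * u) by ring, pow_mul]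
    refine pow_le_pow_left₀ (pow_nonneg (by norm_num) _) ?_ _
    have h2 := one_sub_inv_pow_le_half (n := 39365) (by norm_num)
    rwa [show ((39365 : ℕ) : ℝ) + 1 = 39366 by norm_num] at h2
  have h4 : 27 * (k : ℝ) ^ 3 ≤ 2 ^ u := by exact_mod_cast hku
  have h5 : (1 / 2 : ℝ) ^ (F.filter (IsAbsorber R T)).card ≤ (1 / 2) ^ u := by
    refine h1.trans ?_
    calc _ ≤ (2 : ℝ) ^ u * (1 / 2) ^ (2 * u) :=
          mul_le_mul h4 h3 (pow_nonneg (by norm_num) _) (by positivity)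
      _ = _ := by rw [two_mul, pow_add, ← mul_assoc, ← mul_pow]; norm_num
  exact (pow_le_pow_iff_right_of_lt_one₀ (by norm_num) (by norm_num)).1 h5

end

section
open scoped Classical

/-- A `3 × 3` bipartite graph has a perfect matching. -/
def HasPerm (M : Fin 3 → Fin 3 → Prop) : Prop :=
  ∃ a b c, a ≠ b ∧ a ≠ c ∧ b ≠ c ∧ M 0 a ∧ M 1 b ∧ M 2 c

/-- The rows `a₁`, `a₂` can be matched to any two columns. -/
def RowPair (M : Fin 3 → Fin 3 → Prop) (a₁ a₂ : Fin 3) : Prop :=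
  a₁ ≠ a₂ ∧ ∀ b₁ b₂, b₁ ≠ b₂ → (M a₁ b₁ ∧ M a₂ b₂) ∨ (M a₁ b₂ ∧ M a₂ b₁)

/-- Row `r` and column `c` are full. -/
def IsCross (M : Fin 3 → Fin 3 → Prop) (r c : Fin 3) : Prop :=
  ∀ a b, a = r ∨ b = c → M a b

/-- The number of entries of a `3 × 3` bipartite graph. -/
noncomputable def entries (M : Fin 3 → Fin 3 → Prop) : ℕ :=
  ∑ a, ∑ b, if M a b then 1 else 0

end

section

lemma forall_fin_three {P : Fin 3 → Prop} : (∀ a, P a) ↔ P 0 ∧ P 1 ∧ P 2 := by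
  simp [Fin.forall_fin_succ]

lemma exists_fin_three {P : Fin 3 → Prop} : (∃ a, P a) ↔ P 0 ∨ P 1 ∨ P 2 := by
  simp [Fin.exists_fin_succ]

open scoped Classical in
lemma bool_matrix_induction {P : (Fin 3 → Fin 3 → Prop) → Prop}
    (h : ∀ m₀₀ m₀₁ m₀₂ m₁₀ m₁₁ m₁₂ m₂₀ m₂₁ m₂₂ : Bool,
      P fun a b => (![![m₀₀, m₀₁, m₀₂], ![m₁₀, m₁₁, m₁₂], ![m₂₀, m₂₁, m₂₂]] a b : Bool) = true)
    (M : Fin 3 → Fin 3 → Prop) : P M := by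
  have h1 := h (decide (M 0 0)) (decide (M 0 1)) (decide (M 0 2)) (decide (M 1 0))
    (decide (M 1 1)) (decide (M 1 2)) (decide (M 2 0)) (decide (M 2 1)) (decide (M 2 2))
  convert h1 using 1
  funext a b
  fin_cases a <;> fin_cases b <;> simp

open scoped Classical in
lemma entries_bool (B : Fin 3 → Fin 3 → Bool) :
    entries (fun a b => B a b = true) = ∑ a, ∑ b, (B a b).toNat := by
  refine sum_congr rfl fun a _ => sum_congr rfl fun b _ => ?_
  cases h : B a b <;> simp [h]

set_option synthInstance.maxHeartbeats 400000
set_option synthInstance.maxSize 2000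

lemma entries_le : ∀ M, ¬ HasPerm M → entries M ≤ 6 := by
  apply bool_matrix_induction
  simp +decide only [entries_bool, Fin.sum_univ_three, Matrix.cons_val, forall_fin_three,
    exists_fin_three, true_and, and_true, false_and, and_false, or_false, false_or,
    not_true_eq_false, not_false_eq_true, true_or, or_true, imp_false, forall_const,
    IsEmpty.forall_iff, implies_true, false_implies,
    true_implies, HasPerm]

lemma shape_of_five_le : ∀ M, ¬ HasPerm M → 5 ≤ entries M →
    (∃ a₁ a₂, RowPair M a₁ a₂) ∨ (∃ b₁ b₂, RowPair (fun b a => M a b) b₁ b₂) ∨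
      ∃ r c, IsCross M r c := by
  apply bool_matrix_induction
  simp +decide only [entries_bool, Fin.sum_univ_three, Matrix.cons_val, forall_fin_three,
    exists_fin_three, true_and, and_true, false_and, and_false, or_false, false_or,
    not_true_eq_false, not_false_eq_true, true_or, or_true, imp_false, forall_const,
    IsEmpty.forall_iff, implies_true, false_implies,
    true_implies, HasPerm, RowPair, IsCross]

lemma shape_of_six_le : ∀ M, ¬ HasPerm M → 6 ≤ entries M →
    (∃ a₁ a₂, a₁ ≠ a₂ ∧ ∀ b, M a₁ b ∧ M a₂ b) ∨ (∃ b₁ b₂, b₁ ≠ b₂ ∧ ∀ a, M a b₁ ∧ M a b₂) := by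
  apply bool_matrix_induction
  simp +decide only [entries_bool, Fin.sum_univ_three, Matrix.cons_val, forall_fin_three,
    exists_fin_three, true_and, and_true, false_and, and_false, or_false, false_or,
    not_true_eq_false, not_false_eq_true, true_or, or_true, imp_false, forall_const,
    IsEmpty.forall_iff, implies_true, false_implies,
    true_implies, HasPerm]

lemma entries_transpose (M : Fin 3 → Fin 3 → Prop) :
    entries (fun b a => M a b) = entries M := sum_comm

lemma exists_entry_off_block : ∀ M, 5 ≤ entries M → ∀ a₁ a₂ b₁ b₂, a₁ ≠ a₂ → b₁ ≠ b₂ →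
    ∃ a b, M a b ∧ (a ≠ a₁ ∧ a ≠ a₂ ∨ b ≠ b₁ ∧ b ≠ b₂) := by
  apply bool_matrix_induction
  simp +decide only [entries_bool, Fin.sum_univ_three, Matrix.cons_val, forall_fin_three,
    exists_fin_three, true_and, and_true, false_and, and_false, or_false, false_or,
    not_true_eq_false, not_false_eq_true, true_or, or_true, imp_false, forall_const,
    IsEmpty.forall_iff, implies_true, false_implies,
    true_implies]

lemma exists_entry_off_row : ∀ M, 5 ≤ entries M → ∀ r, ∃ a b, M a b ∧ a ≠ r := by
  apply bool_matrix_induction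
  simp +decide only [entries_bool, Fin.sum_univ_three, Matrix.cons_val, forall_fin_three,
    exists_fin_three, true_and, and_true, false_and, and_false, or_false, false_or,
    not_true_eq_false, not_false_eq_true, true_or, or_true, imp_false, forall_const,
    IsEmpty.forall_iff, implies_true, false_implies,
    true_implies]

lemma exists_disjoint_entries : ∀ M, 5 ≤ entries M →
    ∃ a b c d, a ≠ c ∧ b ≠ d ∧ M a b ∧ M c d := by
  apply bool_matrix_induction
  simp +decide only [entries_bool, Fin.sum_univ_three, Matrix.cons_val, forall_fin_three,
    exists_fin_three, true_and, and_true, false_and, and_false, or_false, false_or,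
    not_true_eq_false, not_false_eq_true, true_or, or_true, imp_false, forall_const,
    IsEmpty.forall_iff, implies_true, false_implies,
    true_implies]

lemma exists_third : ∀ a b : Fin 3, ∃ c, c ≠ a ∧ c ≠ b := by decide

lemma RowPair.exists_entry {M : Fin 3 → Fin 3 → Prop} {a₁ a₂ : Fin 3} (h : RowPair M a₁ a₂)
    (b : Fin 3) : M a₁ b ∨ M a₂ b := by
  obtain ⟨c, hc, -⟩ := exists_third b b
  rcases h.2 b c hc.symm with h | h
  · exact Or.inl h.1
  · exact Or.inr h.2

/-- The two rows matched to two columns, in some order. -/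
lemma RowPair.exists_matching {M : Fin 3 → Fin 3 → Prop} {a₁ a₂ b₁ b₂ : Fin 3}
    (h : RowPair M a₁ a₂) (hb : b₁ ≠ b₂) :
    ∃ c₁ c₂, c₁ ≠ c₂ ∧ M a₁ c₁ ∧ M a₂ c₂ ∧ (c₁ = b₁ ∨ c₁ = b₂) ∧ (c₂ = b₁ ∨ c₂ = b₂) := by
  rcases h.2 b₁ b₂ hb with h | h
  · exact ⟨b₁, b₂, hb, h.1, h.2, by simp, by simp⟩
  · exact ⟨b₂, b₁, hb.symm, h.1, h.2, by simp, by simp⟩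

end

section Tame
open scoped Classical
variable {ι : Type*} {G : ι × Fin 3 → ι × Fin 3 → Prop}

/-- No `d ≤ 5` disjoint edges live on fewer than `d` blocks. -/
def Tame (G : ι × Fin 3 → ι × Fin 3 → Prop) : Prop :=
  ∀ (I : Finset ι) (ps : List ((ι × Fin 3) × (ι × Fin 3))), ps.length ≤ 5 →
    (∀ p ∈ ps, G p.1 p.2 ∧ p.1.1 ∈ I ∧ p.2.1 ∈ I) →
    (ps.flatMap fun p => [p.1, p.2]).Nodup → ps.length ≤ I.card

/-- The bipartite graph between two blocks. -/
def block (G : ι × Fin 3 → ι × Fin 3 → Prop) (i j : ι) : Fin 3 → Fin 3 → Prop :=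
  fun a b => G (i, a) (j, b)

lemma entries_block_comm (hG : ∀ p q, G p q → G q p) (i j : ι) :
    entries (block G i j) = entries (block G j i) := by
  rw [← entries_transpose]
  congr 1
  funext b a
  exact propext ⟨hG _ _, hG _ _⟩

namespace Tame

lemma not_hasPerm (h : Tame G) {i j : ι} (hij : i ≠ j) : ¬ HasPerm (block G i j) := by
  rintro ⟨a, b, c, hab, hac, hbc, h0, h1, h2⟩
  have := h {i, j} [((i, 0), (j, a)), ((i, 1), (j, b)), ((i, 2), (j, c))] (by simp)
    (by simpa using ⟨h0, h1, h2⟩) (by simp [hij, hij.symm, hab, hac, hbc])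
  rw [card_pair hij] at this
  simp at this

lemma not_four (h : Tame G) {i j k : ι} {p₁ q₁ p₂ q₂ p₃ q₃ p₄ q₄ : ι × Fin 3}
    (h₁ : G p₁ q₁) (h₂ : G p₂ q₂) (h₃ : G p₃ q₃) (h₄ : G p₄ q₄)
    (hI : ∀ p ∈ [p₁, q₁, p₂, q₂, p₃, q₃, p₄, q₄], p.1 = i ∨ p.1 = j ∨ p.1 = k)
    (hd : [p₁, q₁, p₂, q₂, p₃, q₃, p₄, q₄].Nodup) : False := by
  simp only [List.mem_cons, List.not_mem_nil, or_false, forall_eq_or_imp, forall_eq] at hI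
  have := h {i, j, k} [(p₁, q₁), (p₂, q₂), (p₃, q₃), (p₄, q₄)] (by simp)
    (by simp [*]) (by simpa using hd)
  have h3 := card_le_three (a := i) (b := j) (c := k)
  simp at this
  omega

lemma not_five (h : Tame G) {i j k l : ι} {p₁ q₁ p₂ q₂ p₃ q₃ p₄ q₄ p₅ q₅ : ι × Fin 3}
    (h₁ : G p₁ q₁) (h₂ : G p₂ q₂) (h₃ : G p₃ q₃) (h₄ : G p₄ q₄) (h₅ : G p₅ q₅)
    (hI : ∀ p ∈ [p₁, q₁, p₂, q₂, p₃, q₃, p₄, q₄, p₅, q₅],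
      p.1 = i ∨ p.1 = j ∨ p.1 = k ∨ p.1 = l)
    (hd : [p₁, q₁, p₂, q₂, p₃, q₃, p₄, q₄, p₅, q₅].Nodup) : False := by
  simp only [List.mem_cons, List.not_mem_nil, or_false, forall_eq_or_imp, forall_eq] at hI
  have := h {i, j, k, l} [(p₁, q₁), (p₂, q₂), (p₃, q₃), (p₄, q₄), (p₅, q₅)] (by simp)
    (by simp [*]) (by simpa using hd)
  have h3 := card_le_four (a := i) (b := j) (c := k) (d := l)
  simp at this
  omega

end Tame
end Tame

section
open scoped Classical

variable {ι : Type*} {G : ι × Fin 3 → ι × Fin 3 → Prop}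

/-- Two vertices of block `i` can be matched to any two vertices of block `j`. -/
def Arc (G : ι × Fin 3 → ι × Fin 3 → Prop) (i j : ι) : Prop :=
  i ≠ j ∧ ∃ a₁ a₂, RowPair (block G i j) a₁ a₂

/-- Some vertex of each of the blocks `i`, `j` is joined to all of the other block. -/
def Crossed (G : ι × Fin 3 → ι × Fin 3 → Prop) (i j : ι) : Prop :=
  i ≠ j ∧ ∃ r c, IsCross (block G i j) r c

lemma exists_other_two : ∀ q : Fin 3, ∃ q₁ q₂, q₁ ≠ q₂ ∧ q₁ ≠ q ∧ q₂ ≠ q := by decide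

lemma exists_mem_pair_ne : ∀ q₁ q₂ : Fin 3, q₁ ≠ q₂ → ∀ q, ∃ q', (q' = q₁ ∨ q' = q₂) ∧ q' ≠ q := by
  decide

namespace Tame

lemma not_heads (h : Tame G) {i j i' j' : ι} (hij : Arc G i j) (hij' : Arc G i' j')
    (h1 : i ≠ i') (h2 : i ≠ j') (h3 : j ≠ i') (h4 : j ≠ j') (f f' : Fin 3) :
    ¬ block G j j' f f' := by
  intro hff
  obtain ⟨hne, a₁, a₂, ha⟩ := hij
  obtain ⟨hne', a₁', a₂', ha'⟩ := hij'
  obtain ⟨b₁, b₂, hb, hb1, hb2⟩ := exists_other_two f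
  obtain ⟨b₁', b₂', hb', hb1', hb2'⟩ := exists_other_two f'
  obtain ⟨c₁, c₂, hc, e₁, e₂, hc1, hc2⟩ := ha.exists_matching hb
  obtain ⟨c₁', c₂', hc', e₁', e₂', hc1', hc2'⟩ := ha'.exists_matching hb'
  have k1 : c₁ ≠ f := by rcases hc1 with rfl | rfl <;> assumption
  have k2 : c₂ ≠ f := by rcases hc2 with rfl | rfl <;> assumption
  have k3 : c₁' ≠ f' := by rcases hc1' with rfl | rfl <;> assumption
  have k4 : c₂' ≠ f' := by rcases hc2' with rfl | rfl <;> assumption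
  have ha1 := ha.1
  have ha1' := ha'.1
  refine h.not_five (i := i) (j := j) (k := i') (l := j') e₁ e₂ e₁' e₂' hff (by simp) ?_
  simp [*, hne.symm, hne'.symm, h3.symm, h4.symm]

lemma arc_six_le_head (h : Tame G) {i j k : ι} (hij : Arc G i j) (hik : i ≠ k) (hjk : j ≠ k)
    (h6 : 6 ≤ entries (block G j k)) (h5 : 5 ≤ entries (block G i k)) : False := by
  obtain ⟨hne, a₁, a₂, ha⟩ := hij
  have ha1 := ha.1
  rcases shape_of_six_le _ (h.not_hasPerm hjk) h6 with ⟨f₁, f₂, hf, hfull⟩ | ⟨q₁, q₂, hq, hfull⟩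
  · obtain ⟨f₃, hf31, hf32⟩ := exists_third f₁ f₂
    obtain ⟨x, hx⟩ : ∃ x, block G i j x f₃ := by
      rcases ha.exists_entry f₃ with h | h
      exacts [⟨_, h⟩, ⟨_, h⟩]
    obtain ⟨e, q, heq, hex⟩ := exists_entry_off_row _ h5 x
    obtain ⟨q₁, q₂, hq, hq1, hq2⟩ := exists_other_two q
    refine h.not_four (i := i) (j := j) (k := k) hx heq (hfull q₁).1 (hfull q₂).2 (by simp) ?_
    simp [*, hne.symm, hjk.symm, hex.symm, hq1.symm, hq2.symm]
  · obtain ⟨e, q, heq, hoff⟩ := exists_entry_off_block _ h5 a₁ a₂ q₁ q₂ ha.1 hq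
    rcases hoff with ⟨he1, he2⟩ | ⟨hq1, hq2⟩
    · obtain ⟨q', hq', hne'⟩ := exists_mem_pair_ne q₁ q₂ hq q
      have hf : block G j k 0 q' := by
        rcases hq' with rfl | rfl
        exacts [(hfull 0).1, (hfull 0).2]
      obtain ⟨c₁, c₂, hc, e₁, e₂, hc1, hc2⟩ := ha.exists_matching (show (1 : Fin 3) ≠ 2 by decide)
      have k1 : c₁ ≠ 0 := by rcases hc1 with rfl | rfl <;> decide
      have k2 : c₂ ≠ 0 := by rcases hc2 with rfl | rfl <;> decide
      refine h.not_four (i := i) (j := j) (k := k) heq hf e₁ e₂ (by simp) ?_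
      simp [*, hne.symm, hik.symm, hjk.symm, hne'.symm, k1.symm, k2.symm]
    · obtain ⟨x, hx, hxe⟩ := exists_mem_pair_ne a₁ a₂ ha.1 e
      obtain ⟨f, hf⟩ : ∃ f, block G i j x f := by
        rcases ha.2 0 1 (by decide) with h | h <;> rcases hx with rfl | rfl
        exacts [⟨_, h.1⟩, ⟨_, h.2⟩, ⟨_, h.1⟩, ⟨_, h.2⟩]
      obtain ⟨f₁, f₂, hff, hf1, hf2⟩ := exists_other_two f
      refine h.not_four (i := i) (j := j) (k := k) heq hf (hfull f₁).1 (hfull f₂).2 (by simp) ?_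
      simp [*, hik.symm, hjk.symm, hxe.symm, hf1.symm, hf2.symm]

lemma arc_six_le_tail (h : Tame G) {i j k : ι} (hij : Arc G i j) (hik : i ≠ k) (hjk : j ≠ k)
    (h6 : 6 ≤ entries (block G i k)) (h5 : 5 ≤ entries (block G j k)) : False := by
  obtain ⟨hne, a₁, a₂, ha⟩ := hij
  have ha1 := ha.1
  rcases shape_of_six_le _ (h.not_hasPerm hik) h6 with ⟨b₁, b₂, hb, hfull⟩ | ⟨q₁, q₂, hq, hfull⟩
  · obtain ⟨f₁, q₁, f₂, q₂, hf, hq, e₁, e₂⟩ := exists_disjoint_entries _ h5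
    obtain ⟨f₃, hf31, hf32⟩ := exists_third f₁ f₂
    obtain ⟨q₃, hq31, hq32⟩ := exists_third q₁ q₂
    obtain ⟨x, hx⟩ : ∃ x, block G i j x f₃ := by
      rcases ha.exists_entry f₃ with h | h
      exacts [⟨_, h⟩, ⟨_, h⟩]
    obtain ⟨b, hb', hbx⟩ := exists_mem_pair_ne b₁ b₂ hb x
    have hbq : block G i k b q₃ := by
      rcases hb' with rfl | rfl
      exacts [(hfull q₃).1, (hfull q₃).2]
    refine h.not_four (i := i) (j := j) (k := k) hx hbq e₁ e₂ (by simp) ?_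
    simp [*, hne.symm, hjk.symm, hbx.symm]
  · obtain ⟨f, q, -, -, -, -, hfq, -⟩ := exists_disjoint_entries _ h5
    obtain ⟨b₁, b₂, hb, hb1, hb2⟩ := exists_other_two f
    obtain ⟨c₁, c₂, hc, e₁, e₂, hc1, hc2⟩ := ha.exists_matching hb
    have k1 : c₁ ≠ f := by rcases hc1 with rfl | rfl <;> assumption
    have k2 : c₂ ≠ f := by rcases hc2 with rfl | rfl <;> assumption
    obtain ⟨a₃, ha3, ha3'⟩ := exists_third a₁ a₂
    obtain ⟨q', hq', hne'⟩ := exists_mem_pair_ne q₁ q₂ hq q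
    have haq : block G i k a₃ q' := by
      rcases hq' with rfl | rfl
      exacts [(hfull a₃).1, (hfull a₃).2]
    refine h.not_four (i := i) (j := j) (k := k) haq hfq e₁ e₂ (by simp) ?_
    simp [*, hne.symm, hik.symm, hjk.symm, k1.symm, k2.symm]

/-- The number of edges between two different blocks. -/
noncomputable def _root_.weight (G : ι × Fin 3 → ι × Fin 3 → Prop) (i j : ι) : ℕ :=
  if i = j then 0 else entries (block G i j)

lemma weight_le_six (h : Tame G) (i j : ι) : weight G i j ≤ 6 := by
  unfold weight
  split_ifs with hij
  exacts [by simp, entries_le _ (h.not_hasPerm hij)]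

lemma _root_.weight_comm (hG : ∀ p q, G p q → G q p) (i j : ι) : weight G i j = weight G j i := by
  unfold weight
  rw [entries_block_comm hG i j]
  simp [eq_comm]

lemma weight_add_weight_le (h : Tame G) {i j k : ι} (hij : Arc G i j) (hik : i ≠ k)
    (hjk : j ≠ k) : weight G i k + weight G j k ≤ 10 := by
  have h1 := h.weight_le_six i k
  have h2 := h.weight_le_six j k
  by_contra hlt
  have h3 := h.arc_six_le_head hij hik hjk
  have h4 := h.arc_six_le_tail hij hik hjk
  simp only [weight, hik, hjk, if_false] at *
  by_cases h6 : 6 ≤ entries (block G j k)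
  · exact h3 h6 (by omega)
  · exact h4 (by omega) (by omega)

lemma weight_heads (h : Tame G) {i j i' j' : ι} (hij : Arc G i j) (hij' : Arc G i' j')
    (h1 : i ≠ i') (h2 : i ≠ j') (h3 : j ≠ i') (h4 : j ≠ j') : weight G j j' = 0 := by
  simp only [weight, h4, if_false, entries]
  exact sum_eq_zero fun a _ => sum_eq_zero fun b _ => if_neg (h.not_heads hij hij' h1 h2 h3 h4 a b)

lemma weight_arcs_le (h : Tame G) {i j i' j' : ι} (hij : Arc G i j)
    (hij' : Arc G i' j') (h1 : i ≠ i') (h2 : i ≠ j') (h3 : j ≠ i') (h4 : j ≠ j') :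
    (weight G i i' + weight G j i') + (weight G i j' + weight G j j') ≤ 18 := by
  have k0 := h.weight_heads hij hij' h1 h2 h3 h4
  have k1 := h.weight_le_six i i'
  have k2 := h.weight_le_six i j'
  have k3 := h.weight_le_six j i'
  omega

lemma weight_add_crossed_le (h : Tame G) (hG : ∀ p q, G p q → G q p) {i j : ι}
    (hij : ¬ Arc G i j) (hji : ¬ Arc G j i) :
    weight G i j + (if ¬ Crossed G i j then 1 else 0) ≤ 5 := by
  unfold weight
  by_cases hne : i = j
  · simp only [hne, if_true]; split_ifs <;> simp
  simp only [hne, if_false]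
  have hT : (fun b a => block G i j a b) = block G j i := by
    funext b a; exact propext ⟨hG _ _, hG _ _⟩
  have h6 : entries (block G i j) < 6 := by
    by_contra hlt
    rcases shape_of_six_le _ (h.not_hasPerm hne) (not_lt.1 hlt) with
      ⟨a, b, hab, hf⟩ | ⟨a, b, hab, hf⟩
    · exact hij ⟨hne, a, b, hab, fun c d _ => Or.inl ⟨(hf c).1, (hf d).2⟩⟩
    · exact hji ⟨Ne.symm hne, a, b, hab, fun c d _ => Or.inl ⟨hG _ _ (hf c).1, hG _ _ (hf d).2⟩⟩
  by_cases h5 : 5 ≤ entries (block G i j)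
  · have : Crossed G i j := by
      rcases shape_of_five_le _ (h.not_hasPerm hne) h5 with ⟨a, b, hf⟩ | ⟨a, b, hf⟩ | hf
      · exact absurd ⟨hne, a, b, hf⟩ hij
      · rw [hT] at hf; exact absurd ⟨Ne.symm hne, a, b, hf⟩ hji
      · exact ⟨hne, hf⟩
    simp only [this, not_true_eq_false, if_false]; omega
  · split_ifs <;> omega

lemma exists_arcs (h : Tame G) (hG : ∀ p q, G p q → G q p) (W : Finset ι) :
    ∃ (W₀ : Finset ι) (A : Finset (ι × ι)), (∀ p ∈ A, Arc G p.1 p.2 ∧ p.1 ∈ W ∧ p.2 ∈ W) ∧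
      W₀ ⊆ W ∧
      (∀ φ : ι → ℕ, ∑ i ∈ W, φ i = ∑ i ∈ W₀, φ i + ∑ p ∈ A, (φ p.1 + φ p.2)) ∧
      ∑ i ∈ W, ∑ j ∈ W, weight G i j + 2 * A.card ^ 2 +
        ∑ i ∈ W₀, ∑ j ∈ W₀, (if ¬ Crossed G i j then 1 else 0) ≤ 5 * W.card ^ 2 := by
  induction W using Finset.strongInduction with
  | H W ih =>
  by_cases hW : ∀ i ∈ W, ∀ j ∈ W, ¬ Arc G i j
  · refine ⟨W, ∅, by simp, Subset.rfl, by simp, ?_⟩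
    simp only [card_empty]
    have := sum_le_card_nsmul W (fun i => ∑ j ∈ W, (weight G i j +
      (if ¬ Crossed G i j then 1 else 0))) (W.card * 5) fun i hi =>
        sum_le_card_nsmul W _ 5 fun j hj => h.weight_add_crossed_le hG (hW i hi j hj) (hW j hj i hi)
    simp only [sum_add_distrib, smul_eq_mul] at this
    nlinarith
  push Not at hW
  obtain ⟨i, hi, j, hj, hij⟩ := hW
  have hne := hij.1
  set W' := (W.erase i).erase j with hW'
  have hj' : j ∈ W.erase i := mem_erase.2 ⟨hne.symm, hj⟩
  have hss : W' ⊂ W := (erase_ssubset hj').trans_subset (erase_subset _ _)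
  have hW2 : ∀ φ : ι → ℕ, ∑ k ∈ W, φ k = φ i + φ j + ∑ k ∈ W', φ k := fun φ => by
    rw [← add_sum_erase W φ hi, ← add_sum_erase _ φ hj', add_assoc]
  obtain ⟨W₀, A, hA, hsub, hsum, hle⟩ := ih W' hss
  have hnot : ∀ k ∈ W', i ≠ k ∧ j ≠ k := fun k hk => by
    simp only [hW', mem_erase] at hk
    exact ⟨fun h => hk.2.1 h.symm, fun h => hk.1 h.symm⟩
  have hnA : (i, j) ∉ A := fun hmem => (hnot _ (hA _ hmem).2.1).1 rfl
  refine ⟨W₀, insert (i, j) A, ?_, hsub.trans hss.subset, ?_, ?_⟩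
  · simp only [mem_insert, forall_eq_or_imp]
    exact ⟨⟨hij, hi, hj⟩, fun p hp =>
      ⟨(hA p hp).1, hss.subset (hA p hp).2.1, hss.subset (hA p hp).2.2⟩⟩
  · intro φ
    rw [hW2, hsum, sum_insert hnA]
    ring
  · have hc : W.card = W'.card + 2 := by
      have := hW2 fun _ => 1
      simp at this; omega
    have hc' : W'.card = W₀.card + 2 * A.card := by
      have := hsum fun _ => 1
      simp at this; omega
    have hij6 := h.weight_le_six i j
    have h0 : ∀ k, weight G k k = 0 := fun k => by simp [weight]
    have hcross : ∑ k ∈ W', (weight G i k + weight G j k) ≤ W₀.card * 10 + A.card * 18 := by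
      rw [hsum]
      refine add_le_add (sum_le_card_nsmul _ _ 10 fun k hk => ?_)
        (sum_le_card_nsmul _ _ 18 fun p hp => ?_)
      · exact h.weight_add_weight_le hij (hnot k (hsub hk)).1 (hnot k (hsub hk)).2
      · obtain ⟨hp, hp1, hp2⟩ := hA p hp
        exact h.weight_arcs_le hij hp (hnot _ hp1).1 (hnot _ hp2).1 (hnot _ hp1).2 (hnot _ hp2).2
    have hT : ∑ k ∈ W, ∑ l ∈ W, weight G k l = ∑ k ∈ W', ∑ l ∈ W', weight G k l +
        2 * ∑ k ∈ W', (weight G i k + weight G j k) + 2 * weight G i j := by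
      rw [hW2]
      simp only [hW2 (weight G _), sum_add_distrib, h0]
      rw [weight_comm hG j i, sum_congr rfl fun k _ => weight_comm hG k i,
        sum_congr rfl fun k _ => weight_comm hG k j]
      ring
    rw [hT, card_insert_of_notMem hnA, hc]
    nlinarith

/-- In a tame graph the total number of edges between blocks is at most `5 m ^ 2`, and near
equality forces almost all pairs of blocks to be crossed. -/
lemma exists_weight_le [Fintype ι] (h : Tame G) (hG : ∀ p q, G p q → G q p) :
    ∃ r, 2 * r ≤ Fintype.card ι ∧
      ∑ i, ∑ j, weight G i j + 2 * r ^ 2 ≤ 5 * Fintype.card ι ^ 2 ∧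
      ∑ i, ∑ j, weight G i j + 2 * r ^ 2 + ∑ i, ∑ j, (if ¬ Crossed G i j then 1 else 0) ≤
        5 * Fintype.card ι ^ 2 + 4 * r * Fintype.card ι := by
  obtain ⟨W₀, A, hA, hsub, hsum, hle⟩ := h.exists_arcs hG univ
  have hc : Fintype.card ι = W₀.card + 2 * A.card := by
    have := hsum fun _ => 1
    simp at this; omega
  refine ⟨A.card, by omega, le_of_add_le_left hle, ?_⟩
  have hx : ∀ i, ∑ j ∈ W₀, (if ¬ Crossed G i j then 1 else 0) ≤ W₀.card := fun i =>
    (sum_le_card_nsmul W₀ _ 1 (fun j _ => by split_ifs <;> simp)).trans_eq (by simp)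
  have hA2 : ∀ i, ∑ p ∈ A, ((if ¬ Crossed G i p.1 then 1 else 0) +
      (if ¬ Crossed G i p.2 then 1 else 0)) ≤ A.card * 2 := fun i =>
    sum_le_card_nsmul A _ 2 (fun j _ => by split_ifs <;> simp)
  have hrow : ∀ i, ∑ j, (if ¬ Crossed G i j then 1 else 0) ≤
      ∑ j ∈ W₀, (if ¬ Crossed G i j then 1 else 0) + A.card * 2 := fun i => by
    rw [hsum]; exact Nat.add_le_add_left (hA2 i) _
  have hall : ∑ i, ∑ j, (if ¬ Crossed G i j then 1 else 0) ≤
      ∑ i ∈ W₀, ∑ j ∈ W₀, (if ¬ Crossed G i j then 1 else 0) + W₀.card * (A.card * 2) +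
        A.card * (2 * Fintype.card ι) := by
    rw [hsum]
    refine add_le_add ?_ (sum_le_card_nsmul _ _ _ fun p _ => ?_)
    · refine (sum_le_sum fun i _ => hrow i).trans ?_
      simp [sum_add_distrib]
    · have h1 := hrow p.1
      have h2 := hrow p.2
      have h3 := hx p.1
      have h4 := hx p.2
      omega
  rw [card_univ] at hle
  nlinarith

/-- The centre of a block is the same in all crossed triangles. -/
lemma center_eq (h : Tame G) {i j k : ι} (hij : i ≠ j) (hik : i ≠ k) (hjk : j ≠ k)
    {r c r' c' : Fin 3} (h₁ : IsCross (block G i j) r c) (h₂ : IsCross (block G i k) r' c')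
    (h₃ : Crossed G j k) : r = r' := by
  by_contra hr
  obtain ⟨-, x, y, h₃⟩ := h₃
  obtain ⟨f, f₁, hff, hf, hf1⟩ := exists_other_two x
  obtain ⟨q, q₁, hqq, hq, hq1⟩ := exists_other_two y
  refine h.not_four (i := i) (j := j) (k := k) (h₁ r f (Or.inl rfl)) (h₂ r' q (Or.inl rfl))
    (h₃ x q₁ (Or.inl rfl)) (h₃ f₁ y (Or.inr rfl)) (by simp) ?_
  simp [*, hij.symm, hjk.symm, hf1.symm]

end Tame
end

section
open scoped Classical

variable {V : Type*} {R : V → V → V → Prop}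

/-- The pair `a`, `b` forms an edge with at least five vertices of `L`. -/
def Rich (R : V → V → V → Prop) (L : Finset V) (a b : V) : Prop :=
  5 ≤ (L.filter fun v => R v a b).card

/-- The graph of rich pairs between the triples. -/
def richGraph {ι : Type*} (R : V → V → V → Prop) (L : Finset V) (f : ι → Fin 3 → V)
    (p q : ι × Fin 3) : Prop :=
  Rich R L (f p.1 p.2) (f q.1 q.2)

lemma richGraph_symm {ι : Type*} {L : Finset V} {f : ι → Fin 3 → V} (hR : IsTripleRel R) (p q : ι × Fin 3) (h : richGraph R L f p q) :
    richGraph R L f q p := by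
  unfold richGraph Rich at *
  have : ∀ v, R v (f q.1 q.2) (f p.1 p.2) ↔ R v (f p.1 p.2) (f q.1 q.2) :=
    fun v => ⟨hR.swap₂, hR.swap₂⟩
  simpa only [this] using h

variable [DecidableEq V]

/-- The triples `f i` are edges forming a largest matching of the graph on their union with `L`. -/
structure IsMaxFamily {ι : Type*} [Fintype ι] (R : V → V → V → Prop) (L : Finset V)
    (f : ι → Fin 3 → V) : Prop where
  rel : ∀ i, R (f i 0) (f i 1) (f i 2)
  inj : ∀ i a j b, f i a = f j b → i = j ∧ a = b
  notMem : ∀ i a, f i a ∉ L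
  max : ∀ N, Matchable R N → (∀ v ∈ N, v ∈ L ∨ ∃ i a, f i a = v) → N.card ≤ 3 * Fintype.card ι

lemma exists_extension (hR : IsTripleRel R) {L N₀ : Finset V} (hN₀ : Matchable R N₀) :
    ∀ ps : List (V × V), (∀ p ∈ ps, Rich R L p.1 p.2) →
      (ps.flatMap fun p => [p.1, p.2]).Nodup →
      (∀ p ∈ ps, p.1 ∉ N₀ ∧ p.1 ∉ L ∧ p.2 ∉ N₀ ∧ p.2 ∉ L) → (N₀ ∩ L).card + ps.length ≤ 5 →
      ∃ N, Matchable R N ∧ N.card = N₀.card + 3 * ps.length ∧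
        (∀ v ∈ N, v ∈ N₀ ∨ v ∈ L ∨ v ∈ ps.flatMap fun p => [p.1, p.2]) ∧
        (N ∩ L).card ≤ (N₀ ∩ L).card + ps.length
  | [], _, _, _, _ => ⟨N₀, hN₀, by simp, fun v hv => Or.inl hv, by simp⟩
  | p :: ps, h1, h2, h3, h4 => by
    simp only [List.flatMap_cons, List.cons_append, List.nil_append, List.nodup_cons,
      List.mem_cons, not_or, List.length_cons, forall_eq_or_imp] at h1 h2 h3 h4 ⊢
    obtain ⟨N, hN, hc, hsub, hL⟩ := exists_extension hR hN₀ ps h1.2 h2.2.2 h3.2 (by omega)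
    obtain ⟨v, hv, hvN⟩ : ∃ v ∈ L.filter (fun v => R v p.1 p.2), v ∉ N ∩ L := by
      refine exists_mem_notMem_of_card_lt_card (lt_of_lt_of_le ?_ h1.1)
      omega
    rw [mem_filter] at hv
    have hvN' : v ∉ N := fun h => hvN (mem_inter.2 ⟨h, hv.1⟩)
    have hp1 : p.1 ∉ N := fun h => by
      rcases hsub _ h with h | h | h
      exacts [h3.1.1 h, h3.1.2.1 h, h2.1.2 h]
    have hp2 : p.2 ∉ N := fun h => by
      rcases hsub _ h with h | h | h
      exacts [h3.1.2.2.1 h, h3.1.2.2.2 h, h2.2.1 h]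
    refine ⟨_, hN.step hv.2 hvN' hp1 hp2, ?_, ?_, ?_⟩
    · rw [Matchable.card_step hR hv.2 hvN' hp1 hp2, hc]; ring
    · intro w hw
      simp only [mem_insert] at hw
      rcases hw with rfl | rfl | rfl | hw
      · exact Or.inr (Or.inl hv.1)
      · simp
      · simp
      · rcases hsub _ hw with h | h | h <;> simp [h]
    · rw [insert_inter_of_mem hv.1, insert_inter_of_notMem h3.1.2.1,
        insert_inter_of_notMem h3.1.2.2.2]
      exact (card_insert_le _ _).trans (by omega)

namespace IsMaxFamily

variable {ι : Type*} [Fintype ι] {L : Finset V} {f : ι → Fin 3 → V}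

lemma matchable_range (h : IsMaxFamily R L f) (I : Finset ι) :
    Matchable R (I.biUnion fun i => univ.image (f i)) := by
  refine Matchable.biUnion I _ (fun i _ => ?_) fun i _ j _ hij => ?_
  · have : univ.image (f i) = {f i 0, f i 1, f i 2} := by
      ext v; simp [Fin.exists_fin_succ, eq_comm]
    rw [this]
    exact Matchable.single (h.rel i)
  · rw [disjoint_left]
    simp only [mem_image, mem_univ, true_and, not_exists, forall_exists_index]
    rintro _ a rfl b hb
    exact hij (h.inj _ _ _ _ hb).1.symm

lemma card_range (h : IsMaxFamily R L f) (I : Finset ι) :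
    (I.biUnion fun i => univ.image (f i)).card = 3 * I.card := by
  rw [card_biUnion, sum_congr rfl fun i _ => card_image_of_injective univ
    (fun a b hab => (h.inj i a i b hab).2)]
  · simp [mul_comm]
  · intro i _ j _ hij
    change Disjoint (univ.image (f i)) (univ.image (f j))
    rw [disjoint_left]
    simp only [mem_image, mem_univ, true_and, not_exists, forall_exists_index]
    rintro _ a rfl b hb
    exact hij (h.inj _ _ _ _ hb).1.symm

/-- A matching inside `L` and few of the triples cannot be larger than the triples it uses. -/
lemma card_add_le (h : IsMaxFamily R L f) (hR : IsTripleRel R) (I : Finset ι) {N₀ : Finset V}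
    (hN₀ : Matchable R N₀) (hsub : ∀ v ∈ N₀, v ∈ L ∨ ∃ i ∈ I, ∃ a, f i a = v)
    (ps : List ((ι × Fin 3) × (ι × Fin 3)))
    (hps : ∀ p ∈ ps, Rich R L (f p.1.1 p.1.2) (f p.2.1 p.2.2) ∧ p.1.1 ∈ I ∧ p.2.1 ∈ I ∧
      f p.1.1 p.1.2 ∉ N₀ ∧ f p.2.1 p.2.2 ∉ N₀)
    (hd : (ps.flatMap fun p => [p.1, p.2]).Nodup) (hle : (N₀ ∩ L).card + ps.length ≤ 5) :
    N₀.card + 3 * ps.length ≤ 3 * I.card := by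
  let F : ι × Fin 3 → V := fun p => f p.1 p.2
  have hF : Function.Injective F := fun p q hpq => 
    Prod.ext (h.inj _ _ _ _ hpq).1 (h.inj _ _ _ _ hpq).2
  have hmap : ((ps.map fun p => (F p.1, F p.2)).flatMap fun p => [p.1, p.2]) =
      (ps.flatMap fun p => [p.1, p.2]).map F := by
    simp [List.flatMap_map, List.map_flatMap]
  obtain ⟨N, hN, hc, hNsub, -⟩ := exists_extension hR (L := L) hN₀ (ps.map fun p => (F p.1, F p.2))
    (by
      simp only [List.mem_map, forall_exists_index, and_imp]
      rintro _ p hp rfl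
      exact (hps p hp).1)
    (by rw [hmap]; exact hd.map hF)
    (by
      simp only [List.mem_map, forall_exists_index, and_imp]
      rintro _ p hp rfl
      exact ⟨(hps p hp).2.2.2.1, h.notMem _ _, (hps p hp).2.2.2.2, h.notMem _ _⟩)
    (by simpa using hle)
  have hNI : ∀ v ∈ N, v ∈ L ∨ ∃ i ∈ I, ∃ a, f i a = v := by
    intro v hv
    rcases hNsub v hv with hv | hv | hv
    · exact hsub v hv
    · exact Or.inl hv
    · rw [hmap] at hv
      simp only [List.mem_map, List.mem_flatMap, List.mem_cons, List.not_mem_nil, or_false] at hv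
      obtain ⟨q, ⟨p, hp, hq⟩, rfl⟩ := hv
      rcases hq with rfl | rfl
      · exact Or.inr ⟨_, (hps p hp).2.1, _, rfl⟩
      · exact Or.inr ⟨_, (hps p hp).2.2.1, _, rfl⟩
  have hdis : Disjoint N (Iᶜ.biUnion fun i => univ.image (f i)) := by
    rw [disjoint_left]
    intro v hv hv'
    simp only [mem_biUnion, mem_compl, mem_image, mem_univ, true_and] at hv'
    obtain ⟨j, hj, b, rfl⟩ := hv'
    rcases hNI _ hv with h' | ⟨i, hi, a, ha⟩
    · exact h.notMem _ _ h'
    · exact hj ((h.inj _ _ _ _ ha).1 ▸ hi)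
  have := h.max _ (hN.union (h.matchable_range Iᶜ) hdis) (by
    intro v hv
    rcases mem_union.1 hv with hv | hv
    · rcases hNI v hv with hv | ⟨i, -, a, ha⟩
      exacts [Or.inl hv, Or.inr ⟨i, a, ha⟩]
    · simp only [mem_biUnion, mem_image, mem_univ, true_and] at hv
      obtain ⟨j, -, b, hb⟩ := hv
      exact Or.inr ⟨j, b, hb⟩)
  rw [card_union_of_disjoint hdis, hc, h.card_range, card_compl, List.length_map] at this
  have := card_le_univ I
  omega

lemma tame (h : IsMaxFamily R L f) (hR : IsTripleRel R) : Tame (richGraph R L f) := by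
  intro I ps hlen hps hd
  have := h.card_add_le hR I Matchable.empty (by simp) ps
    (fun p hp => ⟨(hps p hp).1, (hps p hp).2.1, (hps p hp).2.2, by simp, by simp⟩) hd (by simpa)
  simp at this
  omega

lemma pairDeg_self (h : IsMaxFamily R L f) (hR : IsTripleRel R) {v : V} (hv : v ∈ L) :
    pairDeg R v (L ×ˢ L) = 0 := by
  rw [pairDeg, card_eq_zero, filter_eq_empty_iff]
  rintro ⟨x, y⟩ hxy hr
  rw [mem_product] at hxy
  have := h.card_add_le hR ∅ (Matchable.single hr)
    (by
        simp only [mem_insert, mem_singleton]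
        rintro w (rfl | rfl | rfl)
        exacts [Or.inl hv, Or.inl hxy.1, Or.inl hxy.2])
    [] (by simp) (by simp) (by
      have := (card_le_card (inter_subset_left (s₁ := ({v, x, y} : Finset V)) (s₂ := L))).trans
        card_le_three
      simp only [List.length_nil]; omega)
  rw [card_eq_three.2 ⟨v, x, y, hR.ne hr, (hR.ne' hr).2, (hR.ne' hr).1, rfl⟩] at this
  simp at this

lemma pairDeg_le_of_lt (h : IsMaxFamily R L f) (hR : IsTripleRel R) {i : ι} {a b : Fin 3}
    (hab : a ≠ b) (ha : 0 < pairDeg R (f i a) (L ×ˢ L)) :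
    pairDeg R (f i b) (L ×ˢ L) ≤ 4 * L.card := by
  obtain ⟨⟨x, y⟩, hxy⟩ := card_pos.1 ha
  simp only [mem_filter, mem_product] at hxy
  obtain ⟨⟨hx, hy⟩, hr⟩ := hxy
  by_contra! hlt
  have hcov : ((({x, y} : Finset V) ×ˢ L) ∪ (L ×ˢ ({x, y} : Finset V))).card ≤ 4 * L.card := by
    refine (card_union_le _ _).trans ?_
    rw [card_product, card_product]
    have := card_le_two (a := x) (b := y)
    nlinarith
  obtain ⟨⟨x', y'⟩, hxy', hnot⟩ := exists_mem_notMem_of_card_lt_card (hcov.trans_lt hlt)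
  simp only [mem_filter, mem_product, mem_union, mem_insert, mem_singleton, not_or,
    not_and] at hxy' hnot
  obtain ⟨⟨hx', hy'⟩, hr'⟩ := hxy'
  have hfL := h.notMem i
  have hfab : f i a ≠ f i b := fun he => hab (h.inj _ _ _ _ he).2
  have hdis : Disjoint ({f i a, x, y} : Finset V) {f i b, x', y'} := by
    simp only [disjoint_left, mem_insert, mem_singleton]
    grind
  have hN := (Matchable.single hr).union (Matchable.single hr') hdis
  have hc : ({f i a, x, y} ∪ {f i b, x', y'} : Finset V).card = 6 := by
    rw [card_union_of_disjoint hdis,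
      card_eq_three.2 ⟨_, x, y, hR.ne hr, (hR.ne' hr).2, (hR.ne' hr).1, rfl⟩,
      card_eq_three.2 ⟨_, x', y', hR.ne hr', (hR.ne' hr').2, (hR.ne' hr').1, rfl⟩]
  have := h.card_add_le hR {i} hN (by
      simp only [mem_union, mem_insert, mem_singleton]
      rintro v ((rfl | rfl | rfl) | (rfl | rfl | rfl)) <;> simp [*])
    [] (by simp) (by simp) (by
      have : ({f i a, x, y} ∪ {f i b, x', y'} : Finset V) ∩ L ⊆ {x, y, x', y'} := by
        intro v
        simp only [mem_inter, mem_union, mem_insert, mem_singleton]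
        grind
      have := (card_le_card this).trans card_le_four
      simp only [List.length_nil]; omega)
  rw [hc] at this
  simp at this

lemma sum_pairDeg_le (h : IsMaxFamily R L f) (hR : IsTripleRel R) (i : ι) :
    ∑ a, pairDeg R (f i a) (L ×ˢ L) ≤ L.card ^ 2 + 8 * L.card := by
  have h1 : ∀ a, pairDeg R (f i a) (L ×ˢ L) ≤ L.card ^ 2 := fun a =>
    (pairDeg_le_card _ _).trans (by rw [card_product, sq])
  rw [Fin.sum_univ_three]
  have h01 := h.pairDeg_le_of_lt hR (i := i) (a := 0) (b := 1) (by decide)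
  have h02 := h.pairDeg_le_of_lt hR (i := i) (a := 0) (b := 2) (by decide)
  have h12 := h.pairDeg_le_of_lt hR (i := i) (a := 1) (b := 2) (by decide)
  have h10 := h.pairDeg_le_of_lt hR (i := i) (a := 1) (b := 0) (by decide)
  have := h1 0
  have := h1 1
  have := h1 2
  rcases Nat.eq_zero_or_pos (pairDeg R (f i 0) (L ×ˢ L)) with h0 | h0 <;>
  rcases Nat.eq_zero_or_pos (pairDeg R (f i 1) (L ×ˢ L)) with h1 | h1 <;>
  first
  | (have := h01 h0; have := h02 h0; omega)
  | (have := h12 h1; omega)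
  | omega

/-- No edge meets three crossed triples in vertices other than their centres. -/
lemma not_rel (h : IsMaxFamily R L f) (hR : IsTripleRel R) {i j k o : ι}
    {ci cj ck di dj dk a b c : Fin 3}
    (hi : IsCross (block (richGraph R L f) i o) ci di)
    (hj : IsCross (block (richGraph R L f) j o) cj dj)
    (hk : IsCross (block (richGraph R L f) k o) ck dk)
    (hio : Crossed (richGraph R L f) i o) (hjo : Crossed (richGraph R L f) j o)
    (hko : Crossed (richGraph R L f) k o) (hij : Crossed (richGraph R L f) i j)
    (hjk : Crossed (richGraph R L f) j k) (hki : Crossed (richGraph R L f) k i)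
    (ha : a ≠ ci) (hb : b ≠ cj) (hc : c ≠ ck) : ¬ R (f i a) (f j b) (f k c) := by
  intro hr
  have hT := h.tame hR
  obtain ⟨nij, rij, sij, xij⟩ := hij
  obtain ⟨njk, rjk, sjk, xjk⟩ := hjk
  obtain ⟨nki, rki, ski, xki⟩ := hki
  obtain rfl := hT.center_eq nij hio.1 hjo.1 xij hi hjo
  obtain rfl := hT.center_eq njk hjo.1 hko.1 xjk hj hko
  obtain rfl := hT.center_eq nki hko.1 hio.1 xki hk hio
  obtain ⟨a', ha', ha''⟩ := exists_third rij a
  obtain ⟨b', hb', hb''⟩ := exists_third rjk b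
  obtain ⟨c', hc', hc''⟩ := exists_third rki c
  have hL : ({f i a, f j b, f k c} : Finset V) ∩ L = ∅ := by
    ext v
    simp only [mem_inter, mem_insert, mem_singleton, notMem_empty, iff_false, not_and]
    rintro (rfl | rfl | rfl) <;> exact h.notMem _ _
  have heq : ∀ i a j b, f i a = f j b ↔ i = j ∧ a = b := fun i a j b =>
    ⟨h.inj i a j b, by rintro ⟨rfl, rfl⟩; rfl⟩
  have h1 : Rich R L (f i rij) (f j b') := xij rij b' (Or.inl rfl)
  have h2 : Rich R L (f j rjk) (f k c') := xjk rjk c' (Or.inl rfl)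
  have h3 : Rich R L (f k rki) (f i a') := xki rki a' (Or.inl rfl)
  have := h.card_add_le hR {i, j, k} (Matchable.single hr) (by simp)
    [((i, rij), (j, b')), ((j, rjk), (k, c')), ((k, rki), (i, a'))]
    (by simp [*, nij.symm, njk.symm, nki.symm, ha.symm, hb.symm, hc.symm])
    (by simp [*, nij.symm, nki.symm, ha'.symm])
    (by simp [hL])
  rw [card_eq_three.2 ⟨_, _, _, hR.ne hr, (hR.ne' hr).2, (hR.ne' hr).1, rfl⟩] at this
  have h4 := card_le_three (a := i) (b := j) (c := k)
  simp only [List.length_cons, List.length_nil] at this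
  omega

end IsMaxFamily
end

section
open scoped Classical

variable {V : Type*} {R : V → V → V → Prop}

namespace IsMaxFamily

variable {ι : Type*} [Fintype ι] {L : Finset V} {f : ι → Fin 3 → V}

lemma injective_uncurry [DecidableEq V] (h : IsMaxFamily R L f) :
    Function.Injective fun p : ι × Fin 3 => f p.1 p.2 :=
  fun _ _ hpq => Prod.ext (h.inj _ _ _ _ hpq).1 (h.inj _ _ _ _ hpq).2

lemma sum_rich_le : ∑ p, ∑ q, (if richGraph R L f p q then 1 else 0) ≤
    ∑ i, ∑ j, weight (richGraph R L f) i j + 9 * Fintype.card ι := by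
  have h1 : ∀ i j, entries (block (richGraph R L f) i j) ≤
      weight (richGraph R L f) i j + if i = j then 9 else 0 := by
    intro i j
    unfold weight
    split_ifs with hij
    · have : ∀ a, ∑ b, (if block (richGraph R L f) i j a b then 1 else 0) ≤ 3 := fun a =>
        (sum_le_card_nsmul univ _ 1 fun b _ => by split_ifs <;> simp).trans_eq (by simp)
      exact (sum_le_card_nsmul univ _ 3 fun a _ => this a).trans_eq (by simp)
    · exact le_rfl
  calc ∑ p, ∑ q, (if richGraph R L f p q then 1 else 0)
      = ∑ i, ∑ j, entries (block (richGraph R L f) i j) := by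
        simp only [Fintype.sum_prod_type, entries, block]
        exact sum_congr rfl fun i _ => sum_comm
    _ ≤ ∑ i, ∑ j, (weight (richGraph R L f) i j + if i = j then 9 else 0) :=
        sum_le_sum fun i _ => sum_le_sum fun j _ => h1 i j
    _ = _ := by simp [sum_add_distrib, mul_comm]

variable [DecidableEq V]

lemma sum_pairDeg_square_le (h : IsMaxFamily R L f) :
    ∑ v ∈ L, pairDeg R v ((univ.image fun p : ι × Fin 3 => f p.1 p.2) ×ˢ
      (univ.image fun p : ι × Fin 3 => f p.1 p.2)) ≤ 45 * Fintype.card ι ^ 2 +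
        L.card * (∑ i, ∑ j, weight (richGraph R L f) i j + 9 * Fintype.card ι) := by
  simp only [pairDeg_product, sum_image fun _ _ _ _ h' => h.injective_uncurry h']
  rw [sum_comm]
  simp only [sum_comm (s := L)]
  have : ∀ p q : ι × Fin 3, ∑ v ∈ L, (if R v (f p.1 p.2) (f q.1 q.2) then 1 else 0) ≤
      5 + L.card * if richGraph R L f p q then 1 else 0 := by
    intro p q
    rw [← card_filter]
    split_ifs with hr
    · have := card_filter_le L fun v => R v (f p.1 p.2) (f q.1 q.2)
      omega
    · unfold richGraph Rich at hr
      omega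
  refine (sum_le_sum fun p _ => sum_le_sum fun q _ => this p q).trans ?_
  have h2 := sum_rich_le (R := R) (L := L) (f := f)
  simp only [sum_add_distrib, ← mul_sum, sum_const, card_univ, Fintype.card_prod,
    Fintype.card_fin, smul_eq_mul]
  have := Nat.mul_le_mul_left L.card h2
  nlinarith

variable [Fintype V]

lemma card_eq (h : IsMaxFamily R L f) {D : Finset V} (hDL : Disjoint D L)
    (hDf : ∀ i a, f i a ∉ D) (hcov : ∀ v, v ∈ D ∨ v ∈ L ∨ ∃ i a, f i a = v) :
    L.card + 3 * Fintype.card ι + D.card = Fintype.card V := by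
  have h1 : (univ.image fun p : ι × Fin 3 => f p.1 p.2).card = 3 * Fintype.card ι := by
    rw [card_image_of_injective _ h.injective_uncurry]
    simp [mul_comm]
  have h2 : Disjoint L (univ.image fun p : ι × Fin 3 => f p.1 p.2) := by
    rw [disjoint_left]
    rintro v hv hv'
    obtain ⟨p, -, rfl⟩ := mem_image.1 hv'
    exact h.notMem _ _ hv
  have h3 : Disjoint (L ∪ univ.image fun p : ι × Fin 3 => f p.1 p.2) D := by
    rw [disjoint_union_left]
    refine ⟨hDL.symm, disjoint_left.2 ?_⟩
    rintro v hv hv'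
    obtain ⟨p, -, rfl⟩ := mem_image.1 hv
    exact hDf _ _ hv'
  rw [← h1, ← card_union_of_disjoint h2, ← card_union_of_disjoint h3, ← card_univ]
  congr 1
  ext v
  simp only [mem_union, mem_image, mem_univ, true_and, Prod.exists, iff_true]
  rcases hcov v with h | h | h <;> simp [h]

lemma degree_sum_le (h : IsMaxFamily R L f) (hR : IsTripleRel R) {k : ℕ}
    (hV : Fintype.card V = 3 * k) (hdeg : ∀ v, 5 * k ^ 2 + 4 ≤ pairDeg R v univ + 7 * k)
    {D : Finset V} (hcov : ∀ v, v ∈ D ∨ v ∈ L ∨ ∃ i a, f i a = v) :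
    5 * k ^ 2 * L.card ≤ 7 * k * L.card + 6 * D.card * k * L.card +
      2 * Fintype.card ι * L.card ^ 2 + 25 * Fintype.card ι * L.card +
      45 * Fintype.card ι ^ 2 + L.card * ∑ i, ∑ j, weight (richGraph R L f) i j := by
  set S : Finset V := univ.image fun p : ι × Fin 3 => f p.1 p.2 with hS
  have hpt : ∀ v ∈ L, pairDeg R v univ ≤
      6 * D.card * k + 2 * pairDeg R v (S ×ˢ L) + pairDeg R v (S ×ˢ S) := by
    intro v hv
    have hsub : (univ : Finset (V × V)) ⊆
        (D ×ˢ univ ∪ univ ×ˢ D) ∪ (L ×ˢ L ∪ (S ×ˢ L ∪ (L ×ˢ S ∪ S ×ˢ S))) := by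
      rintro ⟨x, y⟩ -
      have hx := hcov x
      have hy := hcov y
      have hSx : ∀ z, z ∈ S ↔ ∃ i a, f i a = z := fun z => by simp [hS]
      rw [← hSx] at hx hy
      simp only [mem_union, mem_product, mem_univ, and_true, true_and]
      tauto
    have h0 := h.pairDeg_self hR hv
    have h1 := pairDeg_le_card (R := R) v (D ×ˢ (univ : Finset V))
    have h2 := pairDeg_le_card (R := R) v ((univ : Finset V) ×ˢ D)
    rw [card_product, card_univ, hV] at h1 h2
    have h3 := (pairDeg_mono (R := R) v hsub).trans (pairDeg_union_le v _ _)
    have h4 := pairDeg_union_le (R := R) v (D ×ˢ univ) (univ ×ˢ D)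
    have h5 := pairDeg_union_le (R := R) v (L ×ˢ L) (S ×ˢ L ∪ (L ×ˢ S ∪ S ×ˢ S))
    have h6 := pairDeg_union_le (R := R) v (S ×ˢ L) (L ×ˢ S ∪ S ×ˢ S)
    have h7 := pairDeg_union_le (R := R) v (L ×ˢ S) (S ×ˢ S)
    rw [pairDeg_swap hR v L S] at h7
    nlinarith
  have hSL : ∑ v ∈ L, pairDeg R v (S ×ˢ L) ≤ Fintype.card ι * (L.card ^ 2 + 8 * L.card) := by
    rw [sum_pairDeg_product_comm hR, hS, sum_image fun _ _ _ _ h' => h.injective_uncurry h',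
      Fintype.sum_prod_type]
    exact (sum_le_card_nsmul univ _ _ fun i _ => h.sum_pairDeg_le hR i).trans_eq (by simp)
  have hSS := h.sum_pairDeg_square_le
  have htot : L.card * (5 * k ^ 2 + 4) ≤ ∑ v ∈ L, (pairDeg R v univ + 7 * k) :=
    card_nsmul_le_sum _ _ _ fun v _ => hdeg v
  have hle := sum_le_sum hpt
  simp only [sum_add_distrib, ← mul_sum, sum_const, smul_eq_mul] at htot hle
  nlinarith

end IsMaxFamily

lemma near_extremal_arith {k m l g u r T X : ℕ}
    (h1 : 5 * k ^ 2 * l ≤ 7 * k * l + 6 * g * k * l + 2 * m * l ^ 2 + 25 * m * l +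
      45 * m ^ 2 + l * T)
    (h2 : T + 2 * r ^ 2 ≤ 5 * m ^ 2) (h3 : T + 2 * r ^ 2 + X ≤ 5 * m ^ 2 + 4 * r * m)
    (h4 : l + 3 * m + g = 3 * k) (hg : g ≤ 708588 * u) (hl : 3 * u < l) (huk : 10 ^ 27 * u ≤ k)
    (hu : 10 ^ 24 ≤ u) : 10 ^ 20 * k ≤ 10 ^ 20 * m + k ∧ 4 * 10 ^ 9 * X ≤ k ^ 2 := by
  zify at *
  set h : ℤ := k - m with hh
  have hm : (m : ℤ) = k - h := by omega
  have hh0 : 0 ≤ h := by omega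
  have hlh : (l : ℤ) ≤ 3 * h := by omega
  have hl0 : (0 : ℤ) < l := by omega
  have hmk : (m : ℤ) ≤ k := by omega
  have hm0 : (0 : ℤ) ≤ m := by omega
  have hk : (10 : ℤ) ^ 51 ≤ k := by linarith
  have e1 : 10 ^ 24 * (45 * (m : ℤ) ^ 2) ≤ 15 * k ^ 2 * l := by
    have a1 : (m : ℤ) ^ 2 ≤ k ^ 2 := by gcongr
    have a2 : (m : ℤ) ^ 2 * (3 * 10 ^ 24) ≤ k ^ 2 * l := by
      apply mul_le_mul a1 (by linarith) (by positivity) (by positivity)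
    linarith
  have e2 : 10 ^ 24 * (5 * (k : ℤ) ^ 2 - 7 * k - 6 * g * k - 2 * m * l - 25 * m - T) ≤ 15 * k ^ 2 := by
    refine le_of_mul_le_mul_right ?_ hl0
    linarith
  have e3 : 10 ^ 24 * (6 * g * k : ℤ) ≤ 4252 * k ^ 2 := by
    have : 10 ^ 24 * (6 * g : ℤ) ≤ 4252 * k := by linarith
    have := mul_le_mul_of_nonneg_right this (hm0.trans hmk)
    linarith
  have e4 : 10 ^ 24 * (32 * k : ℤ) ≤ k ^ 2 := by
    rw [sq, ← mul_assoc]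
    exact mul_le_mul_of_nonneg_right (by linarith) (hm0.trans hmk)
  have e5 : (2 * m * l : ℤ) ≤ 6 * m * h := by
    linarith [mul_le_mul_of_nonneg_left hlh hm0]
  have e6 : 10 ^ 24 * (5 * (k : ℤ) ^ 2 - 6 * m * h - T) ≤ 4268 * k ^ 2 := by linarith
  have e7 : 5 * (k : ℤ) ^ 2 - 6 * m * h = 5 * m ^ 2 + 4 * k * h + h ^ 2 := by rw [hm]; ring
  rw [e7] at e6
  have e8 : 10 ^ 24 * (4 * k * h : ℤ) ≤ 4268 * k ^ 2 := by linarith [sq_nonneg h, sq_nonneg (r : ℤ)]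
  have e9 : 10 ^ 24 * (4 * h : ℤ) ≤ 4268 * k := by
    have hk0 : (0 : ℤ) < k := by linarith
    refine le_of_mul_le_mul_right ?_ hk0
    linarith
  have e10 : 2 * 10 ^ 10 * (r : ℤ) ≤ k := by
    have hkh : 0 ≤ (k : ℤ) * h := by positivity
    have hr : 10 ^ 24 * (2 * (r : ℤ) ^ 2) ≤ 4268 * k ^ 2 := by linarith [sq_nonneg h]
    refine abs_le_of_sq_le_sq' ?_ (by positivity) |>.2
    linarith
  refine ⟨by linarith, ?_⟩
  have e11 : 10 ^ 24 * (X : ℤ) ≤ 4268 * k ^ 2 + 10 ^ 24 * (4 * r * m) := by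
    have hkh : 0 ≤ (k : ℤ) * h := by positivity
    linarith [sq_nonneg h, sq_nonneg (r : ℤ)]
  have e12 : 2 * 10 ^ 10 * ((r : ℤ) * m) ≤ k * k := by
    rw [← mul_assoc]
    exact mul_le_mul e10 hmk hm0 (by linarith)
  linarith

end

section
open scoped Classical

variable {V : Type*} [DecidableEq V] {R : V → V → V → Prop}

lemma sum_pairDeg_union_le {B₀ B₁ : Finset V} {n : ℕ} (h : (B₀ ∪ B₁).card ≤ n) :
    ∑ b ∈ B₀ ∪ B₁, pairDeg R b ((B₀ ∪ B₁) ×ˢ (B₀ ∪ B₁)) ≤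
      ∑ b ∈ B₀, pairDeg R b (B₀ ×ˢ B₀) + 3 * B₁.card * n ^ 2 := by
  set B := B₀ ∪ B₁
  have hB₀ : B₀.card ≤ n := (card_le_card subset_union_left).trans h
  have h1 : ∀ b ∈ B₀, pairDeg R b (B ×ˢ B) ≤ pairDeg R b (B₀ ×ˢ B₀) + 2 * B₁.card * n := by
    intro b _
    have hsub : B ×ˢ B ⊆ B₀ ×ˢ B₀ ∪ (B₁ ×ˢ B ∪ B ×ˢ B₁) := by
      rintro ⟨x, y⟩
      simp only [B, mem_union, mem_product]
      tauto
    have h2 := (pairDeg_mono (R := R) b hsub).trans (pairDeg_union_le b _ _)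
    have h3 := pairDeg_union_le (R := R) b (B₁ ×ˢ B) (B ×ˢ B₁)
    have h4 := pairDeg_le_card (R := R) b (B₁ ×ˢ B)
    have h5 := pairDeg_le_card (R := R) b (B ×ˢ B₁)
    rw [card_product] at h4 h5
    nlinarith
  have h2 : ∀ b ∈ B₁, pairDeg R b (B ×ˢ B) ≤ n ^ 2 := fun b _ =>
    (pairDeg_le_card _ _).trans (by rw [card_product, sq]; gcongr)
  have h3 : ∑ b ∈ B, pairDeg R b (B ×ˢ B) ≤
      ∑ b ∈ B₀, pairDeg R b (B ×ˢ B) + ∑ b ∈ B₁, pairDeg R b (B ×ˢ B) := by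
    rw [← sum_union_inter]
    exact Nat.le_add_right _ _
  have h4 := sum_le_sum h1
  have h5 := sum_le_card_nsmul _ _ _ h2
  rw [sum_add_distrib, sum_const, smul_eq_mul] at h4
  rw [smul_eq_mul] at h5
  nlinarith [Nat.mul_le_mul_right (2 * B₁.card * n) hB₀]

namespace IsMaxFamily

variable {ι : Type*} [Fintype ι] {L : Finset V} {f : ι → Fin 3 → V}

/-- The vertices of the triples that are not centres span few edges. -/
lemma exists_sparse (h : IsMaxFamily R L f) (hR : IsTripleRel R) (hm : 0 < Fintype.card ι) :
    ∃ B ⊆ univ.image fun p : ι × Fin 3 => f p.1 p.2, B.card = 2 * Fintype.card ι ∧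
      ∑ b ∈ B, pairDeg R b (B ×ˢ B) ≤ 162 * Fintype.card ι *
        ∑ i, ∑ j, (if ¬ Crossed (richGraph R L f) i j then 1 else 0) := by
  set m := Fintype.card ι with hm'
  set G := richGraph R L f with hG
  set δ : ι → ι → ℕ := fun i j => if ¬ Crossed G i j then 1 else 0 with hδ
  obtain ⟨o, -, ho⟩ : ∃ o ∈ (univ : Finset ι), m * ∑ i, δ i o ≤ ∑ i, ∑ j, δ i j := by
    have : Nonempty ι := Fintype.card_pos_iff.1 hm
    refine exists_le_of_sum_le univ_nonempty ?_
    rw [sum_const, card_univ, smul_eq_mul, ← mul_sum, sum_comm]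
  have hcen : ∀ i, ∃ c, Crossed G i o → ∃ d, IsCross (block G i o) c d := by
    intro i
    by_cases hi : Crossed G i o
    · obtain ⟨-, c, d, hcd⟩ := hi
      exact ⟨c, fun _ => ⟨d, hcd⟩⟩
    · exact ⟨0, fun h => absurd h hi⟩
  choose c hc using hcen
  let P : Finset (ι × Fin 3) := univ.filter fun p => p.2 ≠ c p.1
  have hP : P.card = 2 * m := by
    have : ∀ i, (univ.filter fun a => a ≠ c i).card = 2 := fun i => by
      rw [filter_ne', card_erase_of_mem (mem_univ _)]; simp
    rw [card_filter, Fintype.sum_prod_type]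
    simp only [← card_filter, this]
    simp [hm', mul_comm]
  refine ⟨P.image fun p => f p.1 p.2, image_subset_image (subset_univ _), ?_, ?_⟩
  · rw [card_image_of_injective _ h.injective_uncurry, hP]
  have hS : ∀ φ : V → ℕ, ∑ v ∈ P.image (fun p => f p.1 p.2), φ v = ∑ p ∈ P, φ (f p.1 p.2) :=
    fun φ => sum_image fun _ _ _ _ h' => h.injective_uncurry h'
  have hU : ∀ φ : ι × Fin 3 → ℕ, ∑ p ∈ P, φ p ≤ ∑ p, φ p := fun φ =>
    sum_le_sum_of_subset (subset_univ _)
  have h3 : ∀ φ : ι → ℕ, ∑ p : ι × Fin 3, φ p.1 = 3 * ∑ i, φ i := fun φ => by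
    simp [Fintype.sum_prod_type, mul_sum]
  have hpt : ∀ p ∈ P, ∀ q ∈ P, ∀ w ∈ P,
      (if R (f p.1 p.2) (f q.1 q.2) (f w.1 w.2) then 1 else 0) ≤
        δ p.1 o + δ q.1 o + δ w.1 o + δ p.1 q.1 + δ q.1 w.1 + δ w.1 p.1 := by
    intro p hp q hq w hw
    simp only [P, mem_filter, mem_univ, true_and] at hp hq hw
    by_contra! hlt
    have hr : R (f p.1 p.2) (f q.1 q.2) (f w.1 w.2) := by
      by_contra hr
      rw [if_neg hr] at hlt
      omega
    rw [if_pos hr] at hlt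
    have hx : ∀ i j, δ i j = 0 → Crossed G i j := fun i j h0 => by
      by_contra hn
      simp [hδ, hn] at h0
    have k1 := hx p.1 o (by omega)
    have k2 := hx q.1 o (by omega)
    have k3 := hx w.1 o (by omega)
    obtain ⟨d₁, hd₁⟩ := hc _ k1
    obtain ⟨d₂, hd₂⟩ := hc _ k2
    obtain ⟨d₃, hd₃⟩ := hc _ k3
    exact h.not_rel hR hd₁ hd₂ hd₃ k1 k2 k3 (hx _ _ (by omega)) (hx _ _ (by omega))
      (hx _ _ (by omega)) hp hq hw hr
  have hsum : ∑ b ∈ P.image (fun p => f p.1 p.2), pairDeg R b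
      (P.image (fun p => f p.1 p.2) ×ˢ P.image (fun p => f p.1 p.2)) ≤
      ∑ p : ι × Fin 3, ∑ q : ι × Fin 3, ∑ w : ι × Fin 3,
        (δ p.1 o + δ q.1 o + δ w.1 o + δ p.1 q.1 + δ q.1 w.1 + δ w.1 p.1) := by
    simp only [pairDeg_product, hS]
    refine (sum_le_sum fun p hp => sum_le_sum fun q hq => sum_le_sum fun w hw =>
      hpt p hp q hq w hw).trans ?_
    refine (sum_le_sum fun p _ => (sum_le_sum fun q _ => hU _).trans (hU _)).trans (hU _)
  have hw : ∀ i j, ∑ w : ι × Fin 3, (δ i o + δ j o + δ w.1 o + δ i j + δ j w.1 + δ w.1 i) =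
      3 * ∑ k, (δ i o + δ j o + δ k o + δ i j + δ j k + δ k i) := fun i j =>
    h3 fun k => δ i o + δ j o + δ k o + δ i j + δ j k + δ k i
  have hq : ∀ i, ∑ q : ι × Fin 3,
      3 * ∑ k, (δ i o + δ q.1 o + δ k o + δ i q.1 + δ q.1 k + δ k i) =
      3 * ∑ j, 3 * ∑ k, (δ i o + δ j o + δ k o + δ i j + δ j k + δ k i) := fun i =>
    h3 fun j => 3 * ∑ k, (δ i o + δ j o + δ k o + δ i j + δ j k + δ k i)
  simp only [hw, hq] at hsum
  rw [h3 fun i => 3 * ∑ j, 3 * ∑ k, (δ i o + δ j o + δ k o + δ i j + δ j k + δ k i)] at hsum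
  refine hsum.trans ?_
  have hcomm : ∑ i, ∑ j, δ j i = ∑ i, ∑ j, δ i j := sum_comm
  simp only [sum_add_distrib, ← mul_sum, sum_const, card_univ, smul_eq_mul, hcomm]
  rw [← hm']
  change _ ≤ 162 * m * ∑ i, ∑ j, δ i j
  have := Nat.mul_le_mul_left m ho
  linarith

end IsMaxFamily

/-- Either the graph has a perfect matching or a largest matching avoiding `D` leaves few
vertices uncovered. -/
theorem matchable_univ_of_isMaxFamily [Fintype V] (hR : IsTripleRel R) {k u : ℕ}
    (hV : Fintype.card V = 3 * k) (hdeg : ∀ v, 5 * k ^ 2 + 4 ≤ pairDeg R v univ + 7 * k)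
    (huk : 10 ^ 27 * u ≤ k) (hu : 10 ^ 24 ≤ u) {ι : Type*} [Fintype ι] {L D : Finset V}
    {f : ι → Fin 3 → V} (h : IsMaxFamily R L f) (hDL : Disjoint D L) (hDf : ∀ i a, f i a ∉ D)
    (hcov : ∀ v, v ∈ D ∨ v ∈ L ∨ ∃ i a, f i a = v) (hD : D.card ≤ 708588 * u)
    (hL : 3 * u < L.card) : Matchable R univ := by
  have hcard := h.card_eq hDL hDf hcov
  rw [hV] at hcard
  have hsum := h.degree_sum_le hR hV hdeg hcov
  obtain ⟨r, -, h2, h3⟩ := (h.tame hR).exists_weight_le (richGraph_symm hR)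
  obtain ⟨hkm, hX⟩ := near_extremal_arith hsum h2 h3 hcard hD hL huk hu
  set m := Fintype.card ι with hm
  have hmk : m ≤ k := by omega
  obtain ⟨B₀, hB₀, hB₀c, hB₀s⟩ := h.exists_sparse hR (by omega)
  have hSc : (univ.image fun p : ι × Fin 3 => f p.1 p.2).card = 3 * m := by
    rw [card_image_of_injective _ h.injective_uncurry]
    simp [mul_comm, hm]
  obtain ⟨B₁, hB₁, hB₁c⟩ : ∃ B₁ ⊆ (univ.image fun p : ι × Fin 3 => f p.1 p.2)ᶜ,
      B₁.card = 2 * (k - m) := by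
    refine exists_subset_card_eq ?_
    rw [card_compl, hSc, hV]
    omega
  have hdis : Disjoint B₀ B₁ := (disjoint_compl_right).mono hB₀ hB₁
  have hBc : (B₀ ∪ B₁).card = 2 * k := by
    rw [card_union_of_disjoint hdis]
    omega
  refine matchable_univ_of_sparse hR (by omega) hV hdeg hBc ?_
  have hle := sum_pairDeg_union_le (R := R) hBc.le
  refine (Nat.mul_le_mul_left _ (hle.trans (Nat.add_le_add_right hB₀s _))).trans ?_
  rw [hB₁c]
  have e1 : 10 ^ 20 * (k - m) ≤ k := by omega
  have e2 := Nat.mul_le_mul hmk hX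
  have e3 := Nat.mul_le_mul_right (k ^ 2) e1
  nlinarith

end

section
open scoped Classical

variable {V : Type*} [DecidableEq V] {R : V → V → V → Prop}

lemma Matchable.three_dvd_card (hR : IsTripleRel R) {S : Finset V} (hS : Matchable R S) :
    3 ∣ S.card := by
  induction hS with
  | empty => simp
  | step _ hr hx hy hz ih => rw [Matchable.card_step hR hr hx hy hz]; omega

lemma exists_isMaxFamily [Fintype V] (hR : IsTripleRel R) (D : Finset V) :
    ∃ (ι : Type) (_ : Fintype ι) (L : Finset V) (f : ι → Fin 3 → V), IsMaxFamily R L f ∧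
      Disjoint D L ∧ (∀ i a, f i a ∉ D) ∧ ∀ v, v ∈ D ∨ v ∈ L ∨ ∃ i a, f i a = v := by
  obtain ⟨S, hS, hmax⟩ := exists_max_image
    (univ.filter fun S : Finset V => Matchable R S ∧ Disjoint S D) card
    ⟨∅, by simp [Matchable.empty]⟩
  simp only [mem_filter, mem_univ, true_and] at hS hmax
  obtain ⟨ι, _, -, f, hrel, hinj, hmem⟩ := Matchable.exists_family hR hS.1
  have hfam : IsMaxFamily R (D ∪ S)ᶜ f :=
    { rel := hrel
      inj := hinj
      notMem := fun i a h => by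
        simp only [mem_compl, mem_union, not_or] at h
        exact h.2 ((hmem _).2 ⟨i, a, rfl⟩)
      max := fun N hN hsub => by
        have hND : Disjoint N D := disjoint_left.2 fun v hv hvD => by
          rcases hsub v hv with h | h
          · simp only [mem_compl, mem_union, not_or] at h
            exact h.1 hvD
          · exact disjoint_left.1 hS.2 ((hmem v).2 h) hvD
        refine (hmax N ⟨hN, hND⟩).trans ?_
        have : S = univ.image fun p : ι × Fin 3 => f p.1 p.2 := by
          ext v; simp [hmem]
        rw [this]
        refine card_image_le.trans_eq ?_
        simp [mul_comm] }
  refine ⟨ι, inferInstance, _, f, hfam, ?_, ?_, ?_⟩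
  · exact disjoint_compl_right.mono_left subset_union_left
  · exact fun i a h => disjoint_left.1 hS.2 ((hmem _).2 ⟨i, a, rfl⟩) h
  · intro v
    rw [← hmem]
    simp only [mem_compl, mem_union, not_or]
    tauto

lemma cube_le_two_pow {k u : ℕ} (hku : k < 10 ^ 27 * (u + 1)) (hu : 10 ^ 86 ≤ u) :
    27 * k ^ 3 ≤ 2 ^ u := by
  set w := u / 4 with hw
  have h1 : w + 1 ≤ 2 ^ w := Nat.lt_two_pow_self
  have h2 : 2 ^ (4 * w) ≤ 2 ^ u := Nat.pow_le_pow_right (by norm_num) (by omega)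
  have h3 : k ≤ 4 * 10 ^ 27 * (w + 1) := by omega
  calc 27 * k ^ 3 ≤ 27 * (4 * 10 ^ 27 * (w + 1)) ^ 3 := by gcongr
    _ = (1728 * 10 ^ 81) * (w + 1) ^ 3 := by ring
    _ ≤ (w + 1) * (w + 1) ^ 3 := Nat.mul_le_mul_right _ (by omega)
    _ = (w + 1) ^ 4 := by ring
    _ ≤ (2 ^ w) ^ 4 := by gcongr
    _ = 2 ^ (4 * w) := by rw [← pow_mul, mul_comm]
    _ ≤ 2 ^ u := h2

/-- A large 3-graph of the required minimum degree has a perfect matching. -/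
theorem matchable_univ [Fintype V] (hR : IsTripleRel R) {k : ℕ} (hk : 10 ^ 120 ≤ k)
    (hV : Fintype.card V = 3 * k) (hdeg : ∀ v, 5 * k ^ 2 + 4 ≤ pairDeg R v univ + 7 * k) :
    Matchable R univ := by
  set u := k / 10 ^ 27 with hu
  have huk : 10 ^ 27 * u ≤ k := by omega
  have hu86 : 10 ^ 86 ≤ u := by omega
  have hk2 : 28 * k ≤ k ^ 2 := by rw [sq]; exact Nat.mul_le_mul_right k (by omega)
  have hcommon : ∀ x y : V, k ^ 2 ≤
      2 * (univ.filter fun p : V × V => R x p.1 p.2 ∧ R y p.1 p.2).card := by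
    intro x y
    have hx := hdeg x
    have hy := hdeg y
    have h1 := card_union_add_card_inter (univ.filter fun p : V × V => R x p.1 p.2)
      (univ.filter fun p : V × V => R y p.1 p.2)
    rw [← filter_and] at h1
    have h2 := card_le_univ ((univ.filter fun p : V × V => R x p.1 p.2) ∪
      (univ.filter fun p : V × V => R y p.1 p.2))
    rw [Fintype.card_prod, hV] at h2
    unfold pairDeg at hx hy
    nlinarith
  have hedges : 12 * k ^ 3 ≤ ∑ v : V, pairDeg R v univ := by
    have h1 : Fintype.card V * (5 * k ^ 2 + 4) ≤ ∑ v : V, (pairDeg R v univ + 7 * k) :=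
      card_nsmul_le_sum univ _ _ fun v _ => hdeg v
    rw [sum_add_distrib, sum_const, card_univ, hV, smul_eq_mul] at h1
    have h2 := Nat.mul_le_mul_right k hk2
    nlinarith
  obtain ⟨F, hFc, hF, hFd, hFa⟩ := exists_absorbers (by omega) hV hcommon hedges
    (u := u) (by omega) (cube_le_two_pow (by omega) hu86)
  have hD := card_gadgetVerts_le F
  obtain ⟨ι, _, L, f, h, hDL, hDf, hcov⟩ := exists_isMaxFamily hR (gadgetVerts F)
  by_cases hL : 3 * u < L.card
  · exact matchable_univ_of_isMaxFamily hR hV hdeg huk (by omega) h hDL hDf hcov (by omega) hL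
  have hdvd : 3 ∣ (gadgetVerts F).card := by
    have := matchable_absorb (w := 0) (W := ∅) hF hFd (fun _ => Nat.zero_le _) (by simp) (by simp)
    rw [empty_union] at this
    exact this.three_dvd_card hR
  have hcard := h.card_eq hDL hDf hcov
  rw [hV] at hcard
  obtain ⟨w, hw⟩ : 3 ∣ L.card := by omega
  have h1 := matchable_absorb hF hFd (fun T => (show w ≤ u by omega).trans (hFa T)) hDL.symm hw
  have h2 := h.matchable_range univ
  have h3 : Disjoint (L ∪ gadgetVerts F) (univ.biUnion fun i => univ.image (f i)) := by
    rw [disjoint_left]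
    intro v hv hv'
    simp only [mem_biUnion, mem_image, mem_univ, true_and] at hv'
    obtain ⟨i, a, rfl⟩ := hv'
    rcases mem_union.1 hv with hv | hv
    exacts [h.notMem _ _ hv, hDf _ _ hv]
  convert h1.union h2 h3
  ext v
  simp only [mem_union, mem_biUnion, mem_image, mem_univ, true_and, true_iff]
  have := hcov v
  tauto

end

section

variable {V : Type*} [DecidableEq V] {H : Finset (Finset V)}

lemma isTripleRel_of_card (hH : ∀ e ∈ H, e.card = 3) :
    IsTripleRel fun x y z => ({x, y, z} : Finset V) ∈ H where
  swap {x y z} h := by rwa [insert_comm] at h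
  rot {x y z} h := by
    have : ({y, z, x} : Finset V) = {x, y, z} := by ext; simp; tauto
    rwa [this]
  ne {x y z} h := by
    rintro rfl
    have h1 := hH _ h
    have h2 := card_le_two (a := x) (b := z)
    simp only [mem_insert, mem_singleton, true_or, insert_eq_of_mem] at h1
    omega

lemma two_mul_degree_le [Fintype V] (hH : ∀ e ∈ H, e.card = 3) (v : V) :
    2 * (H.filter fun e => v ∈ e).card ≤
      pairDeg (fun x y z => ({x, y, z} : Finset V) ∈ H) v univ := by
  classical
  unfold pairDeg
  rw [card_eq_sum_card_fiberwise (f := fun p : V × V => ({v, p.1, p.2} : Finset V))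
    (t := H.filter fun e => v ∈ e) (fun p hp => by simpa using hp), mul_comm, ← smul_eq_mul]
  refine card_nsmul_le_sum _ _ _ fun e he => ?_
  rw [mem_filter] at he
  obtain ⟨heH, hv⟩ := he
  obtain ⟨y, z, hyz, hE⟩ := card_eq_two.1 (show (e.erase v).card = 2 by
    rw [card_erase_of_mem hv, hH e heH])
  have he1 : e = {v, y, z} := by rw [← insert_erase hv, hE]
  have he2 : e = {v, z, y} := by rw [he1, pair_comm]
  rw [← card_pair (show (y, z) ≠ (z, y) by simp [hyz])]
  refine card_le_card ?_
  simp only [insert_subset_iff, singleton_subset_iff, mem_filter, mem_univ, true_and]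
  exact ⟨⟨he1 ▸ heH, he1.symm⟩, ⟨he2 ▸ heH, he2.symm⟩⟩

lemma two_mul_min_degree {k : ℕ} (hk : 0 < k) :
    5 * k ^ 2 + 4 ≤ 2 * ((3 * k - 1).choose 2 - (2 * (3 * k) / 3).choose 2 + 1) + 7 * k := by
  obtain ⟨j, rfl⟩ : ∃ j, k = j + 1 := ⟨k - 1, by omega⟩
  have h : ∀ n, 2 * (n + 1).choose 2 = (n + 1) * n := fun n => by
    rw [Nat.choose_two_right, Nat.two_mul_div_two_of_even (Nat.even_mul_pred_self _)]
    simp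
  have e1 : 3 * (j + 1) - 1 = 3 * j + 1 + 1 := by omega
  have e2 : 2 * (3 * (j + 1)) / 3 = 2 * j + 1 + 1 := by omega
  have h1 := h (3 * j + 1)
  have h2 := h (2 * j + 1)
  rw [e1, e2]
  zify at *
  have : ((3 * j + 1 + 1).choose 2 : ℤ) - ((2 * j + 1 + 1).choose 2 : ℤ) ≤
      (((3 * j + 1 + 1).choose 2 - (2 * j + 1 + 1).choose 2 : ℕ) : ℤ) := by omega
  nlinarith

end

/-- There exists an integer `n₀` such that for every `n ≥ n₀` divisible by 3, every
3-graph `H` on `n` vertices with `δ₁(H) ≥ C(n−1,2) − C(2n/3,2) + 1` contains a perfect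
matching. -/
theorem stmt0 :
    ∃ n₀ : ℕ, ∀ n : ℕ, n₀ ≤ n → 3 ∣ n →
    ∀ (V : Type) [Fintype V] [DecidableEq V], Fintype.card V = n →
    ∀ H : Finset (Finset V), (∀ e ∈ H, e.card = 3) →
    (∀ v : V, (n - 1).choose 2 - (2 * n / 3).choose 2 + 1 ≤ (H.filter fun e => v ∈ e).card) →
    ∃ M : Finset (Finset V), M ⊆ H ∧
      (M : Set (Finset V)).Pairwise (fun e f => Disjoint e f) ∧
      ∀ v : V, ∃ e ∈ M, v ∈ e := by
  refine ⟨3 * 10 ^ 120, ?_⟩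
  rintro n hn ⟨k, rfl⟩ V _ _ hV H hH hdeg
  have hk : 10 ^ 120 ≤ k := by omega
  have hM := matchable_univ (isTripleRel_of_card hH) hk hV fun v => by
    have h1 := two_mul_degree_le hH v
    have h2 := hdeg v
    have h3 := two_mul_min_degree (k := k) (by omega)
    omega
  obtain ⟨M, hMH, hMd, -, hMc⟩ := hM.exists_matching
  exact ⟨M, hMH, hMd, fun v => hMc v (mem_univ v)⟩
end

section
/- For every η > 0 there is an integer n₀ = n₀(η) such that: if H is a 3-graph on n ≥ n₀ vertices with δ₁(H) ≥ (1/2 + 2η)·C(n,2), then there exists a matching M in H of size |M| ≤ η³·n such that for every set W ⊆ V ∖ V(M) with |W| ≤ η⁶·n and |W| divisible by 3, there exists a matching in H covering exactly the vertex set V(M) ∪ W. -/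
open Finset in
theorem Finset.card_filter_not_disjoint_pair_le {V : Type} [Fintype V] [DecidableEq V]
    (B : Finset V) :
    #{P ∈ powersetCard 2 (univ : Finset V) | ¬ Disjoint P B} ≤ #B * Fintype.card V := by
  have h : {P ∈ powersetCard 2 (univ : Finset V) | ¬ Disjoint P B} ⊆
      (B ×ˢ univ).image fun x : V × V => {x.1, x.2} := by
    intro P hP
    simp only [mem_filter, mem_powersetCard, subset_univ, true_and, not_disjoint_iff] at hP
    obtain ⟨hP, b, hbP, hb⟩ := hP
    obtain ⟨x, y, -, rfl⟩ := card_eq_two.1 hP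
    simp only [mem_image, mem_product, mem_univ, and_true, Prod.exists]
    rcases mem_insert.1 hbP with rfl | h
    · exact ⟨b, y, hb, rfl⟩
    · rw [mem_singleton] at h
      subst h
      exact ⟨b, x, hb, pair_comm _ _⟩
  calc _ ≤ _ := card_le_card h
    _ ≤ _ := card_image_le
    _ = _ := by rw [card_product, card_univ]

open Finset in
theorem Finset.card_mul_le_card_of_fibers {α β : Type*} [DecidableEq α] [DecidableEq β]
    (s : Finset (α × β)) (a : Finset α) (q : ℝ) (b : α → Finset β)
    (hb : ∀ x ∈ a, q ≤ #(b x)) (hs : ∀ x ∈ a, ∀ y ∈ b x, (x, y) ∈ s) :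
    (#a : ℝ) * q ≤ #s := by
  have h : #(a.sigma b) ≤ #s := by
    refine card_le_card_of_injOn (fun z => (z.1, z.2)) ?_ ?_
    · rintro ⟨x, y⟩ hz
      have hz := mem_sigma.1 (mem_coe.1 hz)
      exact hs x hz.1 y hz.2
    · rintro ⟨x, y⟩ - ⟨x', y'⟩ - h
      simp only [Prod.mk.injEq] at h
      obtain ⟨rfl, rfl⟩ := h
      rfl
  calc (#a : ℝ) * q ≤ ∑ x ∈ a, (#(b x) : ℝ) := by
        rw [← nsmul_eq_mul]; exact card_nsmul_le_sum _ _ _ hb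
    _ = (#(a.sigma b) : ℝ) := by rw [card_sigma]; push_cast; rfl
    _ ≤ #s := by exact_mod_cast h

open Finset in
theorem Finset.exists_weighted_sum_le {α β : Type*} (Ω : Finset α) (𝒯 : Finset β)
    (R : α → β → Prop) [∀ a b, Decidable (R a b)] (w : β → ℝ) (hw : ∀ t ∈ 𝒯, 0 ≤ w t)
    (p : ℝ) (hΩ : Ω.Nonempty) (h : ∀ t ∈ 𝒯, p * #Ω ≤ #{x ∈ Ω | R x t}) :
    ∃ x ∈ Ω, p * ∑ t ∈ 𝒯, w t ≤ ∑ t ∈ 𝒯 with R x t, w t := by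
  refine exists_le_of_sum_le hΩ ?_
  calc ∑ x ∈ Ω, p * ∑ t ∈ 𝒯, w t = ∑ t ∈ 𝒯, (p * #Ω) * w t := by
        rw [sum_const, nsmul_eq_mul, ← mul_sum]; ring
    _ ≤ ∑ t ∈ 𝒯, (#{x ∈ Ω | R x t} : ℝ) * w t :=
        sum_le_sum fun t ht => mul_le_mul_of_nonneg_right (h t ht) (hw t ht)
    _ = ∑ t ∈ 𝒯, ∑ x ∈ Ω, if R x t then w t else 0 := by
        refine sum_congr rfl fun t _ => ?_
        rw [← sum_filter, sum_const, nsmul_eq_mul]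
    _ = ∑ x ∈ Ω, ∑ t ∈ 𝒯 with R x t, w t := by
        rw [sum_comm]
        simp_rw [sum_filter]

namespace ThreeGraph

open Finset

variable {V : Type} [DecidableEq V]

/-- `X` is the vertex set of a matching in `H`. -/
def IsMatchable (H : Finset (Finset V)) (X : Finset V) : Prop :=
  ∃ M : Finset (Finset V), M ⊆ H ∧
    (M : Set (Finset V)).Pairwise (fun e f => Disjoint e f) ∧ M.biUnion id = X

variable {H : Finset (Finset V)}

theorem isMatchable_empty : IsMatchable H ∅ := ⟨∅, by simp, by simp, by simp⟩

theorem isMatchable_of_mem {e : Finset V} (he : e ∈ H) : IsMatchable H e :=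
  ⟨{e}, by simpa using he, by simp, by simp⟩

theorem IsMatchable.union {X Y : Finset V} (hX : IsMatchable H X) (hY : IsMatchable H Y)
    (hXY : Disjoint X Y) : IsMatchable H (X ∪ Y) := by
  obtain ⟨M, hM, hMd, rfl⟩ := hX
  obtain ⟨N, hN, hNd, rfl⟩ := hY
  have key : ∀ e ∈ M, ∀ f ∈ N, Disjoint e f := fun e he f hf =>
    hXY.mono (subset_biUnion_of_mem id he) (subset_biUnion_of_mem id hf)
  refine ⟨M ∪ N, union_subset hM hN, ?_, union_biUnion⟩
  intro e he f hf hef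
  simp only [coe_union, Set.mem_union, mem_coe] at he hf
  rcases he with he | he <;> rcases hf with hf | hf
  · exact hMd he hf hef
  · exact key e he f hf
  · exact (key f hf e he).symm
  · exact hNd he hf hef

theorem isMatchable_biUnion (𝒜 : Finset (Finset V))
    (hd : (𝒜 : Set (Finset V)).Pairwise (fun e f => Disjoint e f))
    (hm : ∀ A ∈ 𝒜, IsMatchable H A) : IsMatchable H (𝒜.biUnion id) := by
  induction 𝒜 using Finset.induction_on with
  | empty => simpa using isMatchable_empty
  | insert A 𝒜 hA ih =>
    rw [biUnion_insert]
    refine (hm A (mem_insert_self _ _)).union (ih (hd.mono (by simp))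
      fun B hB => hm B (mem_insert_of_mem hB)) ?_
    rw [disjoint_biUnion_right]
    intro B hB
    exact hd (by simp) (by simp [hB]) (by rintro rfl; exact hA hB)

open Classical in
theorem isMatchable_biUnion_union (k : ℕ) (𝒜 : Finset (Finset V)) (W : Finset V)
    (hd : (𝒜 : Set (Finset V)).Pairwise (fun e f => Disjoint e f))
    (hm : ∀ A ∈ 𝒜, IsMatchable H A)
    (habs : ∀ T : Finset V, #T = 3 → k ≤ #{A ∈ 𝒜 | IsMatchable H (A ∪ T)})
    (hW : Disjoint W (𝒜.biUnion id)) (hWk : #W = 3 * k) :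
    IsMatchable H (𝒜.biUnion id ∪ W) := by
  induction k generalizing 𝒜 W with
  | zero =>
    rw [card_eq_zero.1 hWk, union_empty]
    exact isMatchable_biUnion 𝒜 hd hm
  | succ k ih =>
    obtain ⟨T, hTW, hT⟩ := exists_subset_card_eq (show 3 ≤ #W by omega)
    obtain ⟨A, hA⟩ := card_pos.1 ((Nat.succ_pos k).trans_le (habs T hT))
    rw [mem_filter] at hA
    have hdA : ∀ B ∈ 𝒜.erase A, Disjoint A B := fun B hB =>
      hd hA.1 (mem_of_mem_erase hB) (ne_of_mem_erase hB).symm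
    have hWA : ∀ B ∈ 𝒜, Disjoint W B := by
      rw [disjoint_biUnion_right] at hW
      exact hW
    have h := ih (𝒜.erase A) (W \ T) (hd.mono (by simp))
      (fun B hB => hm B (mem_of_mem_erase hB))
      (fun T' hT' => by
        have h1 := habs T' hT'
        rw [filter_erase]
        have h2 := pred_card_le_card_erase (s := {B ∈ 𝒜 | IsMatchable H (B ∪ T')}) (a := A)
        omega)
      (by
        rw [disjoint_biUnion_right]
        exact fun B hB => (hWA B (mem_of_mem_erase hB)).mono_left sdiff_subset)
      (by rw [card_sdiff_of_subset hTW]; omega)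
    have hU := hA.2.union h (by
      rw [disjoint_union_left, disjoint_union_right, disjoint_union_right,
        disjoint_biUnion_right, disjoint_biUnion_right]
      exact ⟨⟨hdA, ((hWA A hA.1).mono_left sdiff_subset).symm⟩,
        fun B hB => (hWA B (mem_of_mem_erase hB)).mono_left hTW, disjoint_sdiff⟩)
    convert hU using 1
    conv_lhs => rw [← insert_erase hA.1, biUnion_insert, ← union_sdiff_of_subset hTW]
    simp only [id]
    ac_rfl

variable [Fintype V]

/-- The link of `v`: the pairs that form an edge of `H` together with `v`. -/
def link (H : Finset (Finset V)) (v : V) : Finset (Finset V) :=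
  {P ∈ powersetCard 2 univ | v ∉ P ∧ insert v P ∈ H}

theorem card_filter_mem_le_card_link (h3 : ∀ e ∈ H, #e = 3) (v : V) :
    #{e ∈ H | v ∈ e} ≤ #(link H v) := by
  refine card_le_card_of_injOn (fun e => e.erase v) ?_ ?_
  · intro e he
    have he := mem_filter.1 (mem_coe.1 he)
    simp [link, insert_erase he.2, he.1, card_erase_of_mem he.2, h3 e he.1]
  · intro e he f hf hef
    have he := mem_filter.1 (mem_coe.1 he)
    have hf := mem_filter.1 (mem_coe.1 hf)
    rw [← insert_erase he.2, ← insert_erase hf.2]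
    exact congrArg _ hef

theorem card_link_le (v : V) : #(link H v) ≤ (Fintype.card V).choose 2 := by
  rw [← card_univ, ← card_powersetCard]
  exact card_filter_le _ _

theorem card_link_add_card_link_le (u v : V) :
    #(link H u) + #(link H v) ≤ (Fintype.card V).choose 2 + #(link H u ∩ link H v) := by
  rw [← card_union_add_card_inter, ← card_univ, ← card_powersetCard]
  gcongr
  exact union_subset (filter_subset _ _) (filter_subset _ _)

theorem card_le_card_filter_disjoint_add (L : Finset (Finset V))
    (hL : L ⊆ powersetCard 2 univ) (B : Finset V) :
    #L ≤ #{P ∈ L | Disjoint P B} + #B * Fintype.card V := by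
  rw [← card_filter_add_card_filter_not (s := L) (fun P => Disjoint P B)]
  gcongr
  exact (card_le_card (filter_subset_filter _ hL)).trans (card_filter_not_disjoint_pair_le B)

theorem link_subset (v : V) : link H v ⊆ powersetCard 2 univ := filter_subset _ _

open Classical in
/-- The triples of pairs whose union is a matchable set of six vertices avoiding `S`. -/
noncomputable def absorbers (H : Finset (Finset V)) (S : Finset V) :
    Finset (Finset V × Finset V × Finset V) :=
  {x ∈ powersetCard 2 univ ×ˢ powersetCard 2 univ ×ˢ powersetCard 2 univ |
    #(x.1 ∪ x.2.1 ∪ x.2.2) = 6 ∧ Disjoint (x.1 ∪ x.2.1 ∪ x.2.2) S ∧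
      IsMatchable H (x.1 ∪ x.2.1 ∪ x.2.2)}

open Classical in
theorem card_absorbers_le (S : Finset V) :
    #(absorbers H S) ≤ (Fintype.card V).choose 2 ^ 3 := by
  refine (card_filter_le _ _).trans_eq ?_
  simp only [card_product, card_powersetCard, card_univ]
  ring

theorem mem_absorbers_of_links {S : Finset V} {u w x y z : V} {P Q : Finset V}
    (hR : {u, w} ∈ link H x) (hRS : Disjoint {u, w} (S ∪ {x, y, z}))
    (hT : #({x, y, z} : Finset V) = 3)
    (hP : P ∈ link H y ∩ link H u) (hPS : Disjoint P (S ∪ {x, y, z} ∪ {u, w}))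
    (hQ : Q ∈ link H z ∩ link H w) (hQS : Disjoint Q (S ∪ {x, y, z} ∪ {u, w} ∪ P)) :
    ({u, w}, P, Q) ∈ absorbers H S ∧ IsMatchable H ({u, w} ∪ P ∪ Q ∪ {x, y, z}) := by
  have huw : u ≠ w := by
    rintro rfl
    simp [link] at hR
  have hxyz : x ≠ y ∧ x ≠ z ∧ y ≠ z := by
    refine ⟨?_, ?_, ?_⟩ <;> rintro rfl
    · rw [insert_eq_of_mem (by simp)] at hT
      have := card_le_two (a := x) (b := z)
      omega
    · rw [insert_eq_of_mem (by simp)] at hT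
      have := card_le_two (a := y) (b := x)
      omega
    · rw [pair_eq_singleton] at hT
      have := card_le_two (a := x) (b := y)
      omega
  obtain ⟨hxy, hxz, hyz⟩ := hxyz
  simp only [link, mem_inter, mem_filter, mem_powersetCard, subset_univ, true_and] at hR hP hQ
  obtain ⟨-, -, hRH⟩ := hR
  obtain ⟨⟨hP2, -, hyP⟩, -, huP, huPH⟩ := hP
  obtain ⟨⟨hQ2, -, hzQ⟩, -, hwQ, hwQH⟩ := hQ
  simp only [disjoint_union_right] at hRS hPS hQS
  obtain ⟨hRS, hRT⟩ := hRS
  obtain ⟨⟨hPS, hPT⟩, hPR⟩ := hPS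
  obtain ⟨⟨⟨hQS, hQT⟩, hQR⟩, hQP⟩ := hQS
  constructor
  · simp only [absorbers, mem_filter, mem_product, mem_powersetCard, subset_univ, true_and]
    refine ⟨⟨card_pair huw, hP2, hQ2⟩, ?_, ?_, ?_⟩
    · rw [card_union_of_disjoint (disjoint_union_left.2 ⟨hQR.symm, hQP.symm⟩),
        card_union_of_disjoint hPR.symm, card_pair huw, hP2, hQ2]
    · simp only [disjoint_union_left]
      exact ⟨⟨hRS, hPS⟩, hQS⟩
    · have h := (isMatchable_of_mem huPH).union (isMatchable_of_mem hwQH) (by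
        simp only [disjoint_insert_left, disjoint_insert_right, disjoint_singleton_right,
          mem_insert] at hPR hQR ⊢
        grind)
      convert h using 1
      ext a
      simp only [mem_union, mem_insert, mem_singleton]
      tauto
  · simp only [disjoint_insert_right, disjoint_singleton_right, mem_insert, mem_singleton]
      at hPR hQR hPT hQT hRT
    have h := ((isMatchable_of_mem hRH).union (isMatchable_of_mem hyP) (by
        simp only [disjoint_insert_left, disjoint_insert_right, disjoint_singleton_left,
          mem_insert, mem_singleton]
        grind)).union (isMatchable_of_mem hzQ) (by
        simp only [disjoint_union_left, disjoint_insert_left, disjoint_insert_right,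
          disjoint_singleton_left]
        grind)
    convert h using 1
    ext a
    simp only [mem_union, mem_insert, mem_singleton]
    tauto

open Classical in
theorem card_absorbing_ge {η : ℝ} {S T : Finset V} (hT : #T = 3)
    (hη : 0 < η) (hη4 : η ≤ 1 / 4)
    (hn : 10 / η ≤ (Fintype.card V : ℝ)) (h3 : ∀ e ∈ H, #e = 3)
    (hdeg : ∀ v : V, (1 / 2 + 2 * η) * ((Fintype.card V).choose 2 : ℝ) ≤ #{e ∈ H | v ∈ e})
    (hS : (#S : ℝ) ≤ 3 * η ^ 3 * Fintype.card V) :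
    η ^ 3 * (Fintype.card V : ℝ) ^ 6 ≤
      #{x ∈ absorbers H S | IsMatchable H (x.1 ∪ x.2.1 ∪ x.2.2 ∪ T)} := by
  obtain ⟨x, y, z, -, -, -, rfl⟩ := card_eq_three.1 hT
  set n : ℝ := (Fintype.card V : ℝ) with hndef
  have hnη : 10 ≤ η * n := by rwa [div_le_iff₀' hη] at hn
  have hn0 : 0 < n := lt_of_lt_of_le (by positivity) hn
  have hch : ((Fintype.card V).choose 2 : ℝ) = n * (n - 1) / 2 := Nat.cast_choose_two ℝ _
  have hlink : ∀ v, (1 / 2 + 2 * η) * (n * (n - 1) / 2) ≤ #(link H v) := fun v => by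
    rw [← hch]
    exact (hdeg v).trans (by exact_mod_cast card_filter_mem_le_card_link h3 v)
  have hcommon : ∀ u v, 4 * η * (n * (n - 1) / 2) ≤ #(link H u ∩ link H v) := fun u v => by
    have h : (#(link H u) : ℝ) + #(link H v) ≤
        (Fintype.card V).choose 2 + #(link H u ∩ link H v) := by
      exact_mod_cast card_link_add_card_link_le u v
    rw [hch] at h
    linarith [hlink u, hlink v]
  have hη3 : η ^ 3 ≤ η / 16 := by nlinarith [mul_pos hη hη]
  have hη3n : η ^ 3 * n ≤ η * n / 16 := by nlinarith
  have hcommon' : ∀ u v (B : Finset V), #B ≤ #S + 7 →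
      η * n ^ 2 ≤ #{P ∈ link H u ∩ link H v | Disjoint P B} := fun u v B hB => by
    have h : (#(link H u ∩ link H v) : ℝ) ≤
        #{P ∈ link H u ∩ link H v | Disjoint P B} + #B * n := by
      rw [hndef]
      exact_mod_cast card_le_card_filter_disjoint_add (link H u ∩ link H v)
        (inter_subset_left.trans (link_subset u)) B
    have hB' : (#B : ℝ) ≤ #S + 7 := by exact_mod_cast hB
    have h2 : (#B : ℝ) * n ≤ (3 * (η * n / 16) + 7) * n := by gcongr; linarith
    have h4 := hcommon u v
    have h5 : 0 ≤ (η * n - 10) * n := mul_nonneg (by linarith) hn0.le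
    have h6 : 0 ≤ (1 / 4 - η) * n := mul_nonneg (by linarith) hn0.le
    nlinarith
  have hfirst : n ^ 2 / 4 ≤ #{P ∈ link H x | Disjoint P (S ∪ {x, y, z})} := by
    have h : (#(link H x) : ℝ) ≤
        #{P ∈ link H x | Disjoint P (S ∪ {x, y, z})} + #(S ∪ {x, y, z}) * n := by
      rw [hndef]
      exact_mod_cast card_le_card_filter_disjoint_add (link H x) (link_subset x) (S ∪ {x, y, z})
    have hB' : (#(S ∪ {x, y, z}) : ℝ) ≤ #S + 3 := by
      exact_mod_cast (card_union_le _ _).trans (by rw [hT])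
    have h2 : (#(S ∪ {x, y, z}) : ℝ) * n ≤ (3 * (η * n / 16) + 3) * n := by gcongr; linarith
    have h4 := hlink x
    have h5 : 0 ≤ (η * n - 10) * n := mul_nonneg (by linarith) hn0.le
    have h6 : 0 ≤ (1 / 4 - η) * n := mul_nonneg (by linarith) hn0.le
    nlinarith
  have hfibers : (#{P ∈ link H x | Disjoint P (S ∪ {x, y, z})} : ℝ) *
      (η * n ^ 2 * (η * n ^ 2)) ≤
        #{t ∈ absorbers H S | IsMatchable H (t.1 ∪ t.2.1 ∪ t.2.2 ∪ {x, y, z})} := by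
    refine card_mul_le_card_of_fibers _ _ _
      (fun R => {t ∈ univ | (R, t) ∈ absorbers H S ∧
        IsMatchable H (R ∪ t.1 ∪ t.2 ∪ {x, y, z})}) ?_ ?_
    · intro R hR
      rw [mem_filter] at hR
      have hR2 : #R = 2 := (mem_powersetCard.1 (link_subset x hR.1)).2
      obtain ⟨u, w, -, rfl⟩ := card_eq_two.1 hR2
      have hc1 := card_union_le S {x, y, z}
      have hc2 := card_union_le (S ∪ {x, y, z}) {u, w}
      rw [hT] at hc1
      rw [hR2] at hc2
      refine (mul_le_mul_of_nonneg_right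
        (hcommon' y u (S ∪ {x, y, z} ∪ {u, w}) (by omega)) (by positivity)).trans ?_
      refine card_mul_le_card_of_fibers _ _ _
        (fun P => {Q ∈ link H z ∩ link H w | Disjoint Q (S ∪ {x, y, z} ∪ {u, w} ∪ P)}) ?_ ?_
      · intro P hP
        rw [mem_filter, mem_inter] at hP
        have hP2 : #P = 2 := (mem_powersetCard.1 (link_subset y hP.1.1)).2
        have hc3 := card_union_le (S ∪ {x, y, z} ∪ {u, w}) P
        exact hcommon' z w _ (by omega)
      · intro P hP Q hQ
        rw [mem_filter] at hP hQ
        rw [mem_filter]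
        exact ⟨mem_univ _,
          mem_absorbers_of_links hR.1 hR.2 hT hP.1 hP.2 hQ.1 hQ.2⟩
    · intro R _ t ht
      rw [mem_filter] at ht ⊢
      exact ht.2
  refine le_trans ?_ hfibers
  calc η ^ 3 * n ^ 6 = η * (η * n ^ 3) ^ 2 := by ring
    _ ≤ 1 / 4 * (η * n ^ 3) ^ 2 := by gcongr
    _ = n ^ 2 / 4 * (η * n ^ 2 * (η * n ^ 2)) := by ring
    _ ≤ _ := by gcongr

open Classical in
theorem exists_absorber {η : ℝ} {S : Finset V}
    (hη : 0 < η) (hη4 : η ≤ 1 / 4)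
    (hn : 10 / η ≤ (Fintype.card V : ℝ)) (h3 : ∀ e ∈ H, #e = 3)
    (hdeg : ∀ v : V, (1 / 2 + 2 * η) * ((Fintype.card V).choose 2 : ℝ) ≤ #{e ∈ H | v ∈ e})
    (hS : (#S : ℝ) ≤ 3 * η ^ 3 * Fintype.card V) (w : Finset V → ℝ) (hw : ∀ T, 0 ≤ w T) :
    ∃ A : Finset V, #A = 6 ∧ IsMatchable H A ∧ Disjoint A S ∧
      8 * η ^ 3 * ∑ T ∈ powersetCard 3 univ, w T ≤
        ∑ T ∈ powersetCard 3 univ with IsMatchable H (A ∪ T), w T := by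
  have hn40 : (40 : ℝ) ≤ Fintype.card V := le_trans (by rw [le_div_iff₀ hη]; linarith) hn
  have hcard : 3 ≤ #(univ : Finset V) := by
    have : (3 : ℝ) ≤ Fintype.card V := by linarith
    rw [card_univ]; exact_mod_cast this
  have hcount : ∀ T ∈ powersetCard 3 (univ : Finset V),
      η ^ 3 * (Fintype.card V : ℝ) ^ 6 ≤
        #{x ∈ absorbers H S | IsMatchable H (x.1 ∪ x.2.1 ∪ x.2.2 ∪ T)} := fun T hT =>
    card_absorbing_ge (mem_powersetCard.1 hT).2 hη hη4 hn h3 hdeg hS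
  have hne : (absorbers H S).Nonempty := by
    obtain ⟨T, hT⟩ := powersetCard_nonempty.2 hcard
    have h : (0 : ℝ) < #{x ∈ absorbers H S | IsMatchable H (x.1 ∪ x.2.1 ∪ x.2.2 ∪ T)} :=
      lt_of_lt_of_le (by positivity) (hcount T hT)
    exact (card_pos.1 (by exact_mod_cast h)).mono (filter_subset _ _)
  have hupper : 8 * (#(absorbers H S) : ℝ) ≤ (Fintype.card V : ℝ) ^ 6 := by
    have h : (#(absorbers H S) : ℝ) ≤ ((Fintype.card V).choose 2 : ℝ) ^ 3 := by
      exact_mod_cast card_absorbers_le S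
    have h' : ((Fintype.card V).choose 2 : ℝ) ≤ (Fintype.card V : ℝ) ^ 2 / 2 := by
      rw [Nat.cast_choose_two]; nlinarith
    have h'' : ((Fintype.card V).choose 2 : ℝ) ^ 3 ≤ ((Fintype.card V : ℝ) ^ 2 / 2) ^ 3 := by
      gcongr
    nlinarith
  obtain ⟨x, hx, hxw⟩ := exists_weighted_sum_le (absorbers H S) (powersetCard 3 univ)
    (fun x T => IsMatchable H (x.1 ∪ x.2.1 ∪ x.2.2 ∪ T)) w (fun T _ => hw T) (8 * η ^ 3) hne
    (fun T hT => le_trans (by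
      calc 8 * η ^ 3 * (#(absorbers H S) : ℝ) = η ^ 3 * (8 * #(absorbers H S)) := by ring
        _ ≤ _ := by gcongr) (hcount T hT))
  have hx' := (mem_filter.1 hx).2
  exact ⟨x.1 ∪ x.2.1 ∪ x.2.2, hx'.1, hx'.2.2, hx'.2.1, hxw⟩

open Classical in
theorem exists_absorbing_family {η : ℝ} (hη : 0 < η) (hη4 : η ≤ 1 / 4)
    (hn : 10 / η ≤ (Fintype.card V : ℝ)) (h3 : ∀ e ∈ H, #e = 3)
    (hdeg : ∀ v : V, (1 / 2 + 2 * η) * ((Fintype.card V).choose 2 : ℝ) ≤ #{e ∈ H | v ∈ e})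
    (m : ℕ) (hm : (2 * m : ℝ) ≤ η ^ 3 * Fintype.card V) :
    ∃ 𝒜 : Finset (Finset V), #𝒜 = m ∧
      (𝒜 : Set (Finset V)).Pairwise (fun e f => Disjoint e f) ∧
      (∀ A ∈ 𝒜, #A = 6 ∧ IsMatchable H A) ∧
      ∑ T ∈ powersetCard 3 univ, (1 / 2 : ℝ) ^ #{A ∈ 𝒜 | IsMatchable H (A ∪ T)} ≤
        (1 - 4 * η ^ 3) ^ m * (Fintype.card V : ℝ) ^ 3 := by
  induction m with
  | zero =>
    refine ⟨∅, rfl, by simp, by simp, ?_⟩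
    simp only [filter_empty, card_empty, pow_zero, sum_const, card_powersetCard, card_univ,
      nsmul_eq_mul, mul_one, one_mul]
    exact_mod_cast Nat.choose_le_pow _ _
  | succ m ih =>
    push_cast at hm
    obtain ⟨𝒜, hcard, hd, hA, hsum⟩ := ih (by linarith)
    have hS : (#(𝒜.biUnion id) : ℝ) ≤ 3 * η ^ 3 * Fintype.card V := by
      have h : #(𝒜.biUnion id) ≤ #𝒜 * 6 :=
        card_biUnion_le_card_mul _ _ _ fun A h => (hA A h).1.le
      have h' : (#(𝒜.biUnion id) : ℝ) ≤ m * 6 := by rw [← hcard]; exact_mod_cast h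
      linarith
    obtain ⟨A, hA6, hAm, hAS, hAw⟩ := exists_absorber hη hη4 hn h3 hdeg hS
      (fun T => (1 / 2 : ℝ) ^ #{A ∈ 𝒜 | IsMatchable H (A ∪ T)}) (fun T => by positivity)
    rw [disjoint_biUnion_right] at hAS
    have hA𝒜 : A ∉ 𝒜 := fun h => by
      have := disjoint_self.1 (hAS A h)
      rw [bot_eq_empty] at this
      simp [this] at hA6
    refine ⟨insert A 𝒜, by rw [card_insert_of_notMem hA𝒜, hcard], ?_, ?_, ?_⟩
    · rw [coe_insert, Set.pairwise_insert]
      exact ⟨hd, fun B hB _ => ⟨hAS B hB, (hAS B hB).symm⟩⟩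
    · intro B hB
      rcases mem_insert.1 hB with rfl | hB
      · exact ⟨hA6, hAm⟩
      · exact hA B hB
    · have hstep : ∀ T : Finset V,
          (1 / 2 : ℝ) ^ #{B ∈ insert A 𝒜 | IsMatchable H (B ∪ T)} =
          (1 / 2 : ℝ) ^ #{B ∈ 𝒜 | IsMatchable H (B ∪ T)} - 1 / 2 *
            if IsMatchable H (A ∪ T) then (1 / 2 : ℝ) ^ #{B ∈ 𝒜 | IsMatchable H (B ∪ T)}
              else 0 := by
        intro T
        rw [filter_insert]
        split_ifs with h
        · rw [card_insert_of_notMem (by simp [hA𝒜]), pow_succ]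
          ring
        · ring
      simp_rw [hstep]
      rw [sum_sub_distrib, ← mul_sum, ← sum_filter]
      have h1 : 0 ≤ 1 - 4 * η ^ 3 := by
        have : η ^ 3 ≤ (1 / 4) ^ 3 := by gcongr
        norm_num at this
        linarith
      calc _ ≤ (1 - 4 * η ^ 3) * ∑ T ∈ powersetCard 3 univ,
            (1 / 2 : ℝ) ^ #{A ∈ 𝒜 | IsMatchable H (A ∪ T)} := by linarith
        _ ≤ (1 - 4 * η ^ 3) * ((1 - 4 * η ^ 3) ^ m * (Fintype.card V : ℝ) ^ 3) := by gcongr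
        _ = _ := by ring

theorem le_of_half_pow_le {η : ℝ} (hη4 : η ≤ 1 / 4) {n m k X : ℕ} (hn : 0 < n)
    (hm : η ^ 3 * n ≤ 2 * m + 2) (hη : 0 < η)
    (hk : (3 * k : ℝ) ≤ η ^ 6 * n)
    (hlog : 3 * Real.log n + 1 ≤ η ^ 6 * n)
    (hX : (1 / 2 : ℝ) ^ X ≤ (1 - 4 * η ^ 3) ^ m * (n : ℝ) ^ 3) : k ≤ X := by
  by_contra! hlt
  have hη3 : η ^ 3 ≤ 1 / 64 := by
    calc η ^ 3 ≤ (1 / 4) ^ 3 := by gcongr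
      _ = _ := by norm_num
  have h1 : Real.exp (-X) ≤ (1 / 2 : ℝ) ^ X := by
    rw [← mul_neg_one, Real.exp_nat_mul]
    gcongr
    rw [Real.exp_neg, one_div]
    gcongr
    linarith [Real.add_one_le_exp 1]
  have h2 : (1 - 4 * η ^ 3) ^ m ≤ Real.exp (-(4 * η ^ 3 * m)) := by
    rw [show -(4 * η ^ 3 * m) = m * (-(4 * η ^ 3)) by ring, Real.exp_nat_mul]
    gcongr
    · linarith
    · linarith [Real.add_one_le_exp (-(4 * η ^ 3))]
  have h3 : (n : ℝ) ^ 3 = Real.exp (3 * Real.log n) := by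
    rw [show (3 : ℝ) * Real.log n = ((3 : ℕ) : ℝ) * Real.log n by norm_num, Real.exp_nat_mul,
      Real.exp_log (by exact_mod_cast hn)]
  have h4 : Real.exp (-X) ≤ Real.exp (-(4 * η ^ 3 * m) + 3 * Real.log n) := by
    rw [Real.exp_add, ← h3]
    exact h1.trans (hX.trans (by gcongr))
  have h5 := Real.exp_le_exp.1 h4
  have h6 : (X : ℝ) + 1 ≤ k := by exact_mod_cast hlt
  have h7 : η ^ 3 * (η ^ 3 * n) ≤ η ^ 3 * (2 * m + 2) := by gcongr
  have h8 : η ^ 3 * (η ^ 3 * n) = η ^ 6 * n := by ring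
  have h9 : 0 ≤ Real.log n := Real.log_natCast_nonneg n
  nlinarith

end ThreeGraph

/-- Absorbing Lemma: for every `η > 0` there is `n₀` such that every 3-graph `H` on
`n ≥ n₀` vertices with `δ₁(H) ≥ (1/2 + 2η)·C(n,2)` contains a matching `M` of size
`|M| ≤ η³n` such that every set `W` of at most `η⁶n` vertices outside `V(M)` with
`3 ∣ |W|` can be absorbed: there is a matching covering exactly `V(M) ∪ W`. -/
theorem stmt2 :
    ∀ η : ℝ, 0 < η → ∃ n₀ : ℕ, ∀ n : ℕ, n₀ ≤ n →
    ∀ (V : Type) [Fintype V] [DecidableEq V], Fintype.card V = n →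
    ∀ H : Finset (Finset V), (∀ e ∈ H, e.card = 3) →
    (∀ v : V, (1 / 2 + 2 * η) * (n.choose 2 : ℝ) ≤ ((H.filter fun e => v ∈ e).card : ℝ)) →
    ∃ M : Finset (Finset V), M ⊆ H ∧
      (M : Set (Finset V)).Pairwise (fun e f => Disjoint e f) ∧
      (M.card : ℝ) ≤ η ^ 3 * n ∧
      ∀ W : Finset V, Disjoint W (M.biUnion id) → (W.card : ℝ) ≤ η ^ 6 * n → 3 ∣ W.card →
        ∃ M' : Finset (Finset V), M' ⊆ H ∧
          (M' : Set (Finset V)).Pairwise (fun e f => Disjoint e f) ∧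
          M'.biUnion id = M.biUnion id ∪ W := by
  classical
  intro η hη
  have hev : ∀ᶠ n : ℕ in Filter.atTop, 3 * Real.log n + 1 ≤ η ^ 6 * n := by
    have h := (Asymptotics.isLittleO_const_id_atTop (1 : ℝ)).add
      (Real.isLittleO_log_id_atTop.const_mul_left 3)
    have h' := h.bound (show 0 < η ^ 6 by positivity)
    filter_upwards [tendsto_natCast_atTop_atTop.eventually h'] with n hn
    simp only [id, Real.norm_eq_abs, abs_of_nonneg (Nat.cast_nonneg (α := ℝ) n)] at hn
    linarith [le_abs_self (1 + 3 * Real.log n)]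
  have hev' : ∀ᶠ n : ℕ in Filter.atTop, 10 / η ≤ (n : ℝ) :=
    tendsto_natCast_atTop_atTop.eventually_ge_atTop _
  obtain ⟨n₀, hn₀⟩ := Filter.eventually_atTop.1
    ((hev.and hev').and (Filter.eventually_ge_atTop 2))
  refine ⟨n₀, fun n hn V _ _ hV H h3 hdeg => ?_⟩
  subst hV
  obtain ⟨⟨hlog, hlarge⟩, hn2⟩ := hn₀ _ hn
  have hη4 : η ≤ 1 / 4 := by
    obtain ⟨v⟩ : Nonempty V := Fintype.card_pos_iff.1 (by omega)
    have h1 : (1 / 2 + 2 * η) * ((Fintype.card V).choose 2 : ℝ) ≤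
        1 * ((Fintype.card V).choose 2 : ℝ) := by
      rw [one_mul]
      exact (hdeg v).trans (by exact_mod_cast
        (ThreeGraph.card_filter_mem_le_card_link h3 v).trans (ThreeGraph.card_link_le v))
    have h2 : (0 : ℝ) < (Fintype.card V).choose 2 := by exact_mod_cast Nat.choose_pos hn2
    linarith [le_of_mul_le_mul_right h1 h2]
  set m : ℕ := ⌊η ^ 3 * (Fintype.card V : ℝ) / 2⌋₊
  have hm : (2 * m : ℝ) ≤ η ^ 3 * Fintype.card V := by
    have := Nat.floor_le (show 0 ≤ η ^ 3 * (Fintype.card V : ℝ) / 2 by positivity)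
    linarith
  have hm' : η ^ 3 * (Fintype.card V : ℝ) ≤ 2 * m + 2 := by
    have := (Nat.lt_floor_add_one (η ^ 3 * (Fintype.card V : ℝ) / 2)).le
    linarith
  obtain ⟨𝒜, hcard, hd, hA, hsum⟩ :=
    ThreeGraph.exists_absorbing_family hη hη4 hlarge h3 hdeg m hm
  obtain ⟨M, hMH, hMd, hM⟩ :=
    ThreeGraph.isMatchable_biUnion 𝒜 hd fun A h => (hA A h).2
  refine ⟨M, hMH, hMd, ?_, ?_⟩
  · have h1 : (M.biUnion id).card ≤ 𝒜.card * 6 := by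
      rw [hM]
      exact Finset.card_biUnion_le_card_mul _ _ _ fun A h => (hA A h).1.le
    have h2 : (M.biUnion id).card = M.card * 3 := by
      rw [Finset.card_biUnion (t := id) (fun e he f hf hef => hMd he hf hef)]
      exact Finset.sum_const_nat fun e he => h3 e (hMH he)
    have h4 : M.card ≤ 2 * m := by omega
    have h5 : (M.card : ℝ) ≤ 2 * m := by exact_mod_cast h4
    linarith
  · rintro W hWM hW ⟨k, hk⟩
    rw [hM] at hWM ⊢
    refine ThreeGraph.isMatchable_biUnion_union k 𝒜 W hd (fun A h => (hA A h).2) ?_ hWM hk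
    intro T hT
    refine ThreeGraph.le_of_half_pow_le hη4 (by omega) hm' hη ?_ hlog (le_trans ?_ hsum)
    · rw [hk] at hW
      exact_mod_cast hW
    · exact Finset.single_le_sum
        (f := fun T => (1 / 2 : ℝ) ^
          (𝒜.filter fun A => ThreeGraph.IsMatchable H (A ∪ T)).card)
        (fun T _ => by positivity)
        (Finset.mem_powersetCard.2 ⟨Finset.subset_univ T, hT⟩)
end
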